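/- arXiv:2211.13397 — 3 statements merged into one kernel-verified Lean document; each statement's English description precedes it below -/
import Mathlib

section
/- Let k be a positive integer. If G is a hyperbolic group that admits a finite inverse-closed generating set S such that the Cayley graph Cay(G,S) is k-geodetic, then G is virtually free, i.e. G has a free subgroup of finite index. -/
/-- A connected simple graph is `k`-geodetic if between any pair of vertices there are
at most `k` geodesics (walks of minimal length between their endpoints). -/
def IsKGeodetic {V : Type*} (X : SimpleGraph V) (k : ℕ) : Prop :=
  X.Connected ∧ ∀ (u v : V) (s : Finset (X.Walk u v)),
    (∀ p ∈ s, p.length = X.dist u v) → s.card ≤ k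

/-- The (undirected) Cayley graph of a group `G` with respect to a subset `S`:
`g` and `h` are adjacent when `g ≠ h` and `g⁻¹ * h ∈ S` (or symmetrically). For an
inverse-closed `S` not containing `1` this is the usual Cayley graph. -/
def cayleyGraph (G : Type*) [Group G] (S : Set G) : SimpleGraph G :=
  SimpleGraph.fromRel (fun g h => g⁻¹ * h ∈ S)

/-- A graph is (Gromov) hyperbolic if its path metric satisfies the four-point
condition for some `δ > 0`; for geodesic spaces (such as connected graphs) this is
equivalent to all geodesic triangles being thin. -/
def IsHyperbolic {V : Type*} (X : SimpleGraph V) : Prop :=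
  ∃ δ : ℝ, 0 < δ ∧ ∀ x y z w : V,
    (X.dist x y : ℝ) + (X.dist z w : ℝ) ≤
      max ((X.dist x z : ℝ) + (X.dist y w : ℝ)) ((X.dist x w : ℝ) + (X.dist y z : ℝ))
        + 2 * δ

namespace SimpleGraph

variable {V : Type*} {X : SimpleGraph V}

/-- A sequence of vertices whose restriction to `[0, dist x y]` is a geodesic from `x` to `y`. -/
def IsGeodesicSeq (X : SimpleGraph V) (x y : V) (γ : ℕ → V) : Prop :=
  γ 0 = x ∧ γ (X.dist x y) = y ∧ ∀ t < X.dist x y, X.Adj (γ t) (γ (t + 1))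

theorem exists_walk_of_seq {γ : ℕ → V} {n : ℕ} (h : ∀ t < n, X.Adj (γ t) (γ (t + 1))) :
    ∃ p : X.Walk (γ 0) (γ n), p.length = n ∧ ∀ t ≤ n, p.getVert t = γ t := by
  induction n with
  | zero => exact ⟨Walk.nil, rfl, fun t ht => by simp [Nat.le_zero.1 ht]⟩
  | succ n ih =>
    obtain ⟨p, hp, hv⟩ := ih fun t ht => h t (by omega)
    refine ⟨p.concat (h n (by omega)), by simp [hp], fun t ht => ?_⟩
    rw [Walk.concat_eq_append, Walk.getVert_append]
    split_ifs with h1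
    · exact hv t (by omega)
    · obtain h2 | h2 : t = n ∨ t = n + 1 := by omega
      · simp [h2, hp]
      · simp [h2, hp]

theorem dist_le_of_seq {γ : ℕ → V} {s t : ℕ} (hst : s ≤ t)
    (h : ∀ i, s ≤ i → i < t → X.Adj (γ i) (γ (i + 1))) : X.dist (γ s) (γ t) + s ≤ t := by
  obtain ⟨p, hp, -⟩ := exists_walk_of_seq (X := X) (γ := fun i => γ (s + i)) (n := t - s)
    fun i hi => h (s + i) (by omega) (by omega)
  have h1 := dist_le p
  simp only [add_zero, Nat.add_sub_cancel' hst, hp] at h1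
  omega

theorem IsGeodesicSeq.dist_eq (hc : X.Connected) {x y : V} {γ : ℕ → V} (h : X.IsGeodesicSeq x y γ)
    {s t : ℕ} (hst : s ≤ t) (ht : t ≤ X.dist x y) : X.dist (γ s) (γ t) + s = t := by
  obtain ⟨h0, h1, h2⟩ := h
  have a := dist_le_of_seq (X := X) (γ := γ) (Nat.zero_le s) fun i _ hi => h2 i (by omega)
  have b := dist_le_of_seq (X := X) (γ := γ) hst fun i _ hi => h2 i (by omega)
  have c := dist_le_of_seq (X := X) (γ := γ) ht fun i _ hi => h2 i (by omega)
  have d := hc.dist_triangle (u := x) (v := γ s) (w := γ t)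
  have e := hc.dist_triangle (u := x) (v := γ t) (w := y)
  rw [h0] at a
  rw [h1] at c
  omega

theorem IsGeodesicSeq.dist_left (hc : X.Connected) {x y : V} {γ : ℕ → V}
    (h : X.IsGeodesicSeq x y γ) {t : ℕ} (ht : t ≤ X.dist x y) : X.dist x (γ t) = t := by
  simpa [h.1] using h.dist_eq hc (Nat.zero_le t) ht

theorem IsGeodesicSeq.dist_right (hc : X.Connected) {x y : V} {γ : ℕ → V}
    (h : X.IsGeodesicSeq x y γ) {t : ℕ} (ht : t ≤ X.dist x y) :
    X.dist (γ t) y + t = X.dist x y := by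
  simpa [h.2.1] using h.dist_eq hc ht le_rfl

theorem exists_isGeodesicSeq (hc : X.Connected) (x y : V) : ∃ γ, X.IsGeodesicSeq x y γ := by
  obtain ⟨p, hp⟩ := hc.exists_walk_length_eq_dist x y
  exact ⟨p.getVert, p.getVert_zero, by rw [← hp]; exact p.getVert_length,
    fun t ht => p.adj_getVert_succ (hp ▸ ht)⟩

theorem splice_adj {f g : ℕ → V} {n m : ℕ} (hfg : f n = g n)
    (hf : ∀ t < n, X.Adj (f t) (f (t + 1))) (hg : ∀ t, n ≤ t → t < m → X.Adj (g t) (g (t + 1))) :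
    ∀ t < m, X.Adj (if t ≤ n then f t else g t) (if t + 1 ≤ n then f (t + 1) else g (t + 1)) := by
  intro t ht
  rcases lt_trichotomy t n with h | rfl | h
  · rw [if_pos h.le, if_pos (Nat.succ_le_of_lt h)]; exact hf t h
  · rw [if_pos le_rfl, if_neg (by omega), hfg]; exact hg t le_rfl ht
  · rw [if_neg (by omega), if_neg (by omega)]; exact hg t h.le ht

theorem exists_isGeodesicSeq_through (hc : X.Connected) {x y v : V}
    (h : X.dist x v + X.dist v y = X.dist x y) :
    ∃ γ, X.IsGeodesicSeq x y γ ∧ γ (X.dist x v) = v := by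
  obtain ⟨f, hf⟩ := exists_isGeodesicSeq hc x v
  obtain ⟨g, hg⟩ := exists_isGeodesicSeq hc v y
  refine ⟨fun t => if t ≤ X.dist x v then f t else g (t - X.dist x v), ⟨?_, ?_, ?_⟩, ?_⟩
  · simp [hf.1]
  · simp only
    split_ifs with h1
    · have : X.dist v y = 0 := by omega
      rw [← h, this, add_zero, hf.2.1]
      exact hc.dist_eq_zero_iff.1 this
    · rw [← h, Nat.add_sub_cancel_left, hg.2.1]
  · refine splice_adj (g := fun t => g (t - X.dist x v)) ?_ hf.2.2 fun t h1 h2 => ?_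
    · simp [hf.2.1, hg.1]
    · rw [Nat.sub_add_comm h1]
      exact hg.2.2 _ (by omega)
  · simp [hf.2.1]

theorem _root_.IsKGeodetic.false_of_seqs {k : ℕ} (hX : IsKGeodetic X k) {x y : V}
    (γ : Fin (k + 1) → ℕ → V) (hγ : ∀ s, X.IsGeodesicSeq x y (γ s))
    (hne : ∀ s s', s < s' → ∃ t ≤ X.dist x y, γ s t ≠ γ s' t) : False := by
  have hw : ∀ s, ∃ p : X.Walk x y, p.length = X.dist x y ∧
      ∀ t ≤ X.dist x y, p.getVert t = γ s t := by
    intro s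
    obtain ⟨h0, h1, h2⟩ := hγ s
    obtain ⟨p, hp, hv⟩ := exists_walk_of_seq h2
    exact ⟨p.copy h0 h1, by simp [hp], fun t ht => by simp [hv t ht]⟩
  choose p hp hv using hw
  have hinj : Function.Injective p := by
    have key : ∀ s s', s < s' → p s ≠ p s' := by
      intro s s' hs he
      obtain ⟨t, ht, hn⟩ := hne s s' hs
      exact hn (by rw [← hv s t ht, ← hv s' t ht, he])
    intro s s' he
    by_contra hn
    rcases lt_or_gt_of_ne hn with h | h
    · exact key _ _ h he
    · exact key _ _ h he.symm
  classical
  have := hX.2 x y (Finset.univ.image p) (by simp [hp])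
  rw [Finset.card_image_of_injective _ hinj] at this
  simp at this

/-- Two disjoint geodesics issuing from the same level set cannot stay close for a long time in
a `k`-geodetic graph. -/
theorem _root_.IsKGeodetic.false_of_ladder {k : ℕ} (hX : IsKGeodetic X k) {x : V} (D : ℕ) {α β : ℕ → V}
    (r a b : ℕ) (hb : b = a + (2 * k + 2) ^ r * (D + 1))
    (hα : ∀ t, a ≤ t → t ≤ b → X.dist x (α t) = t) (hβ : ∀ t, a ≤ t → t ≤ b → X.dist x (β t) = t)
    (hD : ∀ t, a ≤ t → t ≤ b → X.dist (α t) (β t) ≤ D)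
    (hne : ∀ t, a ≤ t → t ≤ b → α t ≠ β t)
    (hα' : ∀ t, a ≤ t → t < b → X.Adj (α t) (α (t + 1)))
    (hβ' : ∀ t, a ≤ t → t < b → X.Adj (β t) (β (t + 1)))
    (hf : D + 1 + b ≤ X.dist (α a) (β b) + a + r) : False := by
  have hc := hX.1
  induction r generalizing a b with
  | zero =>
    have hab : a ≤ b := by omega
    have h1 := hc.dist_triangle (u := α a) (v := β a) (w := β b)
    have h2 := hD a le_rfl hab
    have h3 := dist_le_of_seq (X := X) hab fun i hi hi' => hβ' i hi hi'
    omega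
  | succ r ih =>
    set l := (2 * k + 2) ^ r * (D + 1) with hl
    have hlD : D + 1 ≤ l := Nat.le_mul_of_pos_left _ (by positivity)
    have hb' : b = a + (2 * k + 2) * l := by rw [hb, hl]; ring
    have hmul : ∀ {i j : ℕ}, i ≤ j → i * l ≤ j * l := fun h => Nat.mul_le_mul_right l h
    have hsub : ∀ s < 2 * k + 2, X.dist (α (a + s * l)) (β (a + (s + 1) * l)) + r < D + 1 + l := by
      intro s hs
      by_contra! hcon
      have h1 : (s + 1) * l ≤ (2 * k + 2) * l := hmul hs
      have h2 : (s + 1) * l = s * l + l := by ring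
      refine ih (a + s * l) (a + (s + 1) * l) (by omega) ?_ ?_ ?_ ?_ ?_ ?_ (by omega)
      · exact fun t h3 h4 => hα t (by omega) (by omega)
      · exact fun t h3 h4 => hβ t (by omega) (by omega)
      · exact fun t h3 h4 => hD t (by omega) (by omega)
      · exact fun t h3 h4 => hne t (by omega) (by omega)
      · exact fun t h3 h4 => hα' t (by omega) (by omega)
      · exact fun t h3 h4 => hβ' t (by omega) (by omega)
    have hab : a ≤ b := by omega
    obtain ⟨F, hF⟩ : ∃ F, X.dist (α a) (β b) + a = b + F := by
      have h1 := hc.dist_triangle (u := x) (v := α a) (w := β b)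
      rw [hα a le_rfl hab, hβ b hab le_rfl] at h1
      exact ⟨X.dist (α a) (β b) + a - b, by omega⟩
    have hFD : F ≤ D := by
      have h1 := hc.dist_triangle (u := α a) (v := β a) (w := β b)
      have h2 := hD a le_rfl hab
      have h3 := dist_le_of_seq (X := X) hab fun i hi hi' => hβ' i hi hi'
      omega
    have hcross : ∀ s < 2 * k + 2, X.dist (α (a + s * l)) (β (a + (s + 1) * l)) = l + F := by
      intro s hs
      have h0 := hsub s hs
      have h1 : (s + 1) * l ≤ (2 * k + 2) * l := hmul hs
      have h2 : (s + 1) * l = s * l + l := by ring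
      have h3 := dist_le_of_seq (X := X) (γ := α) (s := a) (t := a + s * l) (by omega)
        fun i hi hi' => hα' i hi (by omega)
      have h4 := dist_le_of_seq (X := X) (γ := β) (s := a + (s + 1) * l) (t := b) (by omega)
        fun i hi hi' => hβ' i (by omega) (by omega)
      have h5 := hc.dist_triangle (u := α a) (v := α (a + s * l)) (w := β b)
      have h6 := hc.dist_triangle (u := α (a + s * l)) (v := β (a + (s + 1) * l)) (w := β b)
      omega
    have hg : ∀ s : Fin (k + 1), ∃ γ, X.IsGeodesicSeq (α a) (β b) γ ∧
        γ (2 * s * l) = α (a + 2 * s * l) ∧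
        ∀ t, (2 * s + 1) * l + F < t → γ t = β (a + t - F) := by
      intro s
      have hs : 2 * (s : ℕ) < 2 * k + 2 := by omega
      have h1 : (2 * (s : ℕ) + 1) * l ≤ (2 * k + 2) * l := hmul hs
      have h2 : (2 * (s : ℕ) + 1) * l = 2 * s * l + l := by ring
      have h2s : (2 * (s : ℕ) + 1) * l ≤ (2 * k + 1) * l := hmul (by omega)
      have h2k : (2 * k + 2) * l = (2 * k + 1) * l + l := by ring
      obtain ⟨c, hc0, hc1, hc2⟩ := exists_isGeodesicSeq hc (α (a + 2 * s * l))
        (β (a + (2 * s + 1) * l))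
      have h3 := hcross _ hs
      rw [h3] at hc1 hc2
      refine ⟨fun t => if t ≤ 2 * s * l then α (a + t) else
        if t ≤ (2 * s + 1) * l + F then c (t - 2 * s * l) else β (a + t - F), ⟨?_, ?_, ?_⟩, ?_, ?_⟩
      · simp
      · have h4 : X.dist (α a) (β b) = (2 * k + 2) * l + F := by omega
        simp only [h4]
        rw [if_neg (by omega), if_neg (by omega)]
        congr 1; omega
      · have h4 : X.dist (α a) (β b) = (2 * k + 2) * l + F := by omega
        rw [h4]
        refine splice_adj (f := fun t => α (a + t)) (g := fun t =>
          if t ≤ (2 * s + 1) * l + F then c (t - 2 * s * l) else β (a + t - F)) ?_ ?_ ?_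
        · rw [if_pos (by omega), Nat.sub_self, hc0]
        · exact fun t ht => hα' _ (by omega) (by omega)
        · intro t ht ht'
          rcases lt_trichotomy t ((2 * s + 1) * l + F) with h | h | h
          · rw [if_pos h.le, if_pos (Nat.succ_le_of_lt h), Nat.sub_add_comm ht]
            exact hc2 _ (by omega)
          · rw [if_pos h.le, if_neg (by omega)]
            have e1 : t - 2 * s * l = l + F := by omega
            have e2 : a + (t + 1) - F = a + (2 * s + 1) * l + 1 := by omega
            rw [e1, e2, hc1]
            exact hβ' _ (by omega) (by omega)
          · rw [if_neg (by omega), if_neg (by omega)]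
            have e2 : a + (t + 1) - F = a + t - F + 1 := by omega
            rw [e2]
            exact hβ' _ (by omega) (by omega)
      · simp
      · intro t ht
        simp only
        rw [if_neg (by omega), if_neg (by omega)]
    choose γ hγ hγα hγβ using hg
    refine hX.false_of_seqs γ hγ fun s s' hs => ⟨2 * s' * l, ?_, ?_⟩
    · have : 2 * (s' : ℕ) * l ≤ (2 * k + 2) * l := hmul (by omega)
      omega
    · have h1 : (2 * (s : ℕ) + 2) * l ≤ 2 * s' * l := hmul (by omega)
      have h2 : (2 * (s : ℕ) + 2) * l = (2 * s + 1) * l + l := by ring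
      have h3 : 2 * (s' : ℕ) * l ≤ (2 * k + 2) * l := hmul (by omega)
      rw [hγα, hγβ s _ (by omega)]
      intro he
      have h4 := hβ (a + 2 * s' * l - F) (by omega) (by omega)
      have h5 := hα (a + 2 * s' * l) (by omega) (by omega)
      rw [he, h5] at h4
      have hF0 : F = 0 := by omega
      rw [hF0] at he
      exact hne (a + 2 * s' * l) (by omega) (by omega) he.symm

end SimpleGraph

namespace SimpleGraph

variable {V : Type*} {X : SimpleGraph V}

/-- Geodesics from a common point to adjacent points meet in every sufficiently long window. -/
theorem exists_geodesics_meet {k : ℕ} (hX : IsKGeodetic X k) (hh : IsHyperbolic X) :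
    ∃ C, ∀ (x y y' : V) (α β : ℕ → V), X.dist y y' ≤ 1 → X.IsGeodesicSeq x y α →
      X.IsGeodesicSeq x y' β → ∀ n, n + C ≤ X.dist x y → n + C ≤ X.dist x y' →
        ∃ t, n ≤ t ∧ t ≤ n + C ∧ α t = β t := by
  have hc := hX.1
  obtain ⟨δ, -, hδ⟩ := hh
  obtain ⟨D, hD⟩ := exists_nat_ge (2 + 2 * δ)
  refine ⟨(2 * k + 2) ^ (D + 1) * (D + 1), fun x y y' α β hy hα hβ n hn hn' => ?_⟩
  by_contra! hcon
  refine hX.false_of_ladder (x := x) D (α := α) (β := β) (D + 1) n _ rfl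
    (fun t _ h => hα.dist_left hc (by omega)) (fun t _ h => hβ.dist_left hc (by omega)) ?_ hcon
    (fun t _ h => hα.2.2 t (by omega)) (fun t _ h => hβ.2.2 t (by omega)) ?_
  · intro t h h'
    have h1 := hδ (α t) (β t) x y
    have h2 : X.dist (α t) x = t := by rw [dist_comm]; exact hα.dist_left hc (by omega)
    have h3 : X.dist (β t) x = t := by rw [dist_comm]; exact hβ.dist_left hc (by omega)
    have h4 := hα.dist_right hc (t := t) (by omega)
    have h5 := hβ.dist_right hc (t := t) (by omega)
    have h6 := hc.dist_triangle (u := β t) (v := y') (w := y)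
    have h7 := hc.dist_triangle (u := x) (v := y) (w := y')
    rw [dist_comm (u := y')] at h6
    have h8 : X.dist (β t) y + t ≤ X.dist x y + 2 := by omega
    rw [h2, h3] at h1
    have h9 : max ((t : ℝ) + X.dist (β t) y) (X.dist (α t) y + t) ≤ X.dist x y + 2 := by
      refine max_le ?_ ?_
      · rw [add_comm]; exact_mod_cast h8
      · have : X.dist (α t) y + t ≤ X.dist x y + 2 := by omega
        exact_mod_cast this
    have : (X.dist (α t) (β t) : ℝ) ≤ D := by linarith
    exact_mod_cast this
  · have h1 := hα.dist_left hc (t := n) (by omega)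
    have h2 := hβ.dist_left hc (t := n + (2 * k + 2) ^ (D + 1) * (D + 1)) (by omega)
    have h3 := hc.dist_triangle (u := x) (v := α n)
      (w := β (n + (2 * k + 2) ^ (D + 1) * (D + 1)))
    omega

/-- The subgraph of the edges both of whose endpoints are outside the ball of radius `N`. -/
def outside (X : SimpleGraph V) (x : V) (N : ℕ) : SimpleGraph V where
  Adj a b := X.Adj a b ∧ N < X.dist x a ∧ N < X.dist x b
  symm := ⟨fun _ _ h => ⟨h.1.symm, h.2.2, h.2.1⟩⟩
  loopless := ⟨fun _ h => h.1.ne rfl⟩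

/-- Each connected component of the complement of a ball of radius `N` is seen from the centre
through a single vertex at depth `N - M`. -/
def HasBottlenecks (X : SimpleGraph V) (M : ℕ) : Prop :=
  ∀ (x : V) (N : ℕ), M ≤ N → ∀ y, N < X.dist x y → ∃ a, X.dist x a + M = N ∧
    ∀ y', (X.outside x N).Reachable y y' → X.dist x a + X.dist a y' = X.dist x y'

theorem _root_.IsKGeodetic.hasBottlenecks {k : ℕ} (hX : IsKGeodetic X k) (hh : IsHyperbolic X) :
    ∃ M, X.HasBottlenecks M := by
  have hc := hX.1
  obtain ⟨C, hC⟩ := exists_geodesics_meet hX hh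
  refine ⟨C, fun x N hN => ?_⟩
  have step : ∀ y y' a, (X.outside x N).Adj y y' → X.dist x a + C = N →
      X.dist x a + X.dist a y = X.dist x y → X.dist x a + X.dist a y' = X.dist x y' := by
    intro y y' a hy ha hay
    obtain ⟨hadj, hNy, hNy'⟩ := hy
    obtain ⟨α, hα, hαa⟩ := exists_isGeodesicSeq_through hc hay
    obtain ⟨β, hβ⟩ := exists_isGeodesicSeq hc x y'
    obtain ⟨t, ht1, ht2, ht⟩ := hC x y y' α β (dist_eq_one_iff_adj.2 hadj).le hα hβ (N - C)
      (by omega) (by omega)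
    have h1 := hα.dist_eq hc (s := X.dist x a) (t := t) (by omega) (by omega)
    rw [hαa, ht] at h1
    have h2 := hβ.dist_right hc (t := t) (by omega)
    have h3 := hc.dist_triangle (u := a) (v := β t) (w := y')
    have h4 := hc.dist_triangle (u := x) (v := a) (w := y')
    omega
  intro y hy
  obtain ⟨α, hα⟩ := exists_isGeodesicSeq hc x y
  have hl := hα.dist_left hc (t := N - C) (by omega)
  have hr := hα.dist_right hc (t := N - C) (by omega)
  refine ⟨α (N - C), by omega, fun y' hy' => ?_⟩
  rw [reachable_iff_reflTransGen] at hy'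
  induction hy' with
  | refl => omega
  | tail _ h ih => exact step _ _ _ h (by omega) ih

end SimpleGraph

namespace SimpleGraph

variable {V : Type*} {X : SimpleGraph V}

/-- The oriented edges of `X` leaving the vertex set `C`. -/
def edgeBoundary (X : SimpleGraph V) (C : Set V) : Set (V × V) :=
  {e | X.Adj e.1 e.2 ∧ e.1 ∈ C ∧ e.2 ∉ C}

/-- A vertex set is connected if it is not a union of two nonempty parts without edges between
them. -/
def IsConnectedSet (X : SimpleGraph V) (C : Set V) : Prop :=
  ∀ A ⊆ C, A.Nonempty → (∀ a ∈ A, ∀ b ∈ C, X.Adj a b → b ∈ A) → C ⊆ A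

/-- A cut of weight at most `K`: a vertex set with at most `K` boundary edges which is connected
and has connected complement. -/
structure IsCut (X : SimpleGraph V) (K : ℕ) (C : Set V) : Prop where
  finite : (X.edgeBoundary C).Finite
  ncard_le : (X.edgeBoundary C).ncard ≤ K
  conn : X.IsConnectedSet C
  conn_compl : X.IsConnectedSet Cᶜ

theorem edgeBoundary_compl (C : Set V) :
    X.edgeBoundary Cᶜ = Prod.swap '' X.edgeBoundary C := by
  ext ⟨a, b⟩
  simp [edgeBoundary, adj_comm, and_comm]

theorem ncard_edgeBoundary_compl (C : Set V) :
    (X.edgeBoundary Cᶜ).ncard = (X.edgeBoundary C).ncard := by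
  rw [edgeBoundary_compl, Set.ncard_image_of_injective _ Prod.swap_injective]

theorem finite_edgeBoundary_compl {C : Set V} (h : (X.edgeBoundary C).Finite) :
    (X.edgeBoundary Cᶜ).Finite := by
  rw [edgeBoundary_compl]
  exact h.image _

theorem IsCut.compl {K : ℕ} {C : Set V} (h : X.IsCut K C) : X.IsCut K Cᶜ where
  finite := finite_edgeBoundary_compl h.finite
  ncard_le := (ncard_edgeBoundary_compl C).trans_le h.ncard_le
  conn := h.conn_compl
  conn_compl := by rw [compl_compl]; exact h.conn

theorem edgeBoundary_nonempty (hc : X.Connected) {C : Set V} {u v : V} (hu : u ∈ C) (hv : v ∉ C) :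
    (X.edgeBoundary C).Nonempty := by
  obtain ⟨p⟩ := hc.preconnected u v
  obtain ⟨d, -, h1, h2⟩ := p.exists_boundary_dart C hu hv
  exact ⟨(d.fst, d.snd), d.adj, h1, h2⟩

/-- Only finitely many cuts of bounded weight separate two given vertices. -/
theorem finite_isCut_separating (K : ℕ) (X : SimpleGraph V) (u v : V) :
    {C | X.IsCut K C ∧ u ∈ C ∧ v ∉ C}.Finite := by
  induction K generalizing X u v with
  | zero =>
    refine (Set.finite_singleton {w | X.Reachable u w}).subset ?_
    rintro C ⟨hC, hu, hv⟩
    have hno : ∀ a ∈ C, ∀ b, X.Adj a b → b ∈ C := by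
      intro a ha b hab
      by_contra hb
      have h0 := (Set.ncard_eq_zero hC.finite).1 (Nat.le_zero.1 hC.ncard_le)
      exact Set.notMem_empty (a, b) (h0 ▸ ⟨hab, ha, hb⟩)
    refine Set.Subset.antisymm ?_ ?_
    · refine fun w hw => (hC.conn (C ∩ {w | X.Reachable u w}) Set.inter_subset_left
        ⟨u, hu, Reachable.refl u⟩ ?_ hw).2
      exact fun a ha b hb hab => ⟨hb, ha.2.trans hab.reachable⟩
    · intro w hw
      rw [Set.mem_ofPred_eq, reachable_iff_reflTransGen] at hw
      induction hw with
      | refl => exact hu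
      | tail _ h ih => exact hno _ ih _ h
  | succ n ih =>
    by_cases huv : X.Reachable u v
    · obtain ⟨p⟩ := huv
      have hfin : (⋃ d ∈ {d | d ∈ p.darts}, {C | (X.deleteEdges {d.edge}).IsCut n C ∧
          d.fst ∈ C ∧ d.snd ∉ C}).Finite :=
        (List.finite_toSet p.darts).biUnion fun d _ => ih _ _ _
      refine hfin.subset ?_
      rintro C ⟨hC, hu, hv⟩
      obtain ⟨d, hd, h1, h2⟩ := p.exists_boundary_dart C hu hv
      have hconn : ∀ D : Set V, (d.fst ∈ D → d.snd ∉ D) → X.IsConnectedSet D →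
          (X.deleteEdges {d.edge}).IsConnectedSet D := by
        intro D hdD hD A hA hne hcl
        refine hD A hA hne fun a ha b hb hab => hcl a ha b hb ?_
        rw [deleteEdges_adj]
        refine ⟨hab, fun he => ?_⟩
        have he' : s(a, b) = s(d.fst, d.snd) := he
        rw [Sym2.eq_iff] at he'
        rcases he' with ⟨rfl, rfl⟩ | ⟨rfl, rfl⟩
        · exact hdD (hA ha) hb
        · exact hdD hb (hA ha)
      have hsub : (X.deleteEdges {d.edge}).edgeBoundary C ⊆
          X.edgeBoundary C \ {(d.fst, d.snd)} := by
        rintro ⟨a, b⟩ ⟨hab, ha, hb⟩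
        rw [deleteEdges_adj] at hab
        refine ⟨⟨hab.1, ha, hb⟩, fun he => hab.2 ?_⟩
        obtain ⟨rfl, rfl⟩ : a = d.fst ∧ b = d.snd := Prod.mk.inj (Set.mem_singleton_iff.1 he)
        rfl
      have hmem : (d.fst, d.snd) ∈ X.edgeBoundary C := ⟨d.adj, h1, h2⟩
      simp only [Set.mem_iUnion]
      refine ⟨d, hd, ⟨(hC.finite.sdiff).subset hsub, ?_, hconn C (fun _ => h2) hC.conn,
        hconn Cᶜ (fun h => absurd h1 h) hC.conn_compl⟩, h1, h2⟩
      have h3 := Set.ncard_le_ncard hsub hC.finite.sdiff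
      have h4 := Set.ncard_sdiff_singleton_add_one hmem hC.finite
      have h5 := hC.ncard_le
      omega
    · refine (Set.finite_singleton {w | X.Reachable u w}).subset ?_
      rintro C ⟨hC, hu, hv⟩
      refine Set.Subset.antisymm ?_ ?_
      · refine fun w hw => (hC.conn (C ∩ {w | X.Reachable u w}) Set.inter_subset_left
          ⟨u, hu, Reachable.refl u⟩ ?_ hw).2
        exact fun a ha b hb hab => ⟨hb, ha.2.trans hab.reachable⟩
      · intro w hw
        by_contra hwC
        refine huv (hC.conn_compl (Cᶜ ∩ {w | X.Reachable u w}) Set.inter_subset_left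
          ⟨w, hwC, hw⟩ ?_ hv).2
        exact fun a ha b hb hab => ⟨hb, ha.2.trans hab.reachable⟩

theorem ncard_edgeBoundary_inter_add_union {C D : Set V} (hC : (X.edgeBoundary C).Finite)
    (hD : (X.edgeBoundary D).Finite) :
    (X.edgeBoundary (C ∩ D)).Finite ∧ (X.edgeBoundary (C ∪ D)).Finite ∧
    (X.edgeBoundary (C ∩ D)).ncard + (X.edgeBoundary (C ∪ D)).ncard ≤
      (X.edgeBoundary C).ncard + (X.edgeBoundary D).ncard := by
  have h1 : X.edgeBoundary (C ∩ D) ∪ X.edgeBoundary (C ∪ D) ⊆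
      X.edgeBoundary C ∪ X.edgeBoundary D := by
    rintro ⟨a, b⟩ h
    simp only [edgeBoundary, Set.mem_union, Set.mem_ofPred_eq, Set.mem_inter_iff] at h ⊢
    tauto
  have h2 : X.edgeBoundary (C ∩ D) ∩ X.edgeBoundary (C ∪ D) ⊆
      X.edgeBoundary C ∩ X.edgeBoundary D := by
    rintro ⟨a, b⟩ h
    simp only [edgeBoundary, Set.mem_union, Set.mem_ofPred_eq, Set.mem_inter_iff] at h ⊢
    tauto
  have hf := (hC.union hD).subset h1
  have hf1 := hf.subset Set.subset_union_left
  have hf2 := hf.subset Set.subset_union_right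
  refine ⟨hf1, hf2, ?_⟩
  rw [← Set.ncard_union_add_ncard_inter _ _ hf1 hf2, ← Set.ncard_union_add_ncard_inter _ _ hC hD]
  exact add_le_add (Set.ncard_le_ncard h1 (hC.union hD))
    (Set.ncard_le_ncard h2 (hC.inter_of_left _))

end SimpleGraph

/-- Two sets cross if all four of their corners are nonempty; otherwise they are nested. -/
def Set.Crosses {V : Type*} (C D : Set V) : Prop :=
  (C ∩ D).Nonempty ∧ (C ∩ Dᶜ).Nonempty ∧ (Cᶜ ∩ D).Nonempty ∧ (Cᶜ ∩ Dᶜ).Nonempty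

namespace Set

variable {V : Type*} {C D E : Set V}

theorem Crosses.symm (h : C.Crosses D) : D.Crosses C := by
  obtain ⟨h1, h2, h3, h4⟩ := h
  refine ⟨?_, ?_, ?_, ?_⟩ <;> rw [inter_comm] <;> assumption

theorem crosses_compl_left : Cᶜ.Crosses D ↔ C.Crosses D := by
  simp only [Crosses, compl_compl]; tauto

theorem crosses_compl_right : C.Crosses Dᶜ ↔ C.Crosses D := by
  simp only [Crosses, compl_compl]; tauto

theorem Crosses.of_inter (h : C.Crosses D) (hE : (C ∩ D).Crosses E) :
    C.Crosses E ∨ D.Crosses E := by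
  by_contra! hcon
  obtain ⟨h1, h2⟩ := hcon
  simp only [Crosses, Set.Nonempty, mem_inter_iff, mem_compl_iff] at *
  grind

theorem Crosses.of_union (h : C.Crosses D) (hE : (C ∪ D).Crosses E) :
    C.Crosses E ∨ D.Crosses E := by
  rw [← crosses_compl_left, compl_union] at hE
  have := Crosses.of_inter (crosses_compl_left.2 (crosses_compl_right.2 h)) hE
  rwa [crosses_compl_left, crosses_compl_left] at this

theorem Crosses.of_inter_of_union (hE : (C ∩ D).Crosses E) (hE' : (C ∪ D).Crosses E) :
    C.Crosses E := by
  obtain ⟨⟨a, ha⟩, ⟨b, hb⟩, -, -⟩ := hE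
  obtain ⟨-, -, ⟨c, hc⟩, ⟨d, hd⟩⟩ := hE'
  simp only [mem_inter_iff, mem_union, mem_compl_iff, not_or] at ha hb hc hd
  exact ⟨⟨a, ha.1.1, ha.2⟩, ⟨b, hb.1.1, hb.2⟩, ⟨c, hc.1.1, hc.2⟩, ⟨d, hd.1.1, hd.2⟩⟩

theorem not_inter_crosses_left : ¬ (C ∩ D).Crosses C := by
  rintro ⟨-, ⟨a, ha⟩, -⟩
  exact ha.2 ha.1.1

theorem not_union_crosses_left : ¬ (C ∪ D).Crosses C := by
  rintro ⟨-, -, ⟨a, ha⟩, -⟩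
  exact ha.1 (Or.inl ha.2)

end Set

namespace SimpleGraph

variable {V : Type*} {X : SimpleGraph V}

theorem finite_crossing {K : ℕ} {C : Set V} (hC : (X.edgeBoundary C).Finite) :
    {D | X.IsCut K D ∧ C.Crosses D}.Finite := by
  have hfin : (⋃ e ∈ X.edgeBoundary C, ⋃ e' ∈ X.edgeBoundary C,
      {D | X.IsCut K D ∧ e.1 ∈ D ∧ e'.1 ∉ D}).Finite :=
    hC.biUnion fun e _ => hC.biUnion fun e' _ => finite_isCut_separating K X e.1 e'.1
  refine hfin.subset ?_
  rintro D ⟨hD, h1, h2, h3, h4⟩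
  have key : ∀ D, X.IsConnectedSet D → (C ∩ D).Nonempty → (Cᶜ ∩ D).Nonempty →
      ∃ e ∈ X.edgeBoundary C, e.1 ∈ D := by
    intro D hD h1 h2
    by_contra! hcon
    obtain ⟨w, hw⟩ := h2
    refine hw.1 (hD (C ∩ D) Set.inter_subset_right h1 ?_ hw.2).1
    intro a ha b hb hab
    by_contra hbC
    exact hcon (a, b) ⟨hab, ha.1, fun h => hbC ⟨h, hb⟩⟩ ha.2
  obtain ⟨e, he, heD⟩ := key D hD.conn h1 h3
  obtain ⟨e', he', heD'⟩ := key Dᶜ hD.conn_compl h2 h4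
  simp only [Set.mem_iUnion]
  exact ⟨e, he, e', he', hD, heD, heD'⟩

/-- The number of cuts of weight at most `K` crossing `C`. -/
noncomputable def crossingNumber (X : SimpleGraph V) (K : ℕ) (C : Set V) : ℕ :=
  {D | X.IsCut K D ∧ C.Crosses D}.ncard

theorem crossingNumber_compl (K : ℕ) (C : Set V) :
    X.crossingNumber K Cᶜ = X.crossingNumber K C := by
  simp only [crossingNumber, Set.crosses_compl_left]

theorem crossingNumber_inter_add_union_lt {K : ℕ} {C D : Set V} (hC : X.IsCut K C)
    (hD : X.IsCut K D) (h : C.Crosses D) :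
    X.crossingNumber K (C ∩ D) + X.crossingNumber K (C ∪ D) <
      X.crossingNumber K C + X.crossingNumber K D := by
  have hfC := finite_crossing (K := K) hC.finite
  have hfD := finite_crossing (K := K) hD.finite
  have hfi := finite_crossing (K := K) (ncard_edgeBoundary_inter_add_union hC.finite hD.finite).1
  have hfu := finite_crossing (K := K) (ncard_edgeBoundary_inter_add_union hC.finite hD.finite).2.1
  simp only [crossingNumber]
  rw [← Set.ncard_union_add_ncard_inter _ _ hfi hfu, ← Set.ncard_union_add_ncard_inter _ _ hfC hfD]
  refine add_lt_add_of_lt_of_le (Set.ncard_lt_ncard ⟨?_, fun hsub => ?_⟩ (hfC.union hfD))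
    (Set.ncard_le_ncard ?_ (hfC.inter_of_left _))
  · rintro E (⟨hE, hcr⟩ | ⟨hE, hcr⟩)
    · exact (h.of_inter hcr).imp (fun h => ⟨hE, h⟩) fun h => ⟨hE, h⟩
    · exact (h.of_union hcr).imp (fun h => ⟨hE, h⟩) fun h => ⟨hE, h⟩
  · rcases hsub (Or.inr ⟨hC, h.symm⟩) with h1 | h1
    · exact Set.not_inter_crosses_left h1.2
    · exact Set.not_union_crosses_left h1.2
  · rintro E ⟨⟨hE, hi⟩, ⟨-, hu⟩⟩
    refine ⟨⟨hE, hi.of_inter_of_union hu⟩, hE, ?_⟩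
    rw [Set.inter_comm] at hi
    rw [Set.union_comm] at hu
    exact hi.of_inter_of_union hu

end SimpleGraph

/-- A set separates two ultrafilters if it belongs to exactly one of them. -/
def Ultrafilter.Separates {V : Type*} (p q : Ultrafilter V) (C : Set V) : Prop :=
  ¬ (C ∈ p ↔ C ∈ q)

theorem Ultrafilter.separates_compl {V : Type*} {p q : Ultrafilter V} {C : Set V} :
    p.Separates q Cᶜ ↔ p.Separates q C := by
  simp only [Separates, Ultrafilter.compl_mem_iff_notMem]; tauto

namespace SimpleGraph

variable {V : Type*} {X : SimpleGraph V}

/-- A set of minimal weight among those separating two ultrafilters. -/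
structure IsMinCut (X : SimpleGraph V) (p q : Ultrafilter V) (C : Set V) : Prop where
  finite : (X.edgeBoundary C).Finite
  separates : p.Separates q C
  ncard_le : ∀ D, (X.edgeBoundary D).Finite → p.Separates q D →
    (X.edgeBoundary C).ncard ≤ (X.edgeBoundary D).ncard

theorem IsMinCut.compl {p q : Ultrafilter V} {C : Set V} (h : X.IsMinCut p q C) :
    X.IsMinCut p q Cᶜ where
  finite := finite_edgeBoundary_compl h.finite
  separates := Ultrafilter.separates_compl.2 h.separates
  ncard_le D hD hs := by rw [ncard_edgeBoundary_compl]; exact h.ncard_le D hD hs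

theorem IsMinCut.isConnectedSet (hc : X.Connected) {p q : Ultrafilter V} {C : Set V}
    (h : X.IsMinCut p q C) : X.IsConnectedSet C := by
  intro A hA hne hcl
  by_contra hcon
  obtain ⟨b, hbC, hbA⟩ := Set.not_subset.1 hcon
  have hCu : C ≠ Set.univ := by
    rintro rfl
    exact h.separates (iff_of_true Filter.univ_mem Filter.univ_mem)
  obtain ⟨c, hc'⟩ := (Set.ne_univ_iff_exists_notMem C).1 hCu
  have hdA : X.edgeBoundary A ⊆ X.edgeBoundary C := by
    rintro ⟨x, y⟩ ⟨h1, h2, h3⟩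
    exact ⟨h1, hA h2, fun h4 => h3 (hcl x h2 y h4 h1)⟩
  have hdB : X.edgeBoundary (C \ A) ⊆ X.edgeBoundary C := by
    rintro ⟨x, y⟩ ⟨h1, h2, h3⟩
    exact ⟨h1, h2.1, fun h4 => h2.2 (by
      by_contra h5
      exact h5 (hcl y (by by_contra h6; exact h3 ⟨h4, h6⟩) x h2.1 h1.symm))⟩
  have hfA := h.finite.subset hdA
  have hfB := h.finite.subset hdB
  have hdisj : Disjoint (X.edgeBoundary A) (X.edgeBoundary (C \ A)) := by
    rw [Set.disjoint_left]
    rintro ⟨x, y⟩ ⟨-, h2, -⟩ ⟨-, h3, -⟩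
    exact h3.2 h2
  have hsum := Set.ncard_le_ncard (Set.union_subset hdA hdB) h.finite
  rw [Set.ncard_union_eq hdisj hfA hfB] at hsum
  obtain ⟨a, ha⟩ := hne
  have hA0 := (Set.ncard_pos hfA).2 (edgeBoundary_nonempty hc ha (fun h' => hc' (hA h')))
  have hB0 := (Set.ncard_pos hfB).2
    (edgeBoundary_nonempty (C := C \ A) hc ⟨hbC, hbA⟩ (fun h' => hc' h'.1))
  have hu : A ∪ C \ A = C := Set.union_sdiff_cancel hA
  have hmem : ∀ r : Ultrafilter V, C ∈ r ↔ A ∈ r ∨ C \ A ∈ r := fun r => by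
    rw [← Ultrafilter.union_mem_iff, hu]
  have hA' := h.ncard_le A hfA
  have hB' := h.ncard_le (C \ A) hfB
  have hs := h.separates
  have hnb : ∀ r : Ultrafilter V, A ∈ r → C \ A ∉ r := fun r h1 h2 => by
    have := Filter.inter_mem h1 h2
    rw [Set.inter_sdiff_self] at this
    exact r.empty_notMem this
  simp only [Ultrafilter.Separates] at *
  rw [hmem p, hmem q] at hs
  have h1 : ¬ ¬ (A ∈ p ↔ A ∈ q) := fun h => by have := hA' h; omega
  have h2 : ¬ ¬ (C \ A ∈ p ↔ C \ A ∈ q) := fun h => by have := hB' h; omega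
  tauto

/-- A minimal cut between two ultrafilters crossing as few cuts of weight at most `K` as
possible. -/
structure IsOptimalCut (X : SimpleGraph V) (K : ℕ) (p q : Ultrafilter V) (C : Set V) : Prop where
  isMinCut : X.IsMinCut p q C
  isCut : X.IsCut K C
  crossingNumber_le : ∀ D, X.IsMinCut p q D → X.crossingNumber K C ≤ X.crossingNumber K D

theorem IsOptimalCut.compl {K : ℕ} {p q : Ultrafilter V} {C : Set V}
    (h : X.IsOptimalCut K p q C) : X.IsOptimalCut K p q Cᶜ where
  isMinCut := h.isMinCut.compl
  isCut := h.isCut.compl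
  crossingNumber_le D hD := by rw [crossingNumber_compl]; exact h.crossingNumber_le D hD

theorem exists_isOptimalCut (hc : X.Connected) {K : ℕ} {p q : Ultrafilter V}
    (h : ∃ D, (X.edgeBoundary D).Finite ∧ (X.edgeBoundary D).ncard ≤ K ∧ p.Separates q D) :
    ∃ C, X.IsOptimalCut K p q C := by
  obtain ⟨D, hD, hDK, hDs⟩ := h
  obtain ⟨E, ⟨hE, hEs⟩, hEm⟩ := (measure fun D => (X.edgeBoundary D).ncard).wf.has_min
    {D | (X.edgeBoundary D).Finite ∧ p.Separates q D} ⟨D, hD, hDs⟩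
  have hEmin : X.IsMinCut p q E := ⟨hE, hEs, fun D h1 h2 => not_lt.1 (hEm D ⟨h1, h2⟩)⟩
  obtain ⟨C, hC, hCm⟩ := (measure fun D => X.crossingNumber K D).wf.has_min
    {D | X.IsMinCut p q D} ⟨E, hEmin⟩
  exact ⟨C, hC, ⟨hC.finite, (hC.ncard_le D hD hDs).trans hDK, hC.isConnectedSet hc,
    hC.compl.isConnectedSet hc⟩, fun D hD => not_lt.1 (hCm D hD)⟩

theorem IsOptimalCut.false_of_corners {K : ℕ} {p q r s : Ultrafilter V} {C D : Set V}
    (hC : X.IsOptimalCut K p q C) (hD : X.IsOptimalCut K r s D) (hcr : C.Crosses D)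
    (hi : p.Separates q (C ∩ D)) (hu : r.Separates s (C ∪ D)) : False := by
  obtain ⟨hfi, hfu, hle⟩ :=
    ncard_edgeBoundary_inter_add_union hC.isMinCut.finite hD.isMinCut.finite
  have h1 := hC.isMinCut.ncard_le _ hfi hi
  have h2 := hD.isMinCut.ncard_le _ hfu hu
  have h3 := hC.crossingNumber_le (C ∩ D) ⟨hfi, hi, fun E hE hs => by
    have := hC.isMinCut.ncard_le E hE hs; omega⟩
  have h4 := hD.crossingNumber_le (C ∪ D) ⟨hfu, hu, fun E hE hs => by
    have := hD.isMinCut.ncard_le E hE hs; omega⟩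
  have h5 := crossingNumber_inter_add_union_lt hC.isCut hD.isCut hcr
  omega

/-- Optimal cuts are pairwise nested. -/
theorem IsOptimalCut.not_crosses {K : ℕ} {p q r s : Ultrafilter V} {C D : Set V}
    (hC : X.IsOptimalCut K p q C) (hD : X.IsOptimalCut K r s D) : ¬ C.Crosses D := by
  have key : ∀ {p q r s : Ultrafilter V}, X.IsOptimalCut K p q C → X.IsOptimalCut K r s D →
      C.Crosses D → (p.Separates q D ∧ r.Separates s C → p = r ∧ q = s) → False := by
    intro p q r s hC hD hcr hcon
    have hcr' := Set.crosses_compl_right.2 hcr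
    have h1 := hC.false_of_corners hD hcr
    have h2 := hD.false_of_corners hC hcr.symm
    have h3 := hC.false_of_corners hD.compl hcr'
    have h4 := hD.compl.false_of_corners hC hcr'.symm
    have h5 := hC.isMinCut.separates
    have h6 := hD.isMinCut.separates
    have hi : ∀ (r : Ultrafilter V) (A B : Set V), A ∩ B ∈ r ↔ A ∈ r ∧ B ∈ r :=
      fun r A B => Filter.inter_mem_iff
    simp only [Ultrafilter.Separates, hi, Ultrafilter.union_mem_iff,
      Ultrafilter.compl_mem_iff_notMem] at *
    clear hC hD hcr hcr' hi
    by_cases h7 : p = r ∧ q = s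
    · obtain ⟨rfl, rfl⟩ := h7
      grind
    · grind
  intro hcr
  by_cases h : p.Separates q D ∧ r.Separates s C
  · have h1 := hC.isMinCut.ncard_le D hD.isMinCut.finite h.1
    have h2 := hD.isMinCut.ncard_le C hC.isMinCut.finite h.2
    have h3 := hC.crossingNumber_le D ⟨hD.isMinCut.finite, h.1, fun E hE hs =>
      h2.trans (hC.isMinCut.ncard_le E hE hs)⟩
    refine key (p := r) (q := s) (r := r) (s := s) ⟨⟨hC.isMinCut.finite, h.2, fun E hE hs =>
      h1.trans (hD.isMinCut.ncard_le E hE hs)⟩, hC.isCut, fun E hE =>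
      h3.trans (hD.crossingNumber_le E hE)⟩ hD hcr (fun _ => ⟨rfl, rfl⟩)
  · exact key hC hD hcr (fun h' => absurd h' h)

end SimpleGraph

/-- A family of sets closed under complements, pairwise nested, finitely many of which separate
any two given points. -/
structure IsNestedFamily {V : Type*} (E : Set (Set V)) : Prop where
  compl_mem : ∀ C ∈ E, Cᶜ ∈ E
  nonempty : ∀ C ∈ E, C.Nonempty
  not_crosses : ∀ C ∈ E, ∀ D ∈ E, ¬ C.Crosses D
  finite : ∀ u v, {C | C ∈ E ∧ u ∈ C ∧ v ∉ C}.Finite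

/-- A consistent choice of one side of each member of a family of sets, choosing the side of any
given point up to finitely many exceptions. -/
structure IsOrientation {V : Type*} (E o : Set (Set V)) : Prop where
  subset : o ⊆ E
  mem_iff : ∀ C ∈ E, (C ∈ o ↔ Cᶜ ∉ o)
  mem_of_subset : ∀ C ∈ o, ∀ D ∈ E, C ⊆ D → D ∈ o
  finite : ∀ v, {C | C ∈ o ∧ v ∉ C}.Finite

section Orientation

variable {V : Type*} {E : Set (Set V)}

theorem IsNestedFamily.compl_ne (hE : IsNestedFamily E) {C : Set V} (hC : C ∈ E) : Cᶜ ≠ C := by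
  intro h
  obtain ⟨x, hx⟩ := hE.nonempty C hC
  exact (h.symm ▸ hx : x ∈ Cᶜ) hx

theorem IsNestedFamily.not_compl_subset (hE : IsNestedFamily E) {C : Set V} (hC : C ∈ E) :
    ¬ Cᶜ ⊆ C := by
  intro h
  obtain ⟨x, hx⟩ := hE.nonempty _ (hE.compl_mem C hC)
  exact hx (h hx)

theorem IsNestedFamily.nested (hE : IsNestedFamily E) {C D : Set V} (hC : C ∈ E) (hD : D ∈ E) :
    C ⊆ Dᶜ ∨ C ⊆ D ∨ D ⊆ C ∨ Dᶜ ⊆ C := by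
  have h := hE.not_crosses C hC D hD
  simp only [Set.Crosses] at h
  by_contra! hcon
  obtain ⟨h1, h2, h3, h4⟩ := hcon
  rw [Set.not_subset] at h1 h2 h3 h4
  obtain ⟨a, ha, ha'⟩ := h1
  obtain ⟨b, hb, hb'⟩ := h2
  obtain ⟨c, hc, hc'⟩ := h3
  obtain ⟨d, hd, hd'⟩ := h4
  exact h ⟨⟨a, ha, not_not.1 ha'⟩, ⟨b, hb, hb'⟩, ⟨c, hc', hc⟩, ⟨d, hd', hd⟩⟩

theorem IsNestedFamily.isOrientation_point (hE : IsNestedFamily E) (v : V) :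
    IsOrientation E {C | C ∈ E ∧ v ∈ C} where
  subset C h := h.1
  mem_iff C hC := by simp [hC, hE.compl_mem C hC]
  mem_of_subset C hC D hD h := ⟨hD, h hC.2⟩
  finite w := (hE.finite v w).subset fun C h => ⟨h.1.1, h.1.2, h.2⟩

theorem IsOrientation.compl_mem {o : Set (Set V)} (ho : IsOrientation E o)
    {C : Set V} (hC : C ∈ E) : Cᶜ ∈ o ↔ C ∉ o := by
  rw [ho.mem_iff C hC, not_not]

theorem IsOrientation.finite_diff [Nonempty V] {o o' : Set (Set V)}
    (ho : IsOrientation E o) (ho' : IsOrientation E o') : (o \ o').Finite := by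
  obtain ⟨v⟩ := ‹Nonempty V›
  refine ((ho.finite v).union ((ho'.finite v).image compl)).subset ?_
  rintro C ⟨h1, h2⟩
  by_cases hv : v ∈ C
  · refine Or.inr ⟨Cᶜ, ⟨?_, fun h => h hv⟩, compl_compl C⟩
    by_contra h3
    exact h2 ((ho'.mem_iff C (ho.subset h1)).2 h3)
  · exact Or.inl ⟨h1, hv⟩

theorem IsOrientation.eq_of_subset {o o' : Set (Set V)}
    (ho : IsOrientation E o) (ho' : IsOrientation E o') (h : o ⊆ o') : o = o' := by
  refine h.antisymm fun C hC => ?_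
  have hCE := ho'.subset hC
  by_contra h1
  rw [ho.mem_iff C hCE, not_not] at h1
  exact (ho'.mem_iff C hCE).1 hC (h h1)

theorem IsOrientation.flip (hE : IsNestedFamily E) {o : Set (Set V)} (ho : IsOrientation E o)
    {C : Set V} (hC : C ∈ o) (hmin : ∀ D ∈ o, D ⊆ C → D = C) :
    IsOrientation E (insert Cᶜ (o \ {C})) where
  subset := Set.insert_subset (hE.compl_mem C (ho.subset hC)) (Set.sdiff_subset.trans ho.subset)
  mem_iff D hD := by
    have h1 := ho.mem_iff D hD
    have h2 := hE.compl_ne (ho.subset hC)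
    have h3 := hE.compl_ne hD
    have h4 := ho.mem_iff C (ho.subset hC)
    by_cases h5 : D = C
    · subst h5
      simp [h2.symm, h2]
    by_cases h6 : D = Cᶜ
    · subst h6
      simp [h2.symm]
    have h7 : Dᶜ ≠ C := fun h => h6 (by rw [← h, compl_compl])
    have h8 : Dᶜ ≠ Cᶜ := fun h => h5 (compl_injective h)
    simp [h5, h6, h7, h1]
  mem_of_subset := by
    have hCE := ho.subset hC
    rintro D (rfl | ⟨hD, hDC⟩) F hF hsub
    · by_cases h1 : F = Cᶜ
      · exact Or.inl h1
      refine Or.inr ⟨?_, ?_⟩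
      · by_contra h2
        rw [ho.mem_iff F hF, not_not] at h2
        refine h1 ?_
        rw [← hmin _ h2 (by rwa [Set.compl_subset_comm]), compl_compl]
      · rintro rfl
        exact hE.not_compl_subset hF hsub
    · refine Or.inr ⟨ho.mem_of_subset D hD F hF hsub, ?_⟩
      rintro rfl
      exact hDC (hmin D hD hsub)
  finite v := by
    refine ((ho.finite v).union (Set.finite_singleton Cᶜ)).subset ?_
    rintro D ⟨rfl | hD, hv⟩
    · exact Or.inr rfl
    · exact Or.inl ⟨hD.1, hv⟩

/-- The graph of orientations of a nested family; edges flip a single member. -/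
def orientationGraph (E : Set (Set V)) :
    SimpleGraph {o : Set (Set V) // IsOrientation E o} where
  Adj o o' := ∃ C, o.1 \ o'.1 = {C}
  symm := ⟨by
    rintro ⟨o, ho⟩ ⟨o', ho'⟩ ⟨C, hC⟩
    have hCo : C ∈ o \ o' := hC ▸ rfl
    refine ⟨Cᶜ, Set.eq_singleton_iff_unique_mem.2 ⟨⟨?_, ?_⟩, ?_⟩⟩
    · exact (ho'.compl_mem (ho.subset hCo.1)).2 hCo.2
    · exact (ho.mem_iff C (ho.subset hCo.1)).1 hCo.1
    · rintro D ⟨h1, h2⟩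
      have hDE := ho'.subset h1
      have h3 : Dᶜ ∈ o \ o' := ⟨(ho.compl_mem hDE).2 h2, (ho'.mem_iff D hDE).1 h1⟩
      rw [hC] at h3
      rw [← Set.mem_singleton_iff.1 h3, compl_compl]⟩
  loopless := ⟨by
    rintro ⟨o, ho⟩ ⟨C, hC⟩
    have hCo : C ∈ o \ o := hC ▸ rfl
    exact hCo.2 hCo.1⟩

theorem orientationGraph_eq_of_diff {o a b : Set (Set V)}
    (ho : IsOrientation E o) (ha : IsOrientation E a) (hb : IsOrientation E b)
    (h : o \ a = o \ b) : a = b := by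
  refine ha.eq_of_subset hb fun D hD => ?_
  have hDE := ha.subset hD
  by_cases h1 : D ∈ o
  · by_contra h2
    exact (h ▸ (⟨h1, h2⟩ : D ∈ o \ b) : D ∈ o \ a).2 hD
  · by_contra h2
    have h3 : Dᶜ ∈ o \ a := ⟨(ho.compl_mem hDE).2 h1, (ha.mem_iff D hDE).1 hD⟩
    exact (h ▸ h3 : Dᶜ ∈ o \ b).2 ((hb.compl_mem hDE).2 h2)

theorem IsOrientation.minimal_of_diff {o o' : Set (Set V)} (ho : IsOrientation E o)
    (ho' : IsOrientation E o') {C : Set V} (h : o \ o' = {C}) : ∀ D ∈ o, D ⊆ C → D = C := by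
  intro D hD hsub
  have hC : C ∈ o \ o' := h ▸ rfl
  by_contra hne
  refine hC.2 (ho'.mem_of_subset D ?_ C (ho.subset hC.1) hsub)
  by_contra h1
  exact hne (h ▸ (⟨hD, h1⟩ : D ∈ o \ o') : D ∈ ({C} : Set (Set V)))

/-- An orientation is determined by any of its minimal members. -/
theorem IsOrientation.eq_of_minimal {o a : Set (Set V)} (hE : IsNestedFamily E)
    (ho : IsOrientation E o) (ha : IsOrientation E a) {C : Set V} (hCo : C ∈ o) (hCa : C ∈ a)
    (hmo : ∀ D ∈ o, D ⊆ C → D = C) (hma : ∀ D ∈ a, D ⊆ C → D = C) : o = a := by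
  refine ho.eq_of_subset ha fun D hD => ?_
  have hDE := ho.subset hD
  by_contra h1
  have h2 : Dᶜ ∈ a := (ha.compl_mem hDE).2 h1
  have h3 : Dᶜ ∉ o := (ho.mem_iff D hDE).1 hD
  rcases hE.nested (ho.subset hCo) hDE with h | h | h | h
  · exact h3 (ho.mem_of_subset C hCo _ (hE.compl_mem D hDE) h)
  · exact h1 (ha.mem_of_subset C hCa D hDE h)
  · exact h1 (hmo D hD h ▸ hCa)
  · exact h3 (hma _ h2 h ▸ hCo)

theorem orientationGraph_isTree [Nonempty V] (hE : IsNestedFamily E) :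
    (orientationGraph E).IsTree := by
  refine ⟨SimpleGraph.connected_iff _ |>.2 ⟨?_, ?_⟩, ?_⟩
  · rintro ⟨o, ho⟩ ⟨o', ho'⟩
    induction hn : (o \ o').ncard generalizing o with
    | zero =>
      have h0 := (Set.ncard_eq_zero (ho.finite_diff ho')).1 hn
      obtain rfl := ho.eq_of_subset ho' (Set.sdiff_eq_empty.1 h0)
      rfl
    | succ n ih =>
      have hfin := ho.finite_diff ho'
      obtain ⟨C, hC⟩ := hfin.exists_minimal ((Set.ncard_pos hfin).1 (by omega))
      have hmin : ∀ D ∈ o, D ⊆ C → D = C := by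
        intro D hD hsub
        refine hsub.antisymm (hC.2 ⟨hD, fun h1 => ?_⟩ hsub)
        exact hC.1.2 (ho'.mem_of_subset D h1 C (ho.subset hC.1.1) hsub)
      have hne := hE.compl_ne (ho.subset hC.1.1)
      have hf := ho.flip hE hC.1.1 hmin
      have h1 : o \ (insert Cᶜ (o \ {C})) = {C} := by
        ext D
        simp only [Set.mem_sdiff, Set.mem_insert_iff, Set.mem_singleton_iff]
        have := hC.1.1
        grind
      have h2 : (insert Cᶜ (o \ {C})) \ o' = (o \ o') \ {C} := by
        ext D
        have := (ho'.compl_mem (ho.subset hC.1.1)).2 hC.1.2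
        simp only [Set.mem_sdiff, Set.mem_insert_iff, Set.mem_singleton_iff]
        grind
      have hadj : (orientationGraph E).Adj ⟨o, ho⟩ ⟨_, hf⟩ := ⟨C, h1⟩
      refine hadj.reachable.trans (ih _ hf ?_)
      rw [h2]
      have := Set.ncard_sdiff_singleton_add_one hC.1 hfin
      omega
  · obtain ⟨v⟩ := ‹Nonempty V›
    exact ⟨⟨_, hE.isOrientation_point v⟩⟩
  · rw [SimpleGraph.isAcyclic_iff_forall_adj_isBridge]
    rintro ⟨o, ho⟩ ⟨o', ho'⟩ ⟨C, hC⟩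
    rw [SimpleGraph.isBridge_iff]
    intro hr
    have hCo : C ∈ o \ o' := hC ▸ rfl
    rw [SimpleGraph.reachable_iff_reflTransGen] at hr
    have key : ∀ b, Relation.ReflTransGen ((orientationGraph E).deleteEdges
        {s((⟨o, ho⟩ : {o : Set (Set V) // IsOrientation E o}), ⟨o', ho'⟩)}).Adj ⟨o, ho⟩ b →
        C ∈ b.1 := by
      intro b hb
      induction hb with
      | refl => exact hCo.1
      | @tail a b _ hab ih =>
        rw [SimpleGraph.deleteEdges_adj] at hab
        obtain ⟨⟨D, hD⟩, hne⟩ := hab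
        by_contra hCb
        obtain rfl : C = D := (hD ▸ (⟨ih, hCb⟩ : C ∈ a.1 \ b.1) : C ∈ ({D} : Set (Set V)))
        have h1 := ho.eq_of_minimal hE a.2 hCo.1 ih (ho.minimal_of_diff ho' hC)
          (a.2.minimal_of_diff b.2 hD)
        subst h1
        have h2 := orientationGraph_eq_of_diff ho ho' b.2 (hC.trans hD.symm)
        subst h2
        exact hne rfl
    exact hCo.2 (key _ hr)

end Orientation

namespace SimpleGraph

variable {W : Type*} {T : SimpleGraph W}

/-- The product of edge labels along a walk. -/
def Walk.labelProd {A : Type*} [Group A] (f : W → W → A) : ∀ {u v : W}, T.Walk u v → A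
  | _, _, .nil => 1
  | _, _, .cons (u := u) (v := v) _ p => p.labelProd f * f u v

theorem Walk.labelProd_concat {A : Type*} [Group A] (f : W → W → A) {u v w : W} (p : T.Walk u v)
    (h : T.Adj v w) : (p.concat h).labelProd f = f v w * p.labelProd f := by
  induction p with
  | nil => simp [labelProd, concat]
  | cons _ p ih => rw [concat_cons, labelProd, ih, labelProd, mul_assoc]

/-- Every antisymmetric labelling of the edges of a tree has a potential. -/
theorem IsTree.exists_potential (hT : T.IsTree) {A : Type*} [Group A] (f : W → W → A)
    (hf : ∀ a b, T.Adj a b → f b a = (f a b)⁻¹) :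
    ∃ φ : W → A, ∀ a b, T.Adj a b → φ b = f a b * φ a := by
  classical
  obtain ⟨r⟩ := hT.connected.nonempty
  choose p hp using fun w => (hT.existsUnique_path r w).exists
  refine ⟨fun w => (p w).labelProd f, fun a b hab => ?_⟩
  beta_reduce
  by_cases h : a ∈ (p b).support
  · rw [hT.isAcyclic.path_concat (hp a) (hp b) hab h, Walk.labelProd_concat]
  · have h' := hT.isAcyclic.mem_support_of_ne_mem_support_of_adj_of_isPath (hp a) (hp b) hab h
    rw [hT.isAcyclic.path_concat (hp b) (hp a) hab.symm h', Walk.labelProd_concat, hf a b hab]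
    group

theorem Connected.potential_unique (hc : T.Connected) {A : Type*} [Group A] {f : W → W → A}
    {φ ψ : W → A} (hφ : ∀ a b, T.Adj a b → φ b = f a b * φ a)
    (hψ : ∀ a b, T.Adj a b → ψ b = f a b * ψ a) (a b : W) :
    φ b * (φ a)⁻¹ = ψ b * (ψ a)⁻¹ := by
  have h := hc.preconnected a b
  rw [reachable_iff_reflTransGen] at h
  induction h with
  | refl => simp
  | tail _ hbc ih => rw [hφ _ _ hbc, hψ _ _ hbc, mul_assoc, mul_assoc, ih]

end SimpleGraph

section Free

universe u

variable (H W : Type u) [Group H] [MulAction H W]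

/-- The orbits of a group action, viewed as the objects of a groupoid all of whose hom-sets are
the acting group. -/
def OrbitGroupoid := MulAction.orbitRel.Quotient H W

instance : CategoryTheory.Groupoid (OrbitGroupoid H W) where
  Hom _ _ := H
  id _ := (1 : H)
  comp f g := (g * f : H)
  id_comp f := mul_one (M := H) f
  comp_id f := one_mul (M := H) f
  assoc f g h := (mul_assoc (G := H) h g f).symm
  inv f := (f⁻¹ : H)
  inv_comp f := mul_inv_cancel (G := H) f
  comp_inv f := inv_mul_cancel (G := H) f

instance [Nonempty W] : CategoryTheory.IsConnected (OrbitGroupoid H W) := by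
  have : Nonempty (OrbitGroupoid H W) :=
    ‹Nonempty W›.map (Quotient.mk (MulAction.orbitRel H W))
  exact CategoryTheory.zigzag_isConnected fun a b => CategoryTheory.Zigzag.of_hom (1 : H)

variable {H W}

/-- The endomorphism group of an orbit is the acting group. -/
def OrbitGroupoid.endEquiv (r : OrbitGroupoid H W) : CategoryTheory.End r ≃* H where
  toFun h := h
  invFun h := h
  left_inv _ := rfl
  right_inv _ := rfl
  map_mul' _ _ := rfl

/-- A group acting freely on a tree, preserving a two-colouring, is free. -/
theorem isFreeGroup_of_free_action_on_tree {T : SimpleGraph W} (hT : T.IsTree)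
    (hadj : ∀ (h : H) (a b : W), T.Adj a b → T.Adj (h • a) (h • b)) (hfree : ∀ (h : H) (a : W),
    h • a = a → h = 1) (B : Set W) (hB : ∀ a b, T.Adj a b → (a ∈ B ↔ b ∉ B))
    (hBH : ∀ (h : H) (a : W), h • a ∈ B ↔ a ∈ B) : IsFreeGroup H := by
  classical
  have := hT.connected.nonempty
  let Q := OrbitGroupoid H W
  let s : Q → W := Quotient.out
  let q : W → Q := fun w => Quotient.mk (MulAction.orbitRel H W) w
  have hq : ∀ (h : H) w, q (h • w) = q w := fun h w => Quotient.sound ⟨h, rfl⟩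
  have hqs : ∀ x, q (s x) = x := fun x => Quotient.out_eq x
  have hg : ∀ w, ∃ h : H, h • w = s (q w) := fun w =>
    Quotient.exact (s := MulAction.orbitRel H W) (hqs (q w))
  choose g hg using hg
  have hcancel : ∀ (h k : H) (a : W), h • a = k • a → h = k := fun h k a e => by
    have := hfree (k⁻¹ * h) a (by rw [mul_smul, e, inv_smul_smul])
    rwa [inv_mul_eq_one, eq_comm] at this
  have hgh : ∀ (h : H) w, g (h • w) = g w * h⁻¹ := fun h w => by
    refine hcancel _ _ (h • w) ?_
    rw [hg, mul_smul, inv_smul_smul, hg, hq]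
  have hgs : ∀ x, g (s x) = 1 := fun x => hcancel _ _ (s x) (by rw [hg, hqs, one_smul])
  let m : W → W → H := fun a b => g b * (g a)⁻¹
  have hm : ∀ (h : H) a b, m (h • a) (h • b) = m a b := fun h a b => by
    simp only [m, hgh]; group
  have hms : ∀ (h : H) x y, m (h • s x) (s y) = h := fun h x y => by
    simp only [m, hgh, hgs]; group
  have hmadj : ∀ a b, T.Adj a b → T.Adj (m a b • s (q a)) (s (q b)) := fun a b hab => by
    have := hadj (g b) _ _ hab
    rw [← hg b, ← hg a, ← mul_smul]
    simpa [m] using this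
  have hsB : ∀ a, s (q a) ∈ B ↔ a ∈ B := fun a => by rw [← hg a, hBH]
  let : IsFreeGroupoid Q :=
    { quiverGenerators := ⟨fun x y => {h : H // s x ∈ B ∧ T.Adj (h • s x) (s y)}⟩
      of := fun e => e.1
      unique_lift := by
        intro A _ f
        let f' : Q → Q → H → A := fun x y h =>
          if hh : s x ∈ B ∧ T.Adj (h • s x) (s y) then f ⟨h, hh⟩ else 1
        let F : W → W → A := fun a b =>
          if a ∈ B then f' (q a) (q b) (m a b) else (f' (q b) (q a) (m b a))⁻¹
        have hFH : ∀ (h : H) a b, F (h • a) (h • b) = F a b := fun h a b => by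
          simp only [F, hq, hm, hBH]
        obtain ⟨φ, hφ⟩ := hT.exists_potential F (fun a b hab => by
          have := hB a b hab
          by_cases h1 : a ∈ B
          · simp [F, h1, this.1 h1]
          · have h2 : b ∈ B := by tauto
            simp [F, h1, h2])
        have hφH : ∀ (h : H) a b, φ (h • b) * (φ (h • a))⁻¹ = φ b * (φ a)⁻¹ := fun h a b =>
          hT.connected.potential_unique (f := F) (φ := fun a => φ (h • a))
            (fun a b hab => by rw [hφ _ _ (hadj h a b hab), hFH]) hφ a b
        refine ⟨{ obj := fun _ => CategoryTheory.SingleObj.star A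
                  map := fun {x y} h => (φ (s y) * (φ ((h : H) • s x))⁻¹ : A)
                  map_id := fun x => ?_
                  map_comp := fun {x y z} h k => ?_ }, ?_, ?_⟩
        · change φ (s x) * (φ ((1 : H) • s x))⁻¹ = 1
          simp
        · change φ (s z) * (φ ((k * h : H) • s x))⁻¹ =
            φ (s z) * (φ ((k : H) • s y))⁻¹ * (φ (s y) * (φ ((h : H) • s x))⁻¹)
          rw [← hφH k (h • s x) (s y), mul_smul]
          group
        · have key : ∀ (x y : Q) (h : H), s x ∈ B ∧ T.Adj (h • s x) (s y) →
              φ (s y) * (φ (h • s x))⁻¹ = f' x y h := fun x y h hh => by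
            rw [hφ _ _ hh.2, mul_inv_cancel_right]
            simp only [F, hq, hqs, hms, hBH, hh.1, if_true]
          rintro x y ⟨h, hh⟩
          exact (key x y h hh).trans (dif_pos hh)
        · intro F' hF'
          let c : Q → Q → H → A := fun x y h => F'.map (X := x) (Y := y) h
          have hc : ∀ x y z h k, c x z (k * h) = c y z k * c x y h := fun x y z h k =>
            F'.map_comp (X := x) (Y := y) (Z := z) h k
          have hc1 : ∀ x, c x x 1 = 1 := fun x => F'.map_id x
          have hcm : ∀ a b d, c (q a) (q d) (m a d) =
              c (q b) (q d) (m b d) * c (q a) (q b) (m a b) := fun a b d => by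
            rw [← hc]; congr 1; simp only [m]; group
          have hcf : ∀ x y h, s x ∈ B ∧ T.Adj (h • s x) (s y) → c x y h = f' x y h :=
            fun x y h hh => by
              simp only [f', dif_pos hh]
              exact hF' x y ⟨h, hh⟩
          have hcF : ∀ a b, T.Adj a b → c (q a) (q b) (m a b) = F a b := fun a b hab => by
            by_cases h1 : a ∈ B
            · simp only [F, h1, if_true]
              exact hcf _ _ _ ⟨(hsB a).2 h1, hmadj a b hab⟩
            · have h2 : b ∈ B := by have := hB a b hab; tauto
              simp only [F, h1, if_false]
              rw [← hcf _ _ _ ⟨(hsB b).2 h2, hmadj b a hab.symm⟩, eq_inv_iff_mul_eq_one, ← hc]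
              have : m a b * m b a = 1 := by simp only [m]; group
              rw [this, hc1]
          obtain ⟨a0⟩ := hT.connected.nonempty
          have huniq := hT.connected.potential_unique
            (ψ := fun a => c (q a0) (q a) (m a0 a)) hφ fun a b hab => by
              rw [← hcF a b hab]; exact hcm a0 a b
          refine CategoryTheory.Functor.hext (fun _ => rfl) fun x y h => heq_of_eq ?_
          change c x y h = φ (s y) * (φ ((h : H) • s x))⁻¹
          rw [huniq ((h : H) • s x) (s y), eq_mul_inv_iff_mul_eq]
          have := hcm a0 ((h : H) • s x) (s y)
          rw [this]
          simp only [hq, hqs, hms] }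
  obtain ⟨r⟩ : Nonempty Q := ‹Nonempty W›.map q
  have := IsFreeGroupoid.endIsFreeOfConnectedFree r
  exact IsFreeGroup.ofMulEquiv (OrbitGroupoid.endEquiv r)

end Free

section EquivariantBijections

universe u v

/-- Two finite sets of the same size with free actions of a finite group are equivariantly
isomorphic. -/
theorem exists_equivariant_equiv {K X Y : Type*} [Group K] [Finite K] [MulAction K X]
    [MulAction K Y] [Finite X] [Finite Y] (hX : ∀ (k : K) (x : X), k • x = x → k = 1)
    (hY : ∀ (k : K) (y : Y), k • y = y → k = 1) (hcard : Nat.card X = Nat.card Y) :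
    ∃ e : X ≃ Y, ∀ (k : K) (x : X), e (k • x) = k • e x := by
  have hsX : ∀ x : X, MulAction.stabilizer K x = ⊥ := fun x =>
    (Subgroup.eq_bot_iff_forall _).2 fun k hk => hX k x hk
  have hsY : ∀ y : Y, MulAction.stabilizer K y = ⊥ := fun y =>
    (Subgroup.eq_bot_iff_forall _).2 fun k hk => hY k y hk
  have hq : Nat.card (MulAction.orbitRel.Quotient K X) =
      Nat.card (MulAction.orbitRel.Quotient K Y) := by
    rw [Nat.card_congr (MulAction.selfEquivOrbitsQuotientProd hsX),
      Nat.card_congr (MulAction.selfEquivOrbitsQuotientProd hsY), Nat.card_prod,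
      Nat.card_prod] at hcard
    exact Nat.eq_of_mul_eq_mul_right Nat.card_pos hcard
  have : Finite (MulAction.orbitRel.Quotient K X) := inferInstanceAs (Finite (Quotient _))
  have : Finite (MulAction.orbitRel.Quotient K Y) := inferInstanceAs (Finite (Quotient _))
  obtain ⟨ε⟩ := Finite.card_eq.1 hq
  have hcX : ∀ (k l : K) (x : X), k • x = l • x → k = l := fun k l x h => by
    have := hX (l⁻¹ * k) x (by rw [mul_smul, h, inv_smul_smul])
    rwa [inv_mul_eq_one, eq_comm] at this
  have hcY : ∀ (k l : K) (y : Y), k • y = l • y → k = l := fun k l y h => by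
    have := hY (l⁻¹ * k) y (by rw [mul_smul, h, inv_smul_smul])
    rwa [inv_mul_eq_one, eq_comm] at this
  let sX : MulAction.orbitRel.Quotient K X → X := Quotient.out
  let sY : MulAction.orbitRel.Quotient K Y → Y := Quotient.out
  let qX : X → MulAction.orbitRel.Quotient K X := Quotient.mk (MulAction.orbitRel K X)
  let qY : Y → MulAction.orbitRel.Quotient K Y := Quotient.mk (MulAction.orbitRel K Y)
  have hqX : ∀ (k : K) x, qX (k • x) = qX x := fun k x => Quotient.sound ⟨k, rfl⟩
  have hqY : ∀ (k : K) y, qY (k • y) = qY y := fun k x => Quotient.sound ⟨k, rfl⟩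
  have hqsX : ∀ o, qX (sX o) = o := fun o => Quotient.out_eq o
  have hqsY : ∀ o, qY (sY o) = o := fun o => Quotient.out_eq o
  have hgX : ∀ x, ∃ k : K, k • sX (qX x) = x := fun x =>
    Quotient.exact (s := MulAction.orbitRel K X) (hqsX (qX x)).symm
  have hgY : ∀ y, ∃ k : K, k • sY (qY y) = y := fun y =>
    Quotient.exact (s := MulAction.orbitRel K Y) (hqsY (qY y)).symm
  choose gX hgX using hgX
  choose gY hgY using hgY
  have hgkX : ∀ (k : K) x, gX (k • x) = k * gX x := fun k x => by
    refine hcX _ _ (sX (qX x)) ?_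
    rw [mul_smul, hgX, ← hqX k x, hgX]
  have hgkY : ∀ (k : K) y, gY (k • y) = k * gY y := fun k y => by
    refine hcY _ _ (sY (qY y)) ?_
    rw [mul_smul, hgY, ← hqY k y, hgY]
  have hgsX : ∀ o, gX (sX o) = 1 := fun o => hX _ (sX o) (by simpa only [hqsX] using hgX (sX o))
  have hgsY : ∀ o, gY (sY o) = 1 := fun o => hY _ (sY o) (by simpa only [hqsY] using hgY (sY o))
  refine ⟨⟨fun x => gX x • sY (ε (qX x)), fun y => gY y • sX (ε.symm (qY y)), fun x => ?_,
    fun y => ?_⟩, fun k x => ?_⟩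
  · simp only [hgkY, hgsY, hqY, hqsY, mul_one, Equiv.symm_apply_apply, hgX]
  · simp only [hgkX, hgsX, hqX, hqsX, mul_one, Equiv.apply_symm_apply, hgY]
  · simp only [Equiv.coe_fn_mk, hgkX, hqX, mul_smul]

variable {G : Type u} {W : Type v} [Group G] [MulAction G W]

/-- If the orders of all point stabilizers divide `N`, then the action is covered by a free action
with fibres of size `N`. -/
theorem exists_free_cover {N : ℕ}
    (hst : ∀ w : W, Finite (MulAction.stabilizer G w) ∧ Nat.card (MulAction.stabilizer G w) ∣ N) :
    ∃ (P : Type (max u v)) (_ : MulAction G P) (π : P → W),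
      (∀ (g : G) x, π (g • x) = g • π x) ∧ (∀ (g : G) (x : P), g • x = x → g = 1) ∧
      ∀ w, Nat.card {x // π x = w} = N := by
  let Q := MulAction.orbitRel.Quotient G W
  let s : Q → W := Quotient.out
  let q : W → Q := Quotient.mk (MulAction.orbitRel G W)
  have hqg : ∀ (g : G) w, q (g • w) = q w := fun g w => Quotient.sound ⟨g, rfl⟩
  have hqs : ∀ o, q (s o) = o := fun o => Quotient.out_eq o
  let P := Σ o : Q, G × Fin (N / Nat.card (MulAction.stabilizer G (s o)))
  let _ : MulAction G P :=
    { smul := fun g x => ⟨x.1, g * x.2.1, x.2.2⟩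
      one_smul := fun x => by
        change (⟨x.1, 1 * x.2.1, x.2.2⟩ : P) = x
        rw [one_mul]
      mul_smul := fun g h x => by
        change (⟨x.1, g * h * x.2.1, x.2.2⟩ : P) = ⟨x.1, g * (h * x.2.1), x.2.2⟩
        rw [mul_assoc] }
  refine ⟨P, inferInstance, fun x => x.2.1 • s x.1, fun g x => mul_smul g _ _, fun g x h => ?_,
    fun w => ?_⟩
  · have h1 : (⟨x.1, g * x.2.1, x.2.2⟩ : P) = ⟨x.1, x.2.1, x.2.2⟩ := h
    have h2 := (Prod.mk.inj (eq_of_heq (Sigma.mk.inj h1).2)).1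
    simpa using h2
  · obtain ⟨g, hg⟩ : ∃ g : G, g • s (q w) = w :=
      Quotient.exact (s := MulAction.orbitRel G W) (hqs (q w)).symm
    let F : MulAction.stabilizer G (s (q w)) ×
        Fin (N / Nat.card (MulAction.stabilizer G (s (q w)))) →
        {x : P // x.2.1 • s x.1 = w} := fun y => ⟨⟨q w, g * y.1, y.2⟩, by
          change (g * (y.1 : G)) • s (q w) = w
          rw [mul_smul, y.1.2, hg]⟩
    have hF : Function.Bijective F := by
      constructor
      · rintro ⟨⟨k, hk⟩, i⟩ ⟨⟨l, hl⟩, j⟩ h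
        have h1 := Sigma.mk.inj (Subtype.mk.inj h)
        have h2 := Prod.mk.inj (eq_of_heq h1.2)
        have h3 : k = l := by simpa using h2.1
        subst h3
        rw [Prod.mk.injEq]
        exact ⟨rfl, h2.2⟩
      · rintro ⟨⟨o, h, i⟩, hx⟩
        change h • s o = w at hx
        obtain rfl : o = q w := by rw [← hx, hqg, hqs]
        refine ⟨⟨⟨g⁻¹ * h, ?_⟩, i⟩, ?_⟩
        · rw [MulAction.mem_stabilizer_iff, mul_smul, hx, inv_smul_eq_iff, hg]
        · simp [F]
    have hfin := (hst (s (q w))).1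
    rw [← Nat.card_congr (Equiv.ofBijective F hF), Nat.card_prod, Nat.card_fin,
      Nat.mul_div_cancel' (hst (s (q w))).2]

end EquivariantBijections

section Transport

variable {G W P : Type*} [Group G] [MulAction G W] [MulAction G P] {π : P → W}

/-- Equivariant bijections between the fibres of a free cover. -/
theorem exists_equivariant_fibre_equiv {N : ℕ} (hN : 0 < N)
    (hst : ∀ w : W, Finite (MulAction.stabilizer G w))
    (hπ : ∀ (g : G) x, π (g • x) = g • π x) (hfree : ∀ (g : G) (x : P), g • x = x → g = 1)
    (hcard : ∀ w, Nat.card {x // π x = w} = N) :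
    ∃ σ : ∀ a b : W, {x // π x = a} ≃ {x // π x = b}, ∀ (g : G) (a b : W) (x : P) (hx : π x = a),
      (σ (g • a) (g • b) ⟨g • x, by rw [hπ, hx]⟩ : P) = g • (σ a b ⟨x, hx⟩ : P) := by
  have hfin : ∀ w, Finite {x // π x = w} := fun w =>
    Nat.finite_of_card_ne_zero (by rw [hcard]; omega)
  have hθ : ∀ e : W × W, ∃ θ : {x // π x = e.1} ≃ {x // π x = e.2}, ∀ (k : G) (x : P)
      (hx : π x = e.1) (hk1 : k • e.1 = e.1) (hk2 : k • e.2 = e.2),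
      (θ ⟨k • x, by rw [hπ, hx, hk1]⟩ : P) = k • (θ ⟨x, hx⟩ : P) := by
    rintro ⟨a, b⟩
    let K : Subgroup G := MulAction.stabilizer G a ⊓ MulAction.stabilizer G b
    have hK : Finite K := by
      have := hst a
      exact Finite.of_injective _ (Subgroup.inclusion_injective
        (inf_le_left : K ≤ MulAction.stabilizer G a))
    let A : SubMulAction K P := ⟨{x | π x = a}, fun k {x} (hx : π x = a) => by
      change π ((k : G) • x) = a
      rw [hπ, hx]; exact k.2.1⟩
    let B : SubMulAction K P := ⟨{x | π x = b}, fun k {x} (hx : π x = b) => by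
      change π ((k : G) • x) = b
      rw [hπ, hx]; exact k.2.2⟩
    have : Finite A := hfin a
    have : Finite B := hfin b
    have hf : ∀ (S : SubMulAction K P) (k : K) (x : S), k • x = x → k = 1 := fun S k x h =>
      Subtype.ext (hfree k x (congrArg Subtype.val h))
    obtain ⟨e, he⟩ := exists_equivariant_equiv (K := K) (X := A) (Y := B) (hf A) (hf B)
      ((hcard a).trans (hcard b).symm)
    refine ⟨e, fun k x hx hk1 hk2 => ?_⟩
    exact congrArg Subtype.val (he ⟨k, hk1, hk2⟩ ⟨x, hx⟩)
  choose θ hθ using hθ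
  let Q := MulAction.orbitRel.Quotient G (W × W)
  let s : Q → W × W := Quotient.out
  let q : W × W → Q := Quotient.mk (MulAction.orbitRel G (W × W))
  have hqg : ∀ (g : G) w, q (g • w) = q w := fun g w => Quotient.sound ⟨g, rfl⟩
  have hqs : ∀ o, q (s o) = o := fun o => Quotient.out_eq o
  have hγ : ∀ e : W × W, ∃ g : G, g • e = s (q e) := fun e =>
    Quotient.exact (s := MulAction.orbitRel G (W × W)) (hqs (q e))
  choose γ hγ using hγ
  let tr : ∀ (g : G) (a b : W), g • a = b → ({x // π x = a} ≃ {x // π x = b}) := fun g a b h =>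
    { toFun := fun x => ⟨g • x.1, by rw [hπ, x.2, h]⟩
      invFun := fun x => ⟨g⁻¹ • x.1, by rw [hπ, x.2, ← h, inv_smul_smul]⟩
      left_inv := fun x => Subtype.ext (inv_smul_smul g x.1)
      right_inv := fun x => Subtype.ext (smul_inv_smul g x.1) }
  refine ⟨fun a b => ((tr (γ (a, b)) a _ (congrArg Prod.fst (hγ (a, b)))).trans
    (θ (s (q (a, b))))).trans (tr (γ (a, b)) b _ (congrArg Prod.snd (hγ (a, b)))).symm,
    fun g a b x hx => ?_⟩
  have hcong : ∀ (e e' : W × W) (y y' : P) (hy : π y = e.1) (hy' : π y' = e'.1), e = e' → y = y' →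
      (θ e ⟨y, hy⟩ : P) = θ e' ⟨y', hy'⟩ := by
    rintro e _ y _ hy hy' rfl rfl
    rfl
  let k : G := γ (g • a, g • b) * g * (γ (a, b))⁻¹
  have hk : k • s (q (a, b)) = s (q (a, b)) := by
    rw [← hγ (a, b), ← mul_smul, inv_mul_cancel_right, mul_smul]
    change γ (g • (a, b)) • (g • (a, b)) = _
    rw [hγ, hqg, hγ]
  have h1 : π (γ (a, b) • x) = (s (q (a, b))).1 := by
    rw [hπ, hx]; exact congrArg Prod.fst (hγ (a, b))
  have h2 := hθ (s (q (a, b))) k (γ (a, b) • x) h1 (congrArg Prod.fst hk) (congrArg Prod.snd hk)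
  change (γ (g • a, g • b))⁻¹ • (θ (s (q (g • a, g • b))) ⟨γ (g • a, g • b) • g • x, _⟩ : P) =
    g • (γ (a, b))⁻¹ • (θ (s (q (a, b))) ⟨γ (a, b) • x, _⟩ : P)
  rw [inv_smul_eq_iff]
  refine Eq.trans (hcong _ _ _ _ _ _ ?_ ?_) (h2.trans (by simp only [k, mul_smul]))
  · change s (q (g • (a, b))) = _
    rw [hqg]
  · rw [← mul_smul, ← mul_smul]
    simp [k]

/-- Equivariant permutations exchanging the fibres of a free cover. -/
theorem exists_equivariant_swaps {N : ℕ} (hN : 0 < N)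
    (hst : ∀ w : W, Finite (MulAction.stabilizer G w))
    (hπ : ∀ (g : G) x, π (g • x) = g • π x) (hfree : ∀ (g : G) (x : P), g • x = x → g = 1)
    (hcard : ∀ w, Nat.card {x // π x = w} = N) :
    ∃ t : W → W → Equiv.Perm P, ∀ a b : W, a ≠ b → (t a b)⁻¹ = t a b ∧
      (∀ x, π x = a → π (t a b x) = b) ∧ (∀ x, π x = b → π (t a b x) = a) ∧
      ∀ (g : G) x, (π x = a ∨ π x = b) → t (g • a) (g • b) (g • x) = g • t a b x := by
  classical
  obtain ⟨σ, hσ⟩ := exists_equivariant_fibre_equiv hN hst hπ hfree hcard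
  let f : W → W → P → P := fun a b x =>
    if h : π x = a then (σ a b ⟨x, h⟩ : P) else if h : π x = b then ((σ a b).symm ⟨x, h⟩ : P) else x
  have hf1 : ∀ a b x (h : π x = a), f a b x = σ a b ⟨x, h⟩ := fun a b x h => dif_pos h
  have hf2 : ∀ a b x (h : π x = b), a ≠ b → f a b x = (σ a b).symm ⟨x, h⟩ := fun a b x h hab => by
    have h1 : ¬ π x = a := fun h1 => hab (h1.symm.trans h)
    simp only [f, dif_neg h1, dif_pos h]
  have hπ1 : ∀ a b x, π x = a → π (f a b x) = b := fun a b x h => by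
    rw [hf1 a b x h]; exact (σ a b ⟨x, h⟩).2
  have hπ2 : ∀ a b x, a ≠ b → π x = b → π (f a b x) = a := fun a b x hab h => by
    rw [hf2 a b x h hab]; exact ((σ a b).symm ⟨x, h⟩).2
  have hinv : ∀ a b, a ≠ b → Function.Involutive (f a b) := by
    intro a b hab x
    by_cases h1 : π x = a
    · rw [hf2 a b _ (hπ1 a b x h1) hab]
      have : (⟨f a b x, hπ1 a b x h1⟩ : {x // π x = b}) = σ a b ⟨x, h1⟩ :=
        Subtype.ext (hf1 a b x h1)
      rw [this, Equiv.symm_apply_apply]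
    · by_cases h2 : π x = b
      · rw [hf1 a b _ (hπ2 a b x hab h2)]
        have : (⟨f a b x, hπ2 a b x hab h2⟩ : {x // π x = a}) = (σ a b).symm ⟨x, h2⟩ :=
          Subtype.ext (hf2 a b x h2 hab)
        rw [this, Equiv.apply_symm_apply]
      · have : f a b x = x := by simp only [f, dif_neg h1, dif_neg h2]
        rw [this, this]
  refine ⟨fun a b => if hab : a ≠ b then (hinv a b hab).toPerm else 1, fun a b hab => ?_⟩
  simp only [dif_pos hab, Function.Involutive.coe_toPerm]
  refine ⟨Function.Involutive.toPerm_symm _, hπ1 a b, fun x => hπ2 a b x hab, fun g x hx => ?_⟩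
  have hab' : g • a ≠ g • b := fun h => hab (MulAction.injective g h)
  rw [dif_pos hab', Function.Involutive.coe_toPerm]
  have key : ∀ x, π x = a → f (g • a) (g • b) (g • x) = g • f a b x := fun x h => by
    rw [hf1 _ _ (g • x) (by rw [hπ, h]), hf1 a b x h, hσ]
  rcases hx with h | h
  · exact key x h
  · refine (hinv _ _ hab').injective ?_
    rw [hinv _ _ hab', key _ (hπ2 a b x hab h), hinv _ _ hab]

end Transport

section VirtuallyFree

universe u

variable {G W : Type u} [Group G] [MulAction G W] {T : SimpleGraph W}

/-- A group acting on a tree with finite stabilizers of bounded order, preserving a two-colouring,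
has a finite index subgroup acting freely. -/
theorem exists_finiteIndex_free_action (hT : T.IsTree)
    (hadj : ∀ (g : G) (a b : W), T.Adj a b → T.Adj (g • a) (g • b)) (B : Set W)
    (hB : ∀ a b, T.Adj a b → (a ∈ B ↔ b ∉ B)) (hBG : ∀ (g : G) (a : W), g • a ∈ B ↔ a ∈ B)
    {N : ℕ} (hN : 0 < N)
    (hst : ∀ w : W, Finite (MulAction.stabilizer G w) ∧ Nat.card (MulAction.stabilizer G w) ∣ N) :
    ∃ H : Subgroup G, H.FiniteIndex ∧ ∀ h ∈ H, ∀ w : W, h • w = w → h = 1 := by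
  classical
  obtain ⟨P, _, π, hπ, hfree, hcard⟩ := exists_free_cover hst
  obtain ⟨s, hs⟩ := exists_equivariant_swaps hN (fun w => (hst w).1) hπ hfree hcard
  let t : W → W → Equiv.Perm P := fun a b => if a ∈ B then s a b else s b a
  have ht1 : ∀ a b, T.Adj a b → t b a = (t a b)⁻¹ := by
    intro a b hab
    have h1 := hB a b hab
    by_cases ha : a ∈ B
    · simp only [t, ha, if_true, h1.1 ha, if_false, (hs a b hab.ne).1]
    · have hb : b ∈ B := by tauto
      simp only [t, ha, if_true, hb, if_false, (hs b a hab.ne').1]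
  have ht2 : ∀ a b, T.Adj a b → ∀ x, π x = a → π (t a b x) = b := by
    intro a b hab x hx
    by_cases ha : a ∈ B
    · simp only [t, ha, if_true]; exact (hs a b hab.ne).2.1 x hx
    · simp only [t, ha, if_false]; exact (hs b a hab.ne').2.2.1 x hx
  have ht3 : ∀ a b, T.Adj a b → ∀ (g : G) x, π x = a → t (g • a) (g • b) (g • x) = g • t a b x := by
    intro a b hab g x hx
    by_cases ha : a ∈ B
    · simp only [t, ha, if_true, hBG]; exact (hs a b hab.ne).2.2.2 g x (Or.inl hx)
    · simp only [t, ha, if_false, hBG]; exact (hs b a hab.ne').2.2.2 g x (Or.inr hx)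
  obtain ⟨φ, hφ⟩ := hT.exists_potential t ht1
  let F : Set (W → P) := {σ | (∀ w, π (σ w) = w) ∧ ∀ a b, T.Adj a b → σ b = t a b (σ a)}
  let act : MulAction G F :=
    { smul := fun g σ => ⟨fun w => g • σ.1 (g⁻¹ • w), fun w => by
          rw [hπ, σ.2.1, smul_inv_smul], fun a b hab => by
          have h1 := hadj g⁻¹ a b hab
          have h2 := ht3 _ _ h1 g _ (σ.2.1 (g⁻¹ • a))
          simp only [smul_inv_smul] at h2
          beta_reduce
          rw [h2, σ.2.2 _ _ h1]⟩
      one_smul := fun σ => Subtype.ext (funext fun w => by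
        change (1 : G) • σ.1 ((1 : G)⁻¹ • w) = σ.1 w
        simp)
      mul_smul := fun g h σ => Subtype.ext (funext fun w => by
        change (g * h) • σ.1 ((g * h)⁻¹ • w) = g • h • σ.1 (h⁻¹ • g⁻¹ • w)
        rw [mul_smul, mul_inv_rev, mul_smul]) }
  have hext : ∀ x : P, ∃ σ : F, σ.1 (π x) = x := by
    intro x
    refine ⟨⟨fun w => φ w ((φ (π x))⁻¹ x), fun w => ?_, fun a b hab => ?_⟩, ?_⟩
    · have h := hT.connected.preconnected (π x) w
      rw [SimpleGraph.reachable_iff_reflTransGen] at h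
      induction h with
      | refl => simp
      | tail _ hbc ih =>
        beta_reduce at ih ⊢
        rw [hφ _ _ hbc, Equiv.Perm.mul_apply]
        exact ht2 _ _ hbc _ ih
    · beta_reduce
      rw [hφ _ _ hab, Equiv.Perm.mul_apply]
    · simp
  obtain ⟨w₀⟩ := hT.connected.nonempty
  have hFfin : Finite F := by
    have : Finite {x // π x = w₀} := Nat.finite_of_card_ne_zero (by rw [hcard]; omega)
    refine Finite.of_injective (fun σ : F => (⟨σ.1 w₀, σ.2.1 w₀⟩ : {x // π x = w₀})) ?_
    intro σ σ' h
    refine Subtype.ext (funext fun w => ?_)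
    have h' := hT.connected.preconnected w₀ w
    rw [SimpleGraph.reachable_iff_reflTransGen] at h'
    induction h' with
    | refl => exact congrArg Subtype.val h
    | tail _ hbc ih => rw [σ.2.2 _ _ hbc, σ'.2.2 _ _ hbc, ih]
  refine ⟨(MulAction.toPermHom G F).ker, inferInstance, fun h hh w hw => ?_⟩
  obtain ⟨⟨x, rfl⟩⟩ : Nonempty {x // π x = w} := by
    refine (Nat.card_pos_iff.1 ?_).1
    rw [hcard]; exact hN
  obtain ⟨σ, hσ⟩ := hext x
  refine hfree h x ?_
  have h1 : h • σ = σ := DFunLike.congr_fun (MonoidHom.mem_ker.1 hh) σ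
  have h2 : h • σ.1 (h⁻¹ • π x) = σ.1 (π x) := congrFun (congrArg Subtype.val h1) (π x)
  rwa [inv_smul_eq_iff.2 hw.symm, hσ] at h2

/-- A group acting on a tree with finite stabilizers of bounded order is virtually free. -/
theorem exists_isFreeGroup_of_action_on_tree (hT : T.IsTree)
    (hadj : ∀ (g : G) (a b : W), T.Adj a b → T.Adj (g • a) (g • b)) {N : ℕ} (hN : 0 < N)
    (hst : ∀ w : W, Finite (MulAction.stabilizer G w) ∧ Nat.card (MulAction.stabilizer G w) ∣ N) :
    ∃ H : Subgroup G, H.FiniteIndex ∧ IsFreeGroup H := by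
  obtain ⟨w₀⟩ := hT.connected.nonempty
  let B : Set W := {w | hT.coloringTwo w = 0}
  have hB : ∀ a b, T.Adj a b → (a ∈ B ↔ b ∉ B) := by
    intro a b hab
    have h := hT.coloringTwo.valid hab
    change hT.coloringTwo a = 0 ↔ ¬ hT.coloringTwo b = 0
    omega
  have hBG : ∀ (g : G) (a b : W), (g • a ∈ B ↔ a ∈ B) → (g • b ∈ B ↔ b ∈ B) := by
    intro g a b h
    have h' := hT.connected.preconnected a b
    rw [SimpleGraph.reachable_iff_reflTransGen] at h'
    induction h' with
    | refl => exact h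
    | tail _ hbc ih =>
      have h1 := hB _ _ hbc
      have h2 := hB _ _ (hadj g _ _ hbc)
      tauto
  let G₀ : Subgroup G :=
    { carrier := {g | ∀ w, g • w ∈ B ↔ w ∈ B}
      one_mem' := fun w => by rw [one_smul]
      mul_mem' := fun {g h} hg hh w => by rw [mul_smul, hg, hh]
      inv_mem' := fun {g} hg w => by rw [← hg, smul_inv_smul] }
  have hG₀ : G₀.FiniteIndex := by
    have : Finite (G ⧸ G₀) := by
      refine Finite.of_injective (β := Prop) (Quotient.lift (fun g : G => g⁻¹ • w₀ ∈ B) ?_) ?_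
      · intro g h hgh
        rw [← Quotient.eq_iff_equiv] at hgh
        have h1 : g⁻¹ * h ∈ G₀ := QuotientGroup.eq.1 hgh
        have h2 := h1 (h⁻¹ • w₀)
        rw [mul_smul, smul_inv_smul] at h2
        exact propext h2
      · rintro ⟨g⟩ ⟨h⟩ hgh
        have h1 : (g⁻¹ • w₀ ∈ B) = (h⁻¹ • w₀ ∈ B) := hgh
        refine QuotientGroup.eq.2 fun w => hBG _ (h⁻¹ • w₀) w ?_
        rw [mul_smul, smul_inv_smul, h1]
    exact Subgroup.finiteIndex_of_finite_quotient
  have hst' : ∀ w : W, Finite (MulAction.stabilizer G₀ w) ∧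
      Nat.card (MulAction.stabilizer G₀ w) ∣ N := by
    intro w
    let ι : MulAction.stabilizer G₀ w →* MulAction.stabilizer G w :=
      { toFun := fun g => ⟨g.1.1, g.2⟩
        map_one' := rfl
        map_mul' := fun _ _ => rfl }
    have hι : Function.Injective ι := fun g h e =>
      Subtype.ext (Subtype.ext (congrArg (fun y : MulAction.stabilizer G w => (y : G)) e))
    have := (hst w).1
    exact ⟨Finite.of_injective ι hι, (Subgroup.card_dvd_of_injective ι hι).trans (hst w).2⟩
  obtain ⟨H, hHfin, hHfree⟩ := exists_finiteIndex_free_action (G := G₀) hT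
    (fun g a b h => hadj g a b h) B hB (fun g a => g.2 a) hN hst'
  have hfr : IsFreeGroup H := isFreeGroup_of_free_action_on_tree hT
    (fun h a b hab => hadj h a b hab)
    (fun h a ha => Subtype.ext (hHfree h h.2 a ha)) B hB (fun h a => h.1.2 a)
  refine ⟨H.map G₀.subtype, ?_, ?_⟩
  · refine ⟨?_⟩
    rw [Subgroup.index_map_subtype]
    exact mul_ne_zero hHfin.index_ne_zero hG₀.index_ne_zero
  · exact IsFreeGroup.ofMulEquiv (H.equivMapOfInjective G₀.subtype G₀.subtype_injective)

end VirtuallyFree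

namespace SimpleGraph

variable {V : Type*} {X : SimpleGraph V}

/-- The connected component of `y` in the complement of the ball of radius `N` around `x`. -/
def outsideComponent (X : SimpleGraph V) (x : V) (N : ℕ) (y : V) : Set V :=
  {y' | (X.outside x N).Reachable y y'}

theorem lt_dist_of_mem_outsideComponent {x y y' : V} {N : ℕ} (hy : N < X.dist x y)
    (h : y' ∈ X.outsideComponent x N y) : N < X.dist x y' := by
  have h' : (X.outside x N).Reachable y y' := h
  rw [reachable_iff_reflTransGen] at h'
  cases h' with
  | refl => exact hy
  | tail _ h => exact h.2.2

theorem outsideComponent_eq_of_mem {x y y' : V} {N : ℕ} (h : y' ∈ X.outsideComponent x N y) :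
    X.outsideComponent x N y' = X.outsideComponent x N y :=
  Set.ext fun _ => ⟨fun h' => Reachable.trans h h', fun h' => (Reachable.symm h).trans h'⟩

theorem dist_of_mem_edgeBoundary_outsideComponent (hc : X.Connected) {x y : V} {N : ℕ}
    (hy : N < X.dist x y) {e : V × V} (he : e ∈ X.edgeBoundary (X.outsideComponent x N y)) :
    X.dist x e.1 = N + 1 := by
  obtain ⟨h1, h2, h3⟩ := he
  have h4 := lt_dist_of_mem_outsideComponent hy h2
  have h5 : X.dist x e.2 ≤ N := by
    by_contra! h5
    exact h3 (Reachable.trans h2 (Adj.reachable ⟨h1, h4, h5⟩))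
  have h6 := hc.dist_triangle (u := x) (v := e.2) (w := e.1)
  rw [dist_eq_one_iff_adj.2 h1.symm] at h6
  omega

/-- The complementary components of balls have edge boundaries of bounded size. -/
theorem HasBottlenecks.exists_ncard_edgeBoundary_le {M : ℕ} (hM : X.HasBottlenecks M)
    (hc : X.Connected) {b : ℕ → ℕ}
    (hb : ∀ v r, {w | X.dist v w ≤ r}.Finite ∧ {w | X.dist v w ≤ r}.ncard ≤ b r) :
    ∃ K, ∀ x N y, M ≤ N → N < X.dist x y → (X.edgeBoundary (X.outsideComponent x N y)).Finite ∧
      (X.edgeBoundary (X.outsideComponent x N y)).ncard ≤ K := by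
  refine ⟨b (M + 2) * b (M + 2), fun x N y hN hy => ?_⟩
  obtain ⟨a, ha, ha'⟩ := hM x N hN y hy
  have hsub : X.edgeBoundary (X.outsideComponent x N y) ⊆
      {w | X.dist a w ≤ M + 2} ×ˢ {w | X.dist a w ≤ M + 2} := by
    intro e he
    have h1 := dist_of_mem_edgeBoundary_outsideComponent hc hy he
    have h2 := ha' e.1 he.2.1
    have h3 := hc.dist_triangle (u := a) (v := e.1) (w := e.2)
    rw [dist_eq_one_iff_adj.2 he.1] at h3
    exact ⟨show X.dist a e.1 ≤ M + 2 by omega, show X.dist a e.2 ≤ M + 2 by omega⟩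
  have hfin := (hb a (M + 2)).1.prod (hb a (M + 2)).1
  refine ⟨hfin.subset hsub, (Set.ncard_le_ncard hsub hfin).trans ?_⟩
  rw [Set.ncard_prod]
  exact Nat.mul_le_mul (hb a _).2 (hb a _).2

theorem reachable_outside_of_seq {γ : ℕ → V} {x : V} {N s e : ℕ} (hse : s ≤ e)
    (hadj : ∀ t, s ≤ t → t < e → X.Adj (γ t) (γ (t + 1)))
    (h : ∀ t, s ≤ t → t ≤ e → N < X.dist x (γ t)) :
    (X.outside x N).Reachable (γ s) (γ e) := by
  induction e, hse using Nat.le_induction with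
  | base => exact Reachable.refl _
  | succ e hse ih =>
    refine (ih (fun t h1 h2 => hadj t h1 (by omega)) fun t h1 h2 => h t h1 (by omega)).trans ?_
    exact Adj.reachable ⟨hadj e hse (by omega), h e hse (by omega), h (e + 1) (by omega) le_rfl⟩

theorem reachable_outside_of_dist_add_lt (hc : X.Connected) {x u v : V} {N : ℕ}
    (h : X.dist u v + N < X.dist x u) : (X.outside x N).Reachable u v := by
  obtain ⟨γ, hγ⟩ := exists_isGeodesicSeq hc u v
  have h1 := reachable_outside_of_seq (X := X) (γ := γ) (x := x) (N := N)
    (Nat.zero_le (X.dist u v)) (fun t _ ht => hγ.2.2 t ht) fun t _ ht => by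
      have h2 := hγ.dist_left hc ht
      have h3 := hc.dist_triangle (u := x) (v := γ t) (w := u)
      rw [dist_comm (u := γ t)] at h3
      omega
  rwa [hγ.1, hγ.2.1] at h1

theorem exists_mem_outsideComponent (hc : X.Connected) {x y : V} {N : ℕ} (hy : N < X.dist x y) :
    ∃ u, X.dist x u = N + 1 ∧ y ∈ X.outsideComponent x N u := by
  obtain ⟨γ, hγ⟩ := exists_isGeodesicSeq hc x y
  refine ⟨γ (N + 1), hγ.dist_left hc hy, ?_⟩
  have h1 := reachable_outside_of_seq (X := X) (γ := γ) (x := x) (N := N) hy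
    (fun t _ ht => hγ.2.2 t ht) fun t ht ht' => by rw [hγ.dist_left hc ht']; exact ht
  rwa [hγ.2.1] at h1

theorem outsideComponent_subset_of_notMem (hc : X.Connected) {x y z : V} {N : ℕ}
    (hz : 2 * N < X.dist x z) (h : z ∉ X.outsideComponent x N y) :
    X.outsideComponent x N y ⊆ X.outsideComponent z N y := by
  have hfar : ∀ w ∈ X.outsideComponent x N y, N < X.dist z w := by
    intro w hw
    by_contra! hzw
    refine h (Reachable.trans hw (Reachable.symm (reachable_outside_of_dist_add_lt hc ?_)))
    omega
  intro w hw
  have h' : (X.outside x N).Reachable y w := hw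
  rw [reachable_iff_reflTransGen] at h'
  induction h' with
  | refl => exact Reachable.refl _
  | @tail b c hb hbc ih =>
    have hb' : b ∈ X.outsideComponent x N y := (reachable_iff_reflTransGen _ _).2 hb
    exact Reachable.trans (ih hb') (Adj.reachable ⟨hbc.1, hfar b hb', hfar c hw⟩)

theorem compl_outsideComponent_subset_of_mem (hc : X.Connected) {x y z : V} {N : ℕ}
    (hz : 2 * N < X.dist x z) (h : z ∈ X.outsideComponent x N y) :
    (X.outsideComponent x N y)ᶜ ⊆ X.outsideComponent z N x := by
  have hfar : ∀ w, w ∉ X.outsideComponent x N y → N < X.dist z w := by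
    intro w hw
    by_contra! hzw
    refine hw (Reachable.trans h (reachable_outside_of_dist_add_lt hc ?_))
    omega
  intro v hv
  obtain ⟨γ, hγ⟩ := exists_isGeodesicSeq hc x v
  have hγv : ∀ t ≤ X.dist x v, γ t ∉ X.outsideComponent x N y := by
    intro t ht hmem
    have h1 : N < t := by
      rw [← outsideComponent_eq_of_mem h] at hmem
      rw [← hγ.dist_left hc ht]
      exact lt_dist_of_mem_outsideComponent (by omega) hmem
    have h2 := reachable_outside_of_seq (X := X) (γ := γ) (x := x) (N := N) ht
      (fun t _ ht => hγ.2.2 t ht) fun t ht ht' => by rw [hγ.dist_left hc ht']; omega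
    rw [hγ.2.1] at h2
    exact hv (Reachable.trans hmem h2)
  have h1 := reachable_outside_of_seq (X := X) (γ := γ) (x := z) (N := N)
    (Nat.zero_le (X.dist x v)) (fun t _ ht => hγ.2.2 t ht) fun t _ ht => hfar _ (hγv t ht)
  rwa [hγ.1, hγ.2.1] at h1

/-- Ultrafilters separated by a set with finite edge boundary are separated by one with an edge
boundary of bounded size. -/
theorem HasBottlenecks.exists_separates {M : ℕ} (hM : X.HasBottlenecks M)
    (hc : X.Connected) {b : ℕ → ℕ}
    (hb : ∀ v r, {w | X.dist v w ≤ r}.Finite ∧ {w | X.dist v w ≤ r}.ncard ≤ b r) :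
    ∃ K, ∀ (p q : Ultrafilter V) C, (p : Filter V) ≤ Filter.cofinite → C ∈ p → C ∉ q →
      (X.edgeBoundary C).Finite →
      ∃ D, (X.edgeBoundary D).Finite ∧ (X.edgeBoundary D).ncard ≤ K ∧ p.Separates q D := by
  obtain ⟨K, hK⟩ := hM.exists_ncard_edgeBoundary_le hc hb
  refine ⟨K, fun p q C hp hCp hCq hC => ?_⟩
  obtain ⟨x⟩ := hc.nonempty
  obtain ⟨N₀, hN₀⟩ := (hC.image fun e => X.dist x e.1).bddAbove
  let N := max M N₀
  have hcut : ∀ u v, X.Adj u v → N < X.dist x u → (u ∈ C → v ∈ C) := by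
    intro u v huv hu hmem
    by_contra hv
    have h1 : X.dist x u ≤ N₀ := hN₀ ⟨(u, v), ⟨huv, hmem, hv⟩, rfl⟩
    have h2 : N₀ ≤ N := le_max_right _ _
    omega
  have hcomp : ∀ u v, v ∈ X.outsideComponent x N u → (u ∈ C ↔ v ∈ C) := by
    intro u v h
    have h' : (X.outside x N).Reachable u v := h
    rw [reachable_iff_reflTransGen] at h'
    clear h
    induction h' with
    | refl => rfl
    | tail _ h ih => exact ih.trans ⟨hcut _ _ h.1 h.2.1, hcut _ _ h.1.symm h.2.2⟩
  have hfin : {u | X.dist x u = N + 1}.Finite :=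
    (hb x (N + 1)).1.subset fun u (hu : X.dist x u = N + 1) => hu.le
  have hcov : (⋃ u ∈ {u | X.dist x u = N + 1}, X.outsideComponent x N u) ∈ p := by
    refine hp (Filter.mem_cofinite.2 ((hb x N).1.subset fun y hy => ?_))
    by_contra hy'
    obtain ⟨u, hu, huy⟩ := exists_mem_outsideComponent hc (not_le.1 hy')
    exact hy (Set.mem_biUnion hu huy)
  obtain ⟨u, hu, hup⟩ := (Ultrafilter.finite_biUnion_mem_iff hfin).1 hcov
  have hu' : N < X.dist x u := by
    have : X.dist x u = N + 1 := hu
    omega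
  obtain ⟨h1, h2⟩ := hK x N u (le_max_left _ _) hu'
  refine ⟨_, h1, h2, fun h => hCq (Filter.mem_of_superset (h.1 hup) fun v hv => ?_)⟩
  obtain ⟨w, hw, hwC⟩ := p.nonempty_of_mem (Filter.inter_mem hup hCp)
  exact (hcomp u v hv).1 ((hcomp u w hw).2 hwC)

end SimpleGraph

open scoped Pointwise

namespace SimpleGraph

variable {G : Type*} [Group G] {X : SimpleGraph G}

theorem dist_mul_left_le (hc : X.Connected) (hX : ∀ g a b : G, X.Adj a b → X.Adj (g * a) (g * b))
    (g a b : G) : X.dist (g * a) (g * b) ≤ X.dist a b := by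
  obtain ⟨p, hp⟩ := hc.exists_walk_length_eq_dist a b
  rw [← hp, ← Walk.length_map (⟨fun a => g * a, fun h => hX g _ _ h⟩ : X →g X) p]
  exact dist_le _

theorem dist_mul_left (hc : X.Connected) (hX : ∀ g a b : G, X.Adj a b → X.Adj (g * a) (g * b))
    (g a b : G) : X.dist (g * a) (g * b) = X.dist a b := by
  refine (dist_mul_left_le hc hX g a b).antisymm ?_
  simpa using dist_mul_left_le hc hX g⁻¹ (g * a) (g * b)

theorem smul_outsideComponent_subset (hc : X.Connected)
    (hX : ∀ g a b : G, X.Adj a b → X.Adj (g * a) (g * b)) (g x y : G) (N : ℕ) :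
    g • X.outsideComponent x N y ⊆ X.outsideComponent (g * x) N (g * y) := by
  rintro _ ⟨v, hv, rfl⟩
  exact Reachable.map (⟨fun a => g * a, fun h => ⟨hX g _ _ h.1, by
    rw [dist_mul_left hc hX]; exact h.2.1, by rw [dist_mul_left hc hX]; exact h.2.2⟩⟩ :
      X.outside x N →g X.outside (g * x) N) hv

theorem smul_outsideComponent (hc : X.Connected)
    (hX : ∀ g a b : G, X.Adj a b → X.Adj (g * a) (g * b)) (g x y : G) (N : ℕ) :
    g • X.outsideComponent x N y = X.outsideComponent (g * x) N (g * y) := by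
  refine (smul_outsideComponent_subset hc hX g x y N).antisymm ?_
  have h := smul_outsideComponent_subset hc hX g⁻¹ (g * x) (g * y) N
  simpa only [inv_mul_cancel_left, Set.smul_set_subset_iff_subset_inv_smul_set, inv_inv] using h

/-- If a translate of `A` by a member of `H` is contained in `A`, and `A` meets `H` in a finite
set containing the identity, then the translate is `A`. -/
theorem smul_eq_of_smul_subset {H : Subgroup G} {A : Set G} {g : G} (hg : g ∈ H) (h1 : 1 ∈ A)
    (hfin : ((H : Set G) ∩ A).Finite) (h : g • A ⊆ A) : g • A = A := by
  have hpow : ∀ n : ℕ, g ^ n • A ⊆ A := by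
    intro n
    induction n with
    | zero => simp
    | succ n ih =>
      rw [pow_succ', mul_smul]
      exact (Set.smul_set_mono ih).trans h
  have hmem : ∀ n : ℕ, g ^ n ∈ (H : Set G) ∩ A := fun n =>
    ⟨H.pow_mem hg n, by simpa using hpow n (Set.smul_mem_smul_set h1)⟩
  have hord : IsOfFinOrder g := by
    by_contra hord
    have hinj := injective_pow_iff_not_isOfFinOrder.2 hord
    exact Set.infinite_range_of_injective hinj (hfin.subset (Set.range_subset_iff.2 hmem))
  obtain ⟨n, hn, hgn⟩ := isOfFinOrder_iff_pow_eq_one.1 hord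
  refine h.antisymm ?_
  obtain ⟨m, rfl⟩ : ∃ m, n = m + 1 := ⟨n - 1, by omega⟩
  calc A = g ^ (m + 1) • A := by rw [hgn, one_smul]
    _ = g • g ^ m • A := by rw [pow_succ', mul_smul]
    _ ⊆ g • A := Set.smul_set_mono (hpow m)

/-- In a graph with bottlenecks on a group, infinite subgroups are cut into two infinite parts by
sets with finite edge boundary. -/
theorem HasBottlenecks.exists_infinite_inter_diff {M : ℕ} (hM : X.HasBottlenecks M)
    (hc : X.Connected) (hX : ∀ g a b : G, X.Adj a b → X.Adj (g * a) (g * b)) {b : ℕ → ℕ}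
    (hb : ∀ v r, {w | X.dist v w ≤ r}.Finite ∧ {w | X.dist v w ≤ r}.ncard ≤ b r)
    {H : Subgroup G} (hH : (H : Set G).Infinite) :
    ∃ C : Set G, (X.edgeBoundary C).Finite ∧ ((H : Set G) ∩ C).Infinite ∧
      ((H : Set G) \ C).Infinite := by
  by_contra! hcon
  have hdist := dist_mul_left hc hX
  obtain ⟨K, hK⟩ := hM.exists_ncard_edgeBoundary_le hc hb
  let N := M + 1
  have hpt : ∀ L, N < L → ∃ z, L ≤ X.dist z 1 ∧
      ((H : Set G) ∩ X.outsideComponent z N 1).Finite := by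
    intro L hL
    obtain ⟨h, hh, hhd⟩ := (hH.sdiff (hb 1 (2 * L)).1).nonempty
    replace hhd : 2 * L < X.dist 1 h := not_le.1 hhd
    obtain ⟨γ, hγ⟩ := exists_isGeodesicSeq hc 1 h
    have h1 := hγ.dist_left hc (t := L) (by omega)
    have h2 := hγ.dist_right hc (t := L) (by omega)
    rw [dist_comm] at h1
    set z := γ L
    have hbdry := (hK z N 1 (by omega) (by omega)).1
    by_cases hfin : ((H : Set G) ∩ X.outsideComponent z N 1).Finite
    · exact ⟨z, h1.ge, hfin⟩
    have hfin' := hcon _ hbdry hfin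
    refine ⟨h⁻¹ * z, ?_, ?_⟩
    · rw [← hdist h, mul_inv_cancel_left, mul_one]; omega
    have hdisj : h ∉ X.outsideComponent z N 1 := by
      intro hmem
      obtain ⟨a, ha, ha'⟩ := hM z N (by omega) 1 (by omega)
      have h3 := ha' 1 (Reachable.refl _)
      have h4 := ha' h hmem
      have h5 := hc.dist_triangle (u := 1) (v := a) (w := h)
      rw [dist_comm (u := 1) (v := a)] at h5
      omega
    have h6 : h⁻¹ • X.outsideComponent z N h = X.outsideComponent (h⁻¹ * z) N 1 := by
      rw [smul_outsideComponent hc hX, inv_mul_cancel]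
    rw [← h6]
    refine (hfin'.image fun a => h⁻¹ * a).subset ?_
    rintro _ ⟨hv, v, hvm, rfl⟩
    refine ⟨v, ⟨?_, fun hv1 => ?_⟩, rfl⟩
    · simpa using H.mul_mem hh hv
    · exact hdisj (Reachable.trans hv1 (Reachable.symm hvm))
  obtain ⟨F₀, hF₀, hF₀card⟩ := hH.exists_subset_card_eq (b (2 * N + 2) + 1)
  let L := F₀.sup (fun v => X.dist 1 v) + N + 1
  obtain ⟨z, hz, hfin⟩ := hpt L (by omega)
  set A := X.outsideComponent z N 1 with hA
  have hz1 : N < X.dist z 1 := by omega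
  have h1A : 1 ∈ A := Reachable.refl _
  have hzA : z ∉ A := fun h => by
    have := lt_dist_of_mem_outsideComponent hz1 h
    simp at this
  have hclose : ∀ h ∈ (H : Set G) ∩ A, X.dist z (h * z) ≤ 2 * N + 2 := by
    rintro h ⟨hh, hhA⟩
    by_contra! hfar
    have hA' : h • A = X.outsideComponent (h * z) N h := by
      rw [hA, smul_outsideComponent hc hX, mul_one]
    have hhz : N < X.dist (h * z) h := by
      have := hdist h z 1
      rw [mul_one] at this
      omega
    have hAh : X.outsideComponent z N h = A := outsideComponent_eq_of_mem hhA
    have hzh : N < X.dist z h := lt_dist_of_mem_outsideComponent hz1 hhA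
    have hfar' : 2 * N < X.dist (h * z) z := by rw [dist_comm]; omega
    have hsub : h • A ⊆ A ∨ A ⊆ h • A := by
      by_cases h2 : z ∈ h • A
      · by_cases h3 : h * z ∈ A
        · exfalso
          rw [hA'] at h2
          have h4 := compl_outsideComponent_subset_of_mem hc hfar' h2
          rw [outsideComponent_eq_of_mem h3, ← hA'] at h4
          refine hH ((hfin.union (hfin.image fun a => h * a)).subset fun v hv => ?_)
          by_cases h5 : v ∈ h • A
          · obtain ⟨w, hw, rfl⟩ := h5
            refine Or.inr ⟨w, ⟨?_, hw⟩, rfl⟩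
            exact (H.mul_mem_cancel_left hh).1 hv
          · exact Or.inl ⟨hv, h4 h5⟩
        · right
          have h4 := outsideComponent_subset_of_notMem hc (x := z) (z := h * z) (N := N)
            (y := h) (by omega) (by rwa [hAh])
          rwa [hAh, ← hA'] at h4
      · left
        rw [hA'] at h2 ⊢
        have h4 := outsideComponent_subset_of_notMem hc hfar' h2
        rwa [hAh] at h4
    have heq : h • A = A := by
      rcases hsub with h2 | h2
      · exact smul_eq_of_smul_subset hh h1A hfin h2
      · have h3 : h⁻¹ • A ⊆ A := by
          rwa [Set.smul_set_subset_iff_subset_inv_smul_set, inv_inv]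
        have h4 := smul_eq_of_smul_subset (H.inv_mem hh) h1A hfin h3
        rw [← h4, smul_inv_smul, h4]
    obtain ⟨e, he⟩ := edgeBoundary_nonempty hc h1A hzA
    have h2 := dist_of_mem_edgeBoundary_outsideComponent hc hz1 he
    rw [← heq, hA'] at he
    have h3 := dist_of_mem_edgeBoundary_outsideComponent hc hhz he
    have h4 := hc.dist_triangle (u := z) (v := e.1) (w := h * z)
    rw [dist_comm (u := e.1)] at h4
    omega
  have hle : ((H : Set G) ∩ A).ncard ≤ b (2 * N + 2) := by
    refine le_trans ?_ (hb z (2 * N + 2)).2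
    exact Set.ncard_le_ncard_of_injOn (fun h => h * z) hclose
      (fun _ _ _ _ h => mul_right_cancel h) (hb z _).1
  have hF₀A : (F₀ : Set G) ⊆ (H : Set G) ∩ A := by
    intro v hv
    refine ⟨hF₀ hv, reachable_outside_of_dist_add_lt hc ?_⟩
    have h2 : X.dist 1 v ≤ F₀.sup (fun v => X.dist 1 v) :=
      Finset.le_sup (f := fun v => X.dist 1 v) hv
    omega
  have hge := Set.ncard_le_ncard hF₀A hfin
  rw [Set.ncard_coe_finset] at hge
  omega

end SimpleGraph

open scoped Pointwise

section SMul

variable {G V : Type*} [Group G] [MulAction G V]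

theorem Set.crosses_smul_iff (g : G) (C D : Set V) : (g • C).Crosses (g • D) ↔ C.Crosses D := by
  simp only [Set.Crosses, ← Set.smul_set_compl, ← Set.smul_set_inter, Set.smul_set_nonempty]

theorem IsOrientation.smul {E o : Set (Set V)} (hE : ∀ (g : G), ∀ C ∈ E, g • C ∈ E) (g : G)
    (ho : IsOrientation E o) : IsOrientation E (g • o) where
  subset C hC := by
    rw [← smul_inv_smul g C]
    exact hE g _ (ho.subset (Set.mem_smul_set_iff_inv_smul_mem.1 hC))
  mem_iff C hC := by
    rw [Set.mem_smul_set_iff_inv_smul_mem, Set.mem_smul_set_iff_inv_smul_mem, Set.smul_set_compl]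
    exact ho.mem_iff _ (hE g⁻¹ C hC)
  mem_of_subset C hC D hD h := by
    rw [Set.mem_smul_set_iff_inv_smul_mem] at hC ⊢
    exact ho.mem_of_subset _ hC _ (hE g⁻¹ D hD) (Set.smul_set_mono h)
  finite v := by
    refine ((ho.finite (g⁻¹ • v)).smul_set (a := g)).subset ?_
    rintro C ⟨hC, hv⟩
    rw [Set.mem_smul_set_iff_inv_smul_mem] at hC ⊢
    exact ⟨hC, fun h => hv (by rwa [Set.mem_inv_smul_set_iff, smul_inv_smul] at h)⟩

/-- The action on the orientations of an invariant family of sets. -/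
abbrev orientationAction {E : Set (Set V)} (hE : ∀ (g : G), ∀ C ∈ E, g • C ∈ E) :
    MulAction G {o : Set (Set V) // IsOrientation E o} where
  smul g o := ⟨g • o.1, o.2.smul hE g⟩
  one_smul o := Subtype.ext (one_smul G o.1)
  mul_smul g h o := Subtype.ext (mul_smul g h o.1)

/-- If finitely many points meet every orbit, then finite stabilizers have bounded order. -/
theorem exists_card_stabilizer_dvd {R : Set V} (hR : R.Finite) (horb : ∀ v : V, ∃ g : G, g • v ∈ R)
    (hst : ∀ v : V, Finite (MulAction.stabilizer G v)) :
    ∃ N : ℕ, 0 < N ∧ ∀ v : V, Finite (MulAction.stabilizer G v) ∧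
      Nat.card (MulAction.stabilizer G v) ∣ N := by
  refine ⟨∏ r ∈ hR.toFinset, Nat.card (MulAction.stabilizer G r),
    Finset.prod_pos fun r _ => have := hst r; Nat.card_pos, fun v => ⟨hst v, ?_⟩⟩
  obtain ⟨g, hg⟩ := horb v
  have h1 : MulAction.orbitRel G V v (g • v) :=
    (MulAction.orbitRel G V).symm ⟨g, rfl⟩
  rw [Nat.card_congr (MulAction.stabilizerEquivStabilizerOfOrbitRel h1).toEquiv]
  exact Finset.dvd_prod_of_mem (fun r => Nat.card (MulAction.stabilizer G r))
    (hR.mem_toFinset.2 hg)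

end SMul

namespace SimpleGraph

variable {V : Type*} {X : SimpleGraph V}

/-- The optimal cuts of weight at most `K`. -/
def cutFamily (X : SimpleGraph V) (K : ℕ) : Set (Set V) :=
  {C | ∃ p q, X.IsOptimalCut K p q C}

theorem isNestedFamily_cutFamily (X : SimpleGraph V) (K : ℕ) :
    IsNestedFamily (X.cutFamily K) where
  compl_mem := by
    rintro C ⟨p, q, h⟩
    exact ⟨p, q, h.compl⟩
  nonempty := by
    rintro C ⟨p, q, h⟩
    by_contra hC
    rw [Set.not_nonempty_iff_eq_empty] at hC
    subst hC
    exact h.isMinCut.separates (iff_of_false p.empty_notMem q.empty_notMem)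
  not_crosses := by
    rintro C ⟨p, q, h⟩ D ⟨r, s, h'⟩
    exact h.not_crosses h'
  finite u v := by
    refine (finite_isCut_separating K X u v).subset ?_
    rintro C ⟨⟨p, q, h⟩, hC⟩
    exact ⟨h.isCut, hC⟩

theorem edgeBoundary_nonempty_of_mem_cutFamily (hc : X.Connected) {K : ℕ} {C : Set V}
    (hC : C ∈ X.cutFamily K) : (X.edgeBoundary C).Nonempty := by
  have hE := isNestedFamily_cutFamily X K
  obtain ⟨u, hu⟩ := hE.nonempty C hC
  obtain ⟨v, hv⟩ := hE.nonempty Cᶜ (hE.compl_mem C hC)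
  exact edgeBoundary_nonempty hc hu hv

end SimpleGraph

namespace SimpleGraph

variable {G : Type*} [Group G] {X : SimpleGraph G}

theorem edgeBoundary_smul (hX : ∀ g a b : G, X.Adj a b → X.Adj (g * a) (g * b)) (g : G)
    (C : Set G) : X.edgeBoundary (g • C) = g • X.edgeBoundary C := by
  have hadj : ∀ a b, X.Adj (g⁻¹ * a) (g⁻¹ * b) ↔ X.Adj a b := fun a b =>
    ⟨fun h => by simpa using hX g _ _ h, hX _ _ _⟩
  ext ⟨a, b⟩
  rw [Set.mem_smul_set_iff_inv_smul_mem]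
  simp [edgeBoundary, Set.mem_smul_set_iff_inv_smul_mem, hadj]

theorem finite_edgeBoundary_smul (hX : ∀ g a b : G, X.Adj a b → X.Adj (g * a) (g * b)) (g : G)
    {C : Set G} (h : (X.edgeBoundary C).Finite) : (X.edgeBoundary (g • C)).Finite := by
  rw [edgeBoundary_smul hX]
  exact h.smul_set

theorem ncard_edgeBoundary_smul (hX : ∀ g a b : G, X.Adj a b → X.Adj (g * a) (g * b)) (g : G)
    (C : Set G) : (X.edgeBoundary (g • C)).ncard = (X.edgeBoundary C).ncard := by
  rw [edgeBoundary_smul hX, Set.ncard_smul_set]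

theorem IsConnectedSet.smul (hX : ∀ g a b : G, X.Adj a b → X.Adj (g * a) (g * b)) (g : G)
    {C : Set G} (h : X.IsConnectedSet C) : X.IsConnectedSet (g • C) := by
  intro A hA hne hcl
  have h1 := h (g⁻¹ • A) (by rwa [Set.smul_set_subset_iff_subset_inv_smul_set, inv_inv])
    hne.smul_set (by
      intro a ha b hb hab
      rw [Set.mem_inv_smul_set_iff] at ha ⊢
      exact hcl _ ha _ (Set.smul_mem_smul_set hb) (hX g a b hab))
  rwa [Set.smul_set_subset_iff_subset_inv_smul_set]

theorem IsCut.smul (hX : ∀ g a b : G, X.Adj a b → X.Adj (g * a) (g * b)) (g : G) {K : ℕ}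
    {C : Set G} (h : X.IsCut K C) : X.IsCut K (g • C) where
  finite := finite_edgeBoundary_smul hX g h.finite
  ncard_le := (ncard_edgeBoundary_smul hX g C).trans_le h.ncard_le
  conn := h.conn.smul hX g
  conn_compl := by rw [← Set.smul_set_compl]; exact h.conn_compl.smul hX g

theorem crossingNumber_smul (hX : ∀ g a b : G, X.Adj a b → X.Adj (g * a) (g * b)) (g : G) (K : ℕ)
    (C : Set G) : X.crossingNumber K (g • C) = X.crossingNumber K C := by
  have h : {D | X.IsCut K D ∧ (g • C).Crosses D} = g • {D | X.IsCut K D ∧ C.Crosses D} := by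
    ext D
    rw [Set.mem_smul_set_iff_inv_smul_mem]
    have h1 : X.IsCut K D ↔ X.IsCut K (g⁻¹ • D) :=
      ⟨fun h => h.smul hX _, fun h => by simpa using h.smul hX g⟩
    have h2 := Set.crosses_smul_iff g C (g⁻¹ • D)
    rw [smul_inv_smul] at h2
    exact and_congr h1 h2
  rw [crossingNumber, h, Set.ncard_smul_set, crossingNumber]

theorem separates_map_iff (g : G) (p q : Ultrafilter G) (D : Set G) :
    (p.map (g * ·)).Separates (q.map (g * ·)) D ↔ p.Separates q (g⁻¹ • D) := by
  have h : (g * ·) ⁻¹' D = g⁻¹ • D := by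
    ext a
    rw [Set.mem_inv_smul_set_iff]
    rfl
  simp only [Ultrafilter.Separates, Ultrafilter.mem_map, h]

theorem IsMinCut.smul (hX : ∀ g a b : G, X.Adj a b → X.Adj (g * a) (g * b)) (g : G)
    {p q : Ultrafilter G} {C : Set G} (h : X.IsMinCut p q C) :
    X.IsMinCut (p.map (g * ·)) (q.map (g * ·)) (g • C) where
  finite := finite_edgeBoundary_smul hX g h.finite
  separates := by rw [separates_map_iff, inv_smul_smul]; exact h.separates
  ncard_le D hD hs := by
    rw [ncard_edgeBoundary_smul hX, ← ncard_edgeBoundary_smul hX g⁻¹ D]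
    exact h.ncard_le _ (finite_edgeBoundary_smul hX _ hD) ((separates_map_iff g p q D).1 hs)

theorem IsOptimalCut.smul (hX : ∀ g a b : G, X.Adj a b → X.Adj (g * a) (g * b)) (g : G) {K : ℕ}
    {p q : Ultrafilter G} {C : Set G} (h : X.IsOptimalCut K p q C) :
    X.IsOptimalCut K (p.map (g * ·)) (q.map (g * ·)) (g • C) where
  isMinCut := h.isMinCut.smul hX g
  isCut := h.isCut.smul hX g
  crossingNumber_le D hD := by
    have h1 := hD.smul hX g⁻¹
    have hid : ∀ p : Ultrafilter G, (p.map (g * ·)).map (g⁻¹ * ·) = p := fun p => by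
      rw [Ultrafilter.map_map]
      convert Ultrafilter.map_id p
      ext a
      simp
    rw [hid, hid] at h1
    rw [crossingNumber_smul hX, ← crossingNumber_smul hX g⁻¹ K D]
    exact h.crossingNumber_le _ h1

theorem smul_mem_cutFamily (hX : ∀ g a b : G, X.Adj a b → X.Adj (g * a) (g * b)) {K : ℕ} (g : G) :
    ∀ C ∈ X.cutFamily K, g • C ∈ X.cutFamily K := by
  rintro C ⟨p, q, h⟩
  exact ⟨_, _, h.smul hX g⟩

end SimpleGraph

open scoped Pointwise

namespace SimpleGraph

variable {G : Type*} [Group G] {X : SimpleGraph G}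

/-- Balls in a locally finite graph on a group have uniformly bounded size. -/
theorem exists_ncard_ball_le (hc : X.Connected)
    (hX : ∀ g a b : G, X.Adj a b → X.Adj (g * a) (g * b)) (hfin : {s | X.Adj 1 s}.Finite) :
    ∃ b : ℕ → ℕ, ∀ v r, {w | X.dist v w ≤ r}.Finite ∧ {w | X.dist v w ≤ r}.ncard ≤ b r := by
  have hball : ∀ v r, {w | X.dist v w ≤ r} = v • {w | X.dist 1 w ≤ r} := by
    intro v r
    ext w
    rw [Set.mem_smul_set_iff_inv_smul_mem, Set.mem_ofPred_eq, Set.mem_ofPred_eq, smul_eq_mul,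
      ← dist_mul_left hc hX v 1, mul_one, mul_inv_cancel_left]
  have h1 : ∀ r, {w | X.dist 1 w ≤ r}.Finite := by
    intro r
    induction r with
    | zero =>
      refine (Set.finite_singleton 1).subset fun w hw => ?_
      exact ((hc.dist_eq_zero_iff).1 (Nat.le_zero.1 hw)).symm
    | succ r ih =>
      refine (ih.union (ih.mul hfin)).subset fun w hw => ?_
      by_cases hr : X.dist 1 w ≤ r
      · exact Or.inl hr
      have hw' : X.dist 1 w = r + 1 := le_antisymm hw (not_le.1 hr)
      obtain ⟨γ, hγ⟩ := exists_isGeodesicSeq hc 1 w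
      refine Or.inr ⟨γ r, (hγ.dist_left hc (by omega)).le, (γ r)⁻¹ * w, ?_, by simp⟩
      have h2 := hX (γ r)⁻¹ _ _ (hγ.2.2 r (by omega))
      rw [← hw', hγ.2.1, inv_mul_cancel] at h2
      exact h2
  refine ⟨fun r => {w | X.dist 1 w ≤ r}.ncard, fun v r => ?_⟩
  rw [hball v r]
  exact ⟨(h1 r).smul_set, (Set.ncard_smul_set _ _).le⟩

theorem exists_mem_ultrafilter_of_infinite {V : Type*} {A : Set V} (hA : A.Infinite) :
    ∃ p : Ultrafilter V, (p : Filter V) ≤ Filter.cofinite ∧ A ∈ p := by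
  have := hA.cofinite_inf_principal_neBot
  obtain ⟨p, hp⟩ := Ultrafilter.exists_le (Filter.cofinite ⊓ Filter.principal A)
  exact ⟨p, hp.trans inf_le_left, Filter.le_principal_iff.1 (hp.trans inf_le_right)⟩

theorem infinite_of_mem_ultrafilter {V : Type*} {A : Set V} {p : Ultrafilter V}
    (hp : (p : Filter V) ≤ Filter.cofinite) (hA : A ∈ p) : A.Infinite := fun hfin =>
  p.empty_notMem (by
    simpa using Filter.inter_mem hA (hp hfin.compl_mem_cofinite))

/-- Infinite subgroups are cut into two infinite parts by optimal cuts. -/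
theorem HasBottlenecks.exists_cutFamily_infinite {M : ℕ} (hM : X.HasBottlenecks M)
    (hc : X.Connected) (hX : ∀ g a b : G, X.Adj a b → X.Adj (g * a) (g * b)) {b : ℕ → ℕ}
    (hb : ∀ v r, {w | X.dist v w ≤ r}.Finite ∧ {w | X.dist v w ≤ r}.ncard ≤ b r) :
    ∃ K, ∀ H : Subgroup G, (H : Set G).Infinite →
      ∃ C ∈ X.cutFamily K, ((H : Set G) ∩ C).Infinite ∧ ((H : Set G) ∩ Cᶜ).Infinite := by
  obtain ⟨K, hK⟩ := hM.exists_separates hc hb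
  refine ⟨K, fun H hH => ?_⟩
  obtain ⟨C, hC, h1, h2⟩ := hM.exists_infinite_inter_diff hc hX hb hH
  obtain ⟨p, hp, hpC⟩ := exists_mem_ultrafilter_of_infinite h1
  obtain ⟨q, hq, hqC⟩ := exists_mem_ultrafilter_of_infinite h2
  have hpH : (H : Set G) ∈ p := Filter.mem_of_superset hpC Set.inter_subset_left
  have hqH : (H : Set G) ∈ q := Filter.mem_of_superset hqC Set.sdiff_subset
  have hqC' : C ∉ q := Ultrafilter.compl_mem_iff_notMem.1
    (Filter.mem_of_superset hqC fun v hv => hv.2)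
  obtain ⟨D, hD⟩ := exists_isOptimalCut hc
    (hK p q C hp (Filter.mem_of_superset hpC Set.inter_subset_right) hqC' hC)
  refine ⟨D, ⟨p, q, hD⟩, ?_⟩
  have key : ∀ (r : Ultrafilter G) (A : Set G), (r : Filter G) ≤ Filter.cofinite →
      (H : Set G) ∈ r → A ∈ r → ((H : Set G) ∩ A).Infinite := fun r A hr h1 h2 =>
    infinite_of_mem_ultrafilter hr (Filter.inter_mem h1 h2)
  have hs := hD.isMinCut.separates
  by_cases hDp : D ∈ p
  · have hDq : D ∉ q := fun h => hs (iff_of_true hDp h)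
    exact ⟨key p D hp hpH hDp, key q Dᶜ hq hqH (Ultrafilter.compl_mem_iff_notMem.2 hDq)⟩
  · have hDq : D ∈ q := by
      by_contra h
      exact hs (iff_of_false hDp h)
    exact ⟨key q D hq hqH hDq, key p Dᶜ hp hpH (Ultrafilter.compl_mem_iff_notMem.2 hDp)⟩

/-- If every infinite subgroup is split by a member of the family, no orientation has an infinite
stabilizer. -/
theorem finite_stabilizer_orientation (hc : X.Connected)
    (hX : ∀ g a b : G, X.Adj a b → X.Adj (g * a) (g * b)) {K : ℕ}
    (hK : ∀ H : Subgroup G, (H : Set G).Infinite →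
      ∃ C ∈ X.cutFamily K, ((H : Set G) ∩ C).Infinite ∧ ((H : Set G) ∩ Cᶜ).Infinite)
    {o : Set (Set G)} (ho : IsOrientation (X.cutFamily K) o) (H : Subgroup G)
    (hH : ∀ h ∈ H, h • o = o) : Finite H := by
  by_contra hinf
  obtain ⟨C, hC, h1, h2⟩ := hK H fun h => hinf h.to_subtype
  obtain ⟨D, hDo, hD⟩ : ∃ D ∈ o, ((H : Set G) ∩ Dᶜ).Infinite := by
    by_cases hCo : C ∈ o
    · exact ⟨C, hCo, h2⟩
    · exact ⟨Cᶜ, (ho.compl_mem hC).2 hCo, by rwa [compl_compl]⟩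
  have hDE := ho.subset hDo
  obtain ⟨_, _, hDcut⟩ := hDE
  have hDfin := hDcut.isCut.finite
  refine hD (((ho.finite 1).biUnion (t := fun D' => {h | h⁻¹ • D = D'}) fun D' hD' => ?_).subset
    fun h hh => ?_)
  · obtain ⟨e, he⟩ := edgeBoundary_nonempty_of_mem_cutFamily hc (ho.subset hD'.1)
    refine Set.Finite.of_injOn (f := fun h => h • e) (t := X.edgeBoundary D) ?_ ?_ hDfin
    · intro h hh
      have h3 : D = h • D' := by
        rw [← show h⁻¹ • D = D' from hh, smul_inv_smul]
      rw [h3, edgeBoundary_smul hX]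
      exact Set.smul_mem_smul_set he
    · intro h _ h' _ heq
      exact mul_right_cancel (congrArg Prod.fst heq : h * e.1 = h' * e.1)
  · refine Set.mem_biUnion (x := h⁻¹ • D) ⟨?_, fun h3 => hh.2 ?_⟩ rfl
    · rw [← hH h⁻¹ (H.inv_mem hh.1)]
      exact Set.smul_mem_smul_set hDo
    · simpa [Set.mem_inv_smul_set_iff] using h3

/-- Finitely many orientations of the family of optimal cuts meet every orbit. -/
theorem exists_finite_orientation_representatives (hc : X.Connected)
    (hX : ∀ g a b : G, X.Adj a b → X.Adj (g * a) (g * b)) (hfin : {s | X.Adj 1 s}.Finite) (K : ℕ) :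
    ∃ R : Set {o : Set (Set G) // IsOrientation (X.cutFamily K) o}, R.Finite ∧
      ∀ o : {o : Set (Set G) // IsOrientation (X.cutFamily K) o}, ∃ g : G, ∃ r ∈ R,
        g • o.1 = r.1 := by
  have hE := isNestedFamily_cutFamily X K
  let E₁ : Set (Set G) := ⋃ s ∈ {s | X.Adj 1 s}, {C | X.IsCut K C ∧ 1 ∈ C ∧ s ∉ C}
  have hE₁ : E₁.Finite := hfin.biUnion fun s _ => finite_isCut_separating K X 1 s
  let o₁ : {o : Set (Set G) // IsOrientation (X.cutFamily K) o} := ⟨_, hE.isOrientation_point 1⟩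
  refine ⟨{o₁} ∪ ⋃ C ∈ E₁, {o | C ∈ o.1 ∧ ∀ D ∈ o.1, D ⊆ C → D = C}, ?_, fun o => ?_⟩
  · refine (Set.finite_singleton _).union (hE₁.biUnion fun C _ => Set.Subsingleton.finite ?_)
    rintro a ⟨ha1, ha2⟩ b ⟨hb1, hb2⟩
    exact Subtype.ext (IsOrientation.eq_of_minimal hE a.2 b.2 ha1 hb1 ha2 hb2)
  by_cases ho : o = o₁
  · exact ⟨1, o, Or.inl ho, one_smul _ _⟩
  have hne : {C | C ∈ o.1 ∧ 1 ∉ C}.Nonempty := by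
    by_contra hne
    rw [Set.not_nonempty_iff_eq_empty] at hne
    refine ho (Subtype.ext (o.2.eq_of_subset o₁.2 fun C hC => ⟨o.2.subset hC, ?_⟩))
    by_contra h1
    exact (hne ▸ (⟨hC, h1⟩ : C ∈ {C | C ∈ o.1 ∧ 1 ∉ C}) : C ∈ (∅ : Set (Set G)))
  obtain ⟨C, hCm⟩ := (o.2.finite 1).exists_minimal hne
  have hCo := hCm.prop.1
  have hCmin : ∀ D ∈ o.1, D ⊆ C → D = C := fun D hD hDC =>
    hDC.antisymm (hCm.le_of_le ⟨hD, fun h => hCm.prop.2 (hDC h)⟩ hDC)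
  have hCE := o.2.subset hCo
  obtain ⟨⟨u, v⟩, huv, hu, hv⟩ := edgeBoundary_nonempty_of_mem_cutFamily hc hCE
  obtain ⟨_, _, hcut⟩ := hCE
  refine ⟨u⁻¹, ⟨u⁻¹ • o.1, o.2.smul (smul_mem_cutFamily hX) u⁻¹⟩, Or.inr ?_, rfl⟩
  refine Set.mem_biUnion (x := u⁻¹ • C) ?_ ⟨Set.smul_mem_smul_set hCo, fun D hD hDC => ?_⟩
  · refine Set.mem_biUnion (x := u⁻¹ * v) ?_ ⟨hcut.isCut.smul hX _, ?_, ?_⟩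
    · have := hX u⁻¹ u v huv
      rwa [inv_mul_cancel] at this
    · simpa [Set.mem_inv_smul_set_iff] using hu
    · simpa [Set.mem_inv_smul_set_iff] using hv
  · rw [Set.mem_inv_smul_set_iff] at hD
    rw [← hCmin _ hD (by rwa [Set.smul_set_subset_iff_subset_inv_smul_set]), inv_smul_smul]

end SimpleGraph

/-- A group acting simply transitively on the vertices of a locally finite connected graph with
bottlenecks is virtually free. -/
theorem SimpleGraph.HasBottlenecks.exists_isFreeGroup {G : Type*} [Group G] {X : SimpleGraph G}
    {M : ℕ} (hM : X.HasBottlenecks M) (hc : X.Connected)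
    (hX : ∀ g a b : G, X.Adj a b → X.Adj (g * a) (g * b)) (hfin : {s | X.Adj 1 s}.Finite) :
    ∃ H : Subgroup G, H.FiniteIndex ∧ IsFreeGroup H := by
  obtain ⟨b, hb⟩ := exists_ncard_ball_le hc hX hfin
  obtain ⟨K, hK⟩ := hM.exists_cutFamily_infinite hc hX hb
  let _ : MulAction G {o : Set (Set G) // IsOrientation (X.cutFamily K) o} :=
    orientationAction (smul_mem_cutFamily hX)
  obtain ⟨R, hR, hRo⟩ := exists_finite_orientation_representatives hc hX hfin K
  obtain ⟨N, hN, hst⟩ := exists_card_stabilizer_dvd (G := G) hR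
    (fun o => by
      obtain ⟨g, r, hr, hg⟩ := hRo o
      exact ⟨g, (Subtype.ext hg : g • o = r) ▸ hr⟩)
    (fun o => finite_stabilizer_orientation hc hX hK o.2 _ fun h hh =>
      congrArg Subtype.val (MulAction.mem_stabilizer_iff.1 hh))
  refine exists_isFreeGroup_of_action_on_tree
    (orientationGraph_isTree (isNestedFamily_cutFamily X K)) (fun g o o' h => ?_) hN hst
  obtain ⟨C, hC⟩ := h
  refine ⟨g • C, ?_⟩
  change g • o.1 \ g • o'.1 = {g • C}
  rw [← Set.smul_set_sdiff, hC, Set.smul_set_singleton]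

/-- If `G` is a hyperbolic group admitting a finite inverse-closed
generating set `S` such that `Cay(G, S)` is `k`-geodetic, then `G` is virtually free:
it has a free subgroup of finite index. -/
theorem virtually_free_of_hyperbolic_kgeodetic {G : Type*} [Group G] (k : ℕ) (hk : 0 < k)
    (S : Set G) (hfin : S.Finite) (hinv : ∀ s ∈ S, s⁻¹ ∈ S) (hone : (1 : G) ∉ S)
    (hgen : Subgroup.closure S = ⊤)
    (hhyp : IsHyperbolic (cayleyGraph G S))
    (hgeo : IsKGeodetic (cayleyGraph G S) k) :
    ∃ H : Subgroup G, H.FiniteIndex ∧ IsFreeGroup H := by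
  obtain ⟨M, hM⟩ := hgeo.hasBottlenecks hhyp
  refine hM.exists_isFreeGroup hgeo.1 (fun g a b h => ?_) (hfin.subset fun s hs => ?_)
  · simpa [cayleyGraph, mul_assoc] using h
  · rw [Set.mem_ofPred_eq, cayleyGraph, SimpleGraph.fromRel_adj] at hs
    rcases hs.2 with h | h
    · simpa using h
    · simpa using hinv _ h
end

section
/- Let k be a positive integer and let G be a hyperbolic group with a finite inverse-closed generating set S such that Cay(G,S) is k-geodetic. Let g ∈ G be an element of infinite order, and for each n ≥ 0 let L_n ⊆ S* be the set of geodesic words representing g^n. Then the language ⋃_{n≥0} L_n is a regular language over the alphabet S. -/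
/-- A left-invariant length function with finite balls and geodesics, satisfying the integer
four-point condition with constant `δ`. -/
structure IsHyperbolicLength {G : Type*} [Group G] (ℓ : G → ℕ) (δ : ℕ) : Prop where
  one : ℓ 1 = 0
  eq_one : ∀ x, ℓ x = 0 → x = 1
  inv : ∀ x, ℓ x⁻¹ = ℓ x
  mul_le : ∀ x y, ℓ (x * y) ≤ ℓ x + ℓ y
  finite_ball : ∀ n, {x | ℓ x ≤ n}.Finite
  split : ∀ x a b, ℓ x = a + b → ∃ y z, x = y * z ∧ ℓ y = a ∧ ℓ z = b
  four_point : ∀ x y z w,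
    ℓ (x⁻¹ * y) + ℓ (z⁻¹ * w) ≤
      max (ℓ (x⁻¹ * z) + ℓ (y⁻¹ * w)) (ℓ (x⁻¹ * w) + ℓ (y⁻¹ * z)) + δ

namespace IsHyperbolicLength

variable {G : Type*} [Group G] {ℓ : G → ℕ} {δ : ℕ}

theorem symm (H : IsHyperbolicLength ℓ δ) (x y : G) : ℓ (x⁻¹ * y) = ℓ (y⁻¹ * x) := by
  rw [← H.inv (x⁻¹ * y)]; simp

theorem triangle (H : IsHyperbolicLength ℓ δ) (x y z : G) :
    ℓ (x⁻¹ * z) ≤ ℓ (x⁻¹ * y) + ℓ (y⁻¹ * z) := by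
  simpa [mul_assoc] using H.mul_le (x⁻¹ * y) (y⁻¹ * z)

theorem pow_le (H : IsHyperbolicLength ℓ δ) (g : G) (n : ℕ) : ℓ (g ^ n) ≤ n * ℓ g := by
  induction n with
  | zero => simp [H.one]
  | succ n ih =>
    have := H.mul_le (g ^ n) g
    rw [pow_succ, add_mul]
    lia

theorem four_point_pow (H : IsHyperbolicLength ℓ δ) (g : G) (u v w : ℕ) :
    ℓ (g ^ (u + v)) + ℓ (g ^ (v + w)) ≤
      max (ℓ (g ^ (u + v + w)) + ℓ (g ^ v)) (ℓ (g ^ u) + ℓ (g ^ w)) + δ := by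
  have key : ∀ a b : ℕ, ℓ ((g ^ a)⁻¹ * g ^ (a + b)) = ℓ (g ^ b) := fun a b ↦ by
    rw [pow_add, inv_mul_cancel_left]
  have h := H.four_point (g ^ 0) (g ^ (u + v)) (g ^ u) (g ^ (u + v + w))
  have e1 := key 0 (u + v)
  have e2 := key u (v + w)
  have e3 := key 0 u
  have e4 := key (u + v) w
  have e5 := key 0 (u + v + w)
  have e6 := key u v
  rw [H.symm] at e6
  simp only [zero_add, ← add_assoc] at e1 e2 e3 e5
  simp only [e1, e2, e3, e4, e5, e6] at h
  lia

/-- If one step of doubling is long enough, then the powers drift away steadily. -/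
theorem pow_add_le (H : IsHyperbolicLength ℓ δ) {c : G}
    (hc : ℓ c + δ + 1 ≤ ℓ (c ^ 2)) (j k : ℕ) : ℓ (c ^ j) + k ≤ ℓ (c ^ (j + k)) := by
  have step : ∀ j, ℓ (c ^ j) + 1 ≤ ℓ (c ^ (j + 1)) := by
    intro j
    induction j with
    | zero =>
      have := H.pow_le c 2
      simp only [pow_zero, H.one, zero_add, pow_one]
      lia
    | succ j ih =>
      have := H.four_point_pow c j 1 1
      simp only [pow_one, one_add_one_eq_two] at this
      lia
  induction k with
  | zero => simp
  | succ k ih =>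
    have := step (j + k)
    rw [← add_assoc]
    lia

/-- A short element commuting with `y` acts near the middle of a geodesic from `1` to `y`
almost as a translation, so its square moves points there almost twice as far. -/
theorem two_mul_conj_le (H : IsHyperbolicLength ℓ δ) {h y p : G} (hy : Commute h y)
    (hp : ℓ p + ℓ (p⁻¹ * y) = ℓ y)
    (h₁ : 8 * ℓ h + 4 * δ < ℓ p) (h₂ : 8 * ℓ h + 4 * δ < ℓ (p⁻¹ * y)) :
    2 * ℓ (p⁻¹ * h * p) ≤ ℓ (p⁻¹ * h ^ 2 * p) + 6 * δ := by
  -- position of `x * p` for a short `x` commuting with `y`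
  have pos : ∀ x, Commute x y → ℓ x ≤ 2 * ℓ h →
      ℓ (x * p) + ℓ (x⁻¹ * y) ≤ ℓ p + ℓ y + δ ∧ ℓ p + ℓ y ≤ ℓ (x * p) + ℓ (x⁻¹ * y) + δ ∧
      ℓ ((x * p)⁻¹ * y) + ℓ p ≤ ℓ (x⁻¹ * y) + δ ∧
      ℓ (x⁻¹ * y) ≤ ℓ ((x * p)⁻¹ * y) + ℓ p + δ := by
    intro x hx hl
    have a1 := H.four_point (x * p) 1 x y
    have a2 := H.four_point (x * p) x 1 y
    have a3 := H.four_point (x * p) y (x * y) x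
    have a4 := H.four_point (x * p) (x * y) y x
    have e1 : ℓ ((x * p)⁻¹ * x) = ℓ p := by rw [← H.inv p]; congr 1; group
    have e3 : ℓ ((x * p)⁻¹ * (x * y)) = ℓ (p⁻¹ * y) := by congr 1; group
    have e4 : ℓ ((x * y)⁻¹ * x) = ℓ y := by rw [← H.inv y]; congr 1; group
    have e5 : ℓ (y⁻¹ * (x * y)) = ℓ x := by rw [hx.eq]; congr 1; group
    have e6 : ℓ ((x * y)⁻¹ * y) = ℓ x := by rw [H.symm, e5]
    have e7 := H.symm y x
    have t1 := H.triangle x 1 y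
    have t2 := H.triangle 1 x y
    have t3 := H.mul_le x p
    have t4 := H.triangle (x * p) (x * y) y
    have t5 := H.triangle (x * p) y (x * y)
    have t6 := H.triangle x 1 (x * p)
    simp only [inv_one, one_mul, inv_mul_cancel_left, mul_one, H.inv, e1, e3, e4, e5, e6, e7] at *
    lia
  have l2 : ℓ (h ^ 2) ≤ 2 * ℓ h := H.pow_le h 2
  obtain ⟨b1, b2, b3, b4⟩ := pos h hy (by lia)
  obtain ⟨c1, c2, c3, c4⟩ := pos (h ^ 2) (hy.pow_left 2) l2
  have q := H.four_point p (h * p) 1 y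
  have t1 := H.triangle 1 p (h ^ 2 * p)
  have t2 := H.triangle 1 (h ^ 2 * p) p
  have f1 := H.four_point (h ^ 2) (h * y) h y
  have f2 := H.four_point (h ^ 2) y h (h * y)
  have e1 : (h ^ 2)⁻¹ * (h * y) = h⁻¹ * y := by group
  have e2 : ℓ ((h ^ 2)⁻¹ * h) = ℓ h := by rw [← H.inv h]; congr 1; group
  have e3 : ℓ ((h * y)⁻¹ * y) = ℓ h := by
    rw [← H.inv h, hy.eq]; congr 1; group
  have e4 : ℓ ((h * y)⁻¹ * h) = ℓ y := by rw [← H.inv y]; congr 1; group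
  have e5 : ℓ (y⁻¹ * (h * y)) = ℓ h := by rw [hy.eq]; congr 1; group
  have e6 := H.symm y h
  have e7 := H.symm (h ^ 2 * p) p
  have u1 := H.triangle h 1 y
  have u2 := H.triangle 1 h y
  have u3 := H.triangle (h ^ 2) 1 y
  have u4 := H.triangle 1 (h ^ 2) y
  rw [mul_assoc, mul_assoc]
  simp only [inv_one, one_mul, mul_one, H.inv, inv_mul_cancel_left, e1, e2, e3, e4, e5, e6, e7]
    at *
  lia

theorem exists_forall_lt_pow (H : IsHyperbolicLength ℓ δ) {g : G} (hg : ¬ IsOfFinOrder g)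
    (R : ℕ) : ∃ N, ∀ n ≥ N, R < ℓ (g ^ n) := by
  have hfin := (H.finite_ball R).preimage (injective_pow_iff_not_isOfFinOrder.2 hg).injOn
  obtain ⟨N, hN⟩ := hfin.bddAbove
  refine ⟨N + 1, fun n hn ↦ ?_⟩
  by_contra! h
  have := hN h
  lia

theorem exists_conj_pow (H : IsHyperbolicLength ℓ δ) {g : G} (hg : ¬ IsOfFinOrder g) :
    ∃ (i : ℕ) (p : G), 0 < i ∧
      ℓ (p⁻¹ * g ^ i * p) + δ + 1 ≤ ℓ ((p⁻¹ * g ^ i * p) ^ 2) := by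
  by_contra! hcon
  set I := (H.finite_ball (7 * δ)).toFinset.card with hI
  obtain ⟨N, hN⟩ := H.exists_forall_lt_pow hg (2 * (8 * (I * ℓ g) + 4 * δ + 1))
  replace hN := hN N le_rfl
  obtain ⟨p, z, hpz, hp, hz⟩ := H.split (g ^ N) (8 * (I * ℓ g) + 4 * δ + 1)
    (ℓ (g ^ N) - (8 * (I * ℓ g) + 4 * δ + 1)) (by lia)
  have hz' : p⁻¹ * g ^ N = z := by rw [hpz]; group
  have small : ∀ i ∈ Finset.range (I + 1),
      p⁻¹ * g ^ i * p ∈ (H.finite_ball (7 * δ)).toFinset := by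
    intro i hi
    rw [Finset.mem_range] at hi
    simp only [Set.Finite.mem_toFinset, Set.mem_ofPred_eq]
    rcases Nat.eq_zero_or_pos i with rfl | hpos
    · simp [H.one]
    have hl := H.pow_le g i
    have hmul : i * ℓ g ≤ I * ℓ g := Nat.mul_le_mul_right _ (by lia)
    have h2 := H.two_mul_conj_le (h := g ^ i) (y := g ^ N) (p := p)
      ((Commute.refl g).pow_pow i N) (by rw [hz']; lia) (by lia) (by rw [hz']; lia)
    have h3 := hcon i p hpos
    have e : (p⁻¹ * g ^ i * p) ^ 2 = p⁻¹ * (g ^ i) ^ 2 * p := by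
      rw [pow_two, pow_two]; group
    rw [e] at h3
    lia
  obtain ⟨i, -, j, -, hij, he⟩ :=
    Finset.exists_ne_map_eq_of_card_lt_of_maps_to (by simp [← hI]) small
  exact hij (injective_pow_iff_not_isOfFinOrder.2 hg (by simpa using he))

theorem exists_pow_add_drift (H : IsHyperbolicLength ℓ δ) {g : G} (hg : ¬ IsOfFinOrder g) :
    ∃ V, ∀ u, ℓ (g ^ u) + δ + 1 ≤ ℓ (g ^ (u + V)) := by
  obtain ⟨i, p, hi, hc⟩ := H.exists_conj_pow hg
  set k := 4 * ℓ p + 2 * (i * ℓ g) + δ + 1 with hk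
  refine ⟨i * k, fun u ↦ ?_⟩
  have conj : ∀ j, (p⁻¹ * g ^ i * p) ^ j = p⁻¹ * g ^ (i * j) * p := fun j ↦ by
    have := conj_pow (i := j) (a := p⁻¹) (b := g ^ i)
    rw [inv_inv] at this
    rw [this, pow_mul]
  have upper : ∀ j, ℓ (p⁻¹ * g ^ (i * j) * p) ≤ ℓ (g ^ (i * j)) + 2 * ℓ p := fun j ↦ by
    have h1 := H.mul_le (p⁻¹ * g ^ (i * j)) p
    have h2 := H.mul_le p⁻¹ (g ^ (i * j))
    rw [H.inv] at h2
    lia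
  have lower : ∀ j, ℓ (g ^ (i * j)) ≤ ℓ (p⁻¹ * g ^ (i * j) * p) + 2 * ℓ p := fun j ↦ by
    have h1 := H.mul_le (p * (p⁻¹ * g ^ (i * j) * p)) p⁻¹
    have h2 := H.mul_le p (p⁻¹ * g ^ (i * j) * p)
    rw [H.inv] at h1
    have e : p * (p⁻¹ * g ^ (i * j) * p) * p⁻¹ = g ^ (i * j) := by group
    rw [e] at h1
    lia
  have drift := H.pow_add_le hc (u / i) k
  rw [conj, conj] at drift
  have h1 := lower (u / i)
  have h2 := upper (u / i + k)
  have hr : ℓ (g ^ (u % i)) ≤ i * ℓ g :=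
    (H.pow_le g _).trans (Nat.mul_le_mul_right _ (Nat.mod_lt _ hi).le)
  have e1 : g ^ u = g ^ (i * (u / i)) * g ^ (u % i) := by rw [← pow_add, Nat.div_add_mod]
  have e2 : g ^ (u + i * k) * (g ^ (u % i))⁻¹ = g ^ (i * (u / i + k)) := by
    rw [mul_inv_eq_iff_eq_mul, ← pow_add]
    congr 1
    have := Nat.div_add_mod u i
    rw [mul_add]
    lia
  have h3 := H.mul_le (g ^ (i * (u / i))) (g ^ (u % i))
  have h4 := H.mul_le (g ^ (u + i * k)) (g ^ (u % i))⁻¹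
  rw [← e1] at h3
  rw [e2, H.inv] at h4
  lia

theorem exists_pow_add_pow_le (H : IsHyperbolicLength ℓ δ) {g : G} (hg : ¬ IsOfFinOrder g) :
    ∃ K, ∀ u w, ℓ (g ^ u) + ℓ (g ^ w) ≤ ℓ (g ^ (u + w)) + K := by
  obtain ⟨V, hV⟩ := H.exists_pow_add_drift hg
  refine ⟨2 * ℓ (g ^ V) + δ, fun u w ↦ ?_⟩
  have h := H.four_point_pow g u V w
  have h1 := hV u
  have h2 := hV w
  have h3 := H.mul_le (g ^ (u + w)) (g ^ V)
  rw [← pow_add] at h3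
  rw [add_comm V w, add_right_comm u V w] at h
  lia

/-- Geodesics between `1` and `g ^ n` stay close to the powers of `g`. -/
theorem exists_near_pow (H : IsHyperbolicLength ℓ δ) {g : G} (hg : ¬ IsOfFinOrder g) :
    ∃ D, ∀ (n : ℕ) (q : G), ℓ q + ℓ (q⁻¹ * g ^ n) = ℓ (g ^ n) →
      ∃ m ≤ n, ℓ ((g ^ m)⁻¹ * q) ≤ D := by
  obtain ⟨K, hK⟩ := H.exists_pow_add_pow_le hg
  refine ⟨ℓ g + K + δ, fun n q hq ↦ ?_⟩
  have hex : ∃ i, ℓ q ≤ ℓ (g ^ i) := ⟨n, by lia⟩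
  classical
  set i := Nat.find hex with hi
  have hiq : ℓ q ≤ ℓ (g ^ i) := Nat.find_spec hex
  have hin : i ≤ n := Nat.find_min' hex (by lia)
  have hiq' : ℓ (g ^ i) ≤ ℓ q + ℓ g := by
    rcases Nat.eq_zero_or_pos i with h0 | h0
    · simp [h0, H.one]
    · have h1 : ¬ ℓ q ≤ ℓ (g ^ (i - 1)) := Nat.find_min hex (by lia)
      have h2 := H.mul_le (g ^ (i - 1)) g
      rw [← pow_succ, Nat.sub_add_cancel h0] at h2
      lia
  refine ⟨i, hin, ?_⟩
  have h := H.four_point (g ^ i) q 1 (g ^ n)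
  have hn : (g ^ i)⁻¹ * g ^ n = g ^ (n - i) := by
    rw [inv_mul_eq_iff_eq_mul, ← pow_add, Nat.add_sub_cancel' hin]
  have hKi := hK i (n - i)
  rw [Nat.add_sub_cancel' hin] at hKi
  simp only [mul_one, H.inv, hn, inv_one, one_mul] at h
  lia

/-- The cone of `p` is determined by the relative lengths on a ball around `p`. -/
theorem cone_transfer (H : IsHyperbolicLength ℓ δ) {p p' : G}
    (hpp : ∀ h, ℓ h ≤ δ + 2 → ℓ (p * h) + ℓ p' = ℓ (p' * h) + ℓ p) (q : G)
    (hq : ℓ (p * q) = ℓ p + ℓ q) : ℓ (p' * q) = ℓ p' + ℓ q := by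
  induction hn : ℓ q generalizing q with
  | zero => simp [H.eq_one q hn]
  | succ n ih =>
    obtain ⟨q₁, s, rfl, hq₁, hs⟩ := H.split q n 1 hn
    have a1 := H.mul_le (p * q₁) s
    have a2 := H.mul_le p q₁
    rw [mul_assoc] at a1
    have hq' := ih q₁ (by lia) hq₁
    set x := p' * (q₁ * s) with hx
    have hupper : ℓ x ≤ ℓ p' + (n + 1) := hn ▸ H.mul_le p' (q₁ * s)
    have hlower : ℓ p' + n ≤ ℓ x + 1 := by
      have := H.mul_le x s⁻¹
      rw [hx, H.inv, ← mul_assoc, mul_inv_cancel_right, mul_assoc] at this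
      lia
    by_contra hne
    have hp0 : ℓ p' ≠ 0 := fun h0 ↦ hne (by simp [hx, H.eq_one p' h0, hn, H.one])
    obtain ⟨z, v, hzv, hz, hv⟩ := H.split x (ℓ x - n) n (by lia)
    have f := H.four_point p' z 1 x
    have e1 : p'⁻¹ * x = q₁ * s := by simp [hx]
    have e2 : z⁻¹ * x = v := by simp [hzv]
    simp only [mul_one, H.inv, e1, e2, inv_one, one_mul] at f
    have key := hpp (p'⁻¹ * z) (by lia)
    rw [mul_inv_cancel_left] at key
    have e3 : p * (q₁ * s) = p * (p'⁻¹ * z) * v := by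
      rw [← e1, hzv]; group
    have a3 := H.mul_le (p * (p'⁻¹ * z)) v
    rw [← e3] at a3
    lia

/-- If `p` and `p'` are close to large powers of `g` in the same way and have the same relative
lengths around them, then they have the same geodesic continuations to powers of `g`. -/
theorem continuation_transfer (H : IsHyperbolicLength ℓ δ) {g : G} {D M : ℕ}
    (hD : ∀ (n : ℕ) (q : G), ℓ q + ℓ (q⁻¹ * g ^ n) = ℓ (g ^ n) →
      ∃ m ≤ n, ℓ ((g ^ m)⁻¹ * q) ≤ D)
    (hM : ∀ n ≥ M, 2 * D < ℓ (g ^ n)) {p p' : G} {m m' : ℕ}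
    (hpp : ∀ h, ℓ h ≤ δ + 2 → ℓ (p * h) + ℓ p' = ℓ (p' * h) + ℓ p)
    (hu : (g ^ m)⁻¹ * p = (g ^ m')⁻¹ * p') (huD : ℓ ((g ^ m)⁻¹ * p) ≤ D)
    (hm : min m M = min m' M) {q : G} {n : ℕ} (hqn : p * q = g ^ n)
    (hq : ℓ (p * q) = ℓ p + ℓ q) :
    (∃ n' : ℕ, p' * q = g ^ n') ∧ ℓ (p' * q) = ℓ p' + ℓ q := by
  have hq' := H.cone_transfer hpp q hq
  refine ⟨?_, hq'⟩
  rcases lt_or_ge m M with hmM | hmM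
  · obtain rfl : m = m' := by lia
    exact ⟨n, by rw [← mul_left_cancel hu, hqn]⟩
  have hp' : p' = g ^ m' * ((g ^ m)⁻¹ * p) := by rw [hu, mul_inv_cancel_left]
  have hz : p' * q = g ^ ((m' : ℤ) - m + n) := by
    rw [hp', mul_assoc, mul_assoc, hqn, zpow_add, zpow_sub]
    simp [mul_assoc]
  rcases le_or_gt m (m' + n) with hle | hlt
  · refine ⟨m' + n - m, ?_⟩
    rw [hz, ← zpow_natCast]
    congr 1
    lia
  exfalso
  obtain ⟨j, hj⟩ : ∃ j, m = m' + n + j := ⟨m - (m' + n), by lia⟩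
  have hj' : p' * q = (g ^ j)⁻¹ := by
    rw [hz, ← zpow_natCast, ← zpow_neg]
    congr 1
    lia
  have hgj : g ^ j = q⁻¹ * p'⁻¹ := by rw [← mul_inv_rev, hj', inv_inv]
  obtain ⟨i, hij, hi⟩ := hD j q⁻¹ (by
    rw [hgj, inv_inv, mul_inv_cancel_left, ← mul_inv_rev, H.inv, H.inv, H.inv, hq', add_comm])
  have hbig := hM (m' + (j - i)) (by lia)
  have e : g ^ (m' + (j - i)) = (g ^ i)⁻¹ * q⁻¹ * ((g ^ m)⁻¹ * p)⁻¹ := by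
    rw [hu, pow_add, (Commute.refl g).pow_pow m' (j - i) |>.eq]
    have : g ^ (j - i) = (g ^ i)⁻¹ * g ^ j := by
      rw [eq_inv_mul_iff_mul_eq, ← pow_add, Nat.add_sub_cancel' hij]
    rw [this, hgj]
    group
  have hle := H.mul_le ((g ^ i)⁻¹ * q⁻¹) ((g ^ m)⁻¹ * p)⁻¹
  rw [← e, H.inv] at hle
  lia

theorem isRegular_geodesics_of_powers (H : IsHyperbolicLength ℓ δ) {S : Set G}
    (hS : ∀ w : List S, ℓ (w.map Subtype.val).prod ≤ w.length) {g : G}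
    (hg : ¬ IsOfFinOrder g) :
    Language.IsRegular {w : List S | ∃ n : ℕ,
      (w.map Subtype.val).prod = g ^ n ∧ w.length = ℓ (g ^ n)} := by
  set L : Language S := {w : List S | ∃ n : ℕ,
    (w.map Subtype.val).prod = g ^ n ∧ w.length = ℓ (g ^ n)} with hL
  obtain ⟨D, hD⟩ := H.exists_near_pow hg
  obtain ⟨M, hM⟩ := H.exists_forall_lt_pow hg (2 * D)
  let ev : List S → G := fun w ↦ (w.map Subtype.val).prod
  have ev_append : ∀ v w, ev (v ++ w) = ev v * ev w := fun v w ↦ by simp [ev]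
  have mem_L : ∀ v w, v ++ w ∈ L ↔ (∃ n : ℕ, ev v * ev w = g ^ n) ∧
      ℓ (ev v * ev w) = ℓ (ev v) + ℓ (ev w) ∧ ℓ (ev v) = v.length ∧ ℓ (ev w) = w.length := by
    intro v w
    have h1 := hS v
    have h2 := hS w
    have h3 := H.mul_le (ev v) (ev w)
    constructor
    · rintro ⟨n, hn, hl⟩
      change ev (v ++ w) = _ at hn
      rw [ev_append] at hn
      rw [← hn, List.length_append] at hl
      change ℓ (ev v) ≤ _ at h1
      change ℓ (ev w) ≤ _ at h2
      exact ⟨⟨n, hn⟩, by lia, by lia, by lia⟩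
    · rintro ⟨⟨n, hn⟩, hl, hv, hw⟩
      refine ⟨n, (ev_append v w).trans hn, ?_⟩
      rw [← hn, hl, hv, hw, List.length_append]
  rw [Language.isRegular_iff_finite_range_leftQuotient]
  suffices h : (Set.range L.leftQuotient \ {(∅ : Set (List S))}).Finite from
    h.of_sdiff (Set.finite_singleton _)
  have hrep : ∀ Q : ↥(Set.range L.leftQuotient \ {(∅ : Set (List S))}), ∃ (p : List S) (m : ℕ),
      L.leftQuotient p = Q ∧ ℓ (ev p) = p.length ∧ ℓ ((g ^ m)⁻¹ * ev p) ≤ D := by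
    rintro ⟨_, ⟨p, rfl⟩, hne⟩
    obtain ⟨q, hq⟩ := Set.nonempty_iff_ne_empty.2 hne
    obtain ⟨⟨n, hn⟩, hl, hp, -⟩ := (mem_L p q).1 hq
    obtain ⟨m, -, hm⟩ := hD n (ev p) (by rw [← hn, inv_mul_cancel_left, hl])
    exact ⟨p, m, rfl, hp, hm⟩
  choose p m hQ hlen hnear using hrep
  have : Finite {h | ℓ h ≤ δ + 2} := H.finite_ball _
  have : Finite {h | ℓ h ≤ D} := H.finite_ball _
  let F : ↥(Set.range L.leftQuotient \ {(∅ : Set (List S))}) →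
      ({h | ℓ h ≤ δ + 2} → Fin (2 * (δ + 2) + 1)) × {h | ℓ h ≤ D} × Fin (M + 1) := fun Q ↦
    (fun h ↦ ⟨ℓ (ev (p Q) * h) + (δ + 2) - ℓ (ev (p Q)), by
        have h1 := H.mul_le (ev (p Q)) h
        have h2 : ℓ h ≤ δ + 2 := h.2
        lia⟩,
      ⟨(g ^ m Q)⁻¹ * ev (p Q), hnear Q⟩, ⟨min (m Q) M, by lia⟩)
  have sub : ∀ Q Q', F Q = F Q' → L.leftQuotient (p Q) ≤ L.leftQuotient (p Q') := by
    intro Q Q' hF q hq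
    simp only [F, Prod.mk.injEq, Subtype.mk.injEq, Fin.mk.injEq] at hF
    obtain ⟨hf, hu, hm⟩ := hF
    obtain ⟨⟨n, hn⟩, hl, -, hq⟩ := (mem_L _ _).1 hq
    have hpp : ∀ h, ℓ h ≤ δ + 2 →
        ℓ (ev (p Q) * h) + ℓ (ev (p Q')) = ℓ (ev (p Q') * h) + ℓ (ev (p Q)) := by
      intro h hh
      have h1 := congrArg Fin.val (congrFun hf ⟨h, hh⟩)
      have h2 := H.mul_le (ev (p Q) * h) h⁻¹
      have h3 := H.mul_le (ev (p Q') * h) h⁻¹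
      rw [mul_inv_cancel_right, H.inv] at h2 h3
      simp only at h1
      lia
    have := H.continuation_transfer hD hM hpp hu (hnear Q) hm hn hl
    exact (mem_L _ _).2 ⟨this.1, this.2, hlen Q', hq⟩
  have hinj : Function.Injective F := fun Q Q' hF ↦ by
    apply Subtype.ext
    rw [← hQ Q, ← hQ Q']
    exact le_antisymm (sub _ _ hF) (sub _ _ hF.symm)
  exact Finite.of_injective F hinj

end IsHyperbolicLength

section Cayley

variable {G : Type*} [Group G] {S : Set G}

theorem cayleyGraph_adj_iff (hinv : ∀ s ∈ S, s⁻¹ ∈ S) (hone : (1 : G) ∉ S) (u v : G) :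
    (cayleyGraph G S).Adj u v ↔ u⁻¹ * v ∈ S := by
  rw [cayleyGraph, SimpleGraph.fromRel_adj]
  constructor
  · rintro ⟨-, h | h⟩
    · exact h
    · simpa using hinv _ h
  · refine fun h ↦ ⟨?_, Or.inl h⟩
    rintro rfl
    exact hone (by simpa using h)

theorem cayleyGraph_exists_walk (hinv : ∀ s ∈ S, s⁻¹ ∈ S) (hone : (1 : G) ∉ S)
    (w : List S) (u v : G) (h : u * (w.map Subtype.val).prod = v) :
    ∃ p : (cayleyGraph G S).Walk u v, p.length = w.length := by
  induction w generalizing u with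
  | nil =>
    obtain rfl : u = v := by simpa using h
    exact ⟨.nil, rfl⟩
  | cons s w ih =>
    obtain ⟨p, hp⟩ := ih (u * s) (by simpa [mul_assoc] using h)
    exact ⟨.cons ((cayleyGraph_adj_iff hinv hone _ _).2 (by simp)) p, by simp [hp]⟩

theorem cayleyGraph_exists_word (hinv : ∀ s ∈ S, s⁻¹ ∈ S) (hone : (1 : G) ∉ S)
    {u v : G} (p : (cayleyGraph G S).Walk u v) :
    ∃ w : List S, (w.map Subtype.val).prod = u⁻¹ * v ∧ w.length = p.length := by
  induction p with
  | nil => exact ⟨[], by simp⟩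
  | cons h p ih =>
    obtain ⟨w, hw, hl⟩ := ih
    exact ⟨⟨_, (cayleyGraph_adj_iff hinv hone _ _).1 h⟩ :: w, by
      rw [List.map_cons, List.prod_cons, hw]
      group, by simp [hl]⟩

theorem cayleyGraph_dist_le (hinv : ∀ s ∈ S, s⁻¹ ∈ S) (hone : (1 : G) ∉ S)
    (w : List S) (u v : G) (h : u * (w.map Subtype.val).prod = v) :
    (cayleyGraph G S).dist u v ≤ w.length := by
  obtain ⟨p, hp⟩ := cayleyGraph_exists_walk hinv hone w u v h
  exact hp ▸ SimpleGraph.dist_le p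

theorem cayleyGraph_exists_geodesic_word (hinv : ∀ s ∈ S, s⁻¹ ∈ S) (hone : (1 : G) ∉ S)
    (hconn : (cayleyGraph G S).Connected) (u v : G) :
    ∃ w : List S, (w.map Subtype.val).prod = u⁻¹ * v ∧
      w.length = (cayleyGraph G S).dist u v := by
  obtain ⟨p, hp⟩ := hconn.exists_walk_length_eq_dist u v
  exact hp ▸ cayleyGraph_exists_word hinv hone p

theorem cayleyGraph_dist_eq (hinv : ∀ s ∈ S, s⁻¹ ∈ S) (hone : (1 : G) ∉ S)
    (hconn : (cayleyGraph G S).Connected) (u v : G) :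
    (cayleyGraph G S).dist u v = (cayleyGraph G S).dist 1 (u⁻¹ * v) := by
  apply le_antisymm
  · obtain ⟨w, hw, hl⟩ := cayleyGraph_exists_geodesic_word hinv hone hconn 1 (u⁻¹ * v)
    exact hl ▸ cayleyGraph_dist_le hinv hone w u v (by rw [hw]; group)
  · obtain ⟨w, hw, hl⟩ := cayleyGraph_exists_geodesic_word hinv hone hconn u v
    exact hl ▸ cayleyGraph_dist_le hinv hone w 1 _ (by rw [hw, one_mul])

theorem exists_isHyperbolicLength (hfin : S.Finite) (hinv : ∀ s ∈ S, s⁻¹ ∈ S)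
    (hone : (1 : G) ∉ S) (hconn : (cayleyGraph G S).Connected)
    (hhyp : IsHyperbolic (cayleyGraph G S)) :
    ∃ δ, IsHyperbolicLength (fun x : G ↦ (cayleyGraph G S).dist 1 x) δ := by
  obtain ⟨δ, -, hδ⟩ := hhyp
  have hd := cayleyGraph_dist_eq hinv hone hconn
  refine ⟨⌈2 * δ⌉₊, ?_, ?_, ?_, ?_, ?_, ?_, ?_⟩
  · simp
  · exact fun x hx ↦ (hconn.dist_eq_zero_iff.1 hx).symm
  · intro x
    rw [SimpleGraph.dist_comm, hd]
    simp
  · intro x y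
    have h := hconn.dist_triangle (u := 1) (v := x) (w := x * y)
    rwa [hd x (x * y), inv_mul_cancel_left] at h
  · intro n
    have : Finite S := hfin
    refine ((List.finite_length_le S n).image fun w ↦ (w.map Subtype.val).prod).subset ?_
    intro x hx
    obtain ⟨w, hw, hl⟩ := cayleyGraph_exists_geodesic_word hinv hone hconn 1 x
    exact ⟨w, hl.trans_le hx, hw.trans (by group)⟩
  · intro x a b hx
    obtain ⟨w, hw, hl⟩ := cayleyGraph_exists_geodesic_word hinv hone hconn 1 x
    rw [inv_one, one_mul] at hw
    have hprod : x = ((w.take a).map Subtype.val).prod * ((w.drop a).map Subtype.val).prod := by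
      rw [← List.prod_append, ← List.map_append, List.take_append_drop, hw]
    refine ⟨_, _, hprod, ?_⟩
    have h1 := cayleyGraph_dist_le hinv hone (w.take a) 1 _ (one_mul _)
    have h2 := cayleyGraph_dist_le hinv hone (w.drop a) 1 _ (one_mul _)
    have h3 := hconn.dist_triangle (u := 1) (v := ((w.take a).map Subtype.val).prod) (w := x)
    have h4 := hd ((w.take a).map Subtype.val).prod x
    nth_rewrite 2 [hprod] at h4
    rw [inv_mul_cancel_left] at h4
    rw [List.length_take] at h1
    rw [List.length_drop] at h2
    lia
  · intro x y z w
    simp only [← hd]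
    have h := hδ x y z w
    have hc := Nat.le_ceil (2 * δ)
    have : (((cayleyGraph G S).dist x y + (cayleyGraph G S).dist z w : ℕ) : ℝ) ≤
        ((max ((cayleyGraph G S).dist x z + (cayleyGraph G S).dist y w)
          ((cayleyGraph G S).dist x w + (cayleyGraph G S).dist y z) + ⌈2 * δ⌉₊ : ℕ) : ℝ) := by
      push_cast
      linarith
    exact_mod_cast this

end Cayley

/-- Let `G` be a hyperbolic group with a finite inverse-closed generating
set `S` such that `Cay(G, S)` is `k`-geodetic, and let `g ∈ G` have infinite order. Then
the language `⋃_{n ≥ 0} L_n` over the alphabet `S`, where `L_n` is the set of geodesic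
words representing `g^n`, is regular. Words over `S` are modelled as lists of elements
of the subtype `↥S`; a word is a geodesic word for `g^n` when it evaluates to `g^n` and
its length is the graph distance from `1` to `g^n`. -/
theorem geodesics_of_powers_regular {G : Type*} [Group G] (k : ℕ) (hk : 0 < k)
    (S : Set G) (hfin : S.Finite) (hinv : ∀ s ∈ S, s⁻¹ ∈ S) (hone : (1 : G) ∉ S)
    (hgen : Subgroup.closure S = ⊤)
    (hhyp : IsHyperbolic (cayleyGraph G S))
    (hgeo : IsKGeodetic (cayleyGraph G S) k)
    (g : G) (hg : ¬ IsOfFinOrder g) :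
    Language.IsRegular
      {w : List ↥S | ∃ n : ℕ,
        (w.map Subtype.val).prod = g ^ n ∧
        w.length = (cayleyGraph G S).dist 1 (g ^ n)} := by
  obtain ⟨δ, H⟩ := exists_isHyperbolicLength hfin hinv hone hgeo.1 hhyp
  exact H.isRegular_geodesics_of_powers
    (fun w ↦ cayleyGraph_dist_le hinv hone w 1 _ (one_mul _)) hg
end

section
/- Let k be a positive integer and let G be a hyperbolic group that admits a finite inverse-closed generating set S such that Cay(G,S) is k-geodetic. Then for every element g ∈ G of infinite order, the centraliser C_G(g) is an infinite cyclic group. -/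
/-- A point on a walk splits its length at least as the distances do. -/
theorem SimpleGraph.Walk.dist_add_dist_le_length {V : Type*} {X : SimpleGraph V} {a b u : V}
    (p : X.Walk a b) (hu : u ∈ p.support) : X.dist a u + X.dist u b ≤ p.length := by
  classical
  rw [← p.take_spec hu, SimpleGraph.Walk.length_append]
  exact add_le_add (SimpleGraph.dist_le _) (SimpleGraph.dist_le _)

theorem SimpleGraph.Walk.append_right_injective {V : Type*} {X : SimpleGraph V} {a b c : V}
    (q : X.Walk a b) : Function.Injective (fun p : X.Walk b c => q.append p) := by
  induction q with
  | nil => exact fun _ _ h => h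
  | cons hadj q ih =>
    intro p p' h
    simp only [SimpleGraph.Walk.cons_append, SimpleGraph.Walk.cons.injEq, heq_eq_eq, true_and] at h
    exact ih h

/-- Any two points of a connected graph are joined by a discrete geodesic segment. -/
theorem SimpleGraph.Connected.exists_geodesic_segment {V : Type*} {X : SimpleGraph V}
    (hX : X.Connected) (a b : V) : ∃ c : ℕ → V, c 0 = a ∧ c (X.dist a b) = b ∧
      ∀ i n, i + n ≤ X.dist a b → X.dist (c i) (c (i + n)) = n := by
  obtain ⟨p, hp⟩ := hX.exists_walk_length_eq_dist a b
  have hle : ∀ i n, X.dist (p.getVert i) (p.getVert (i + n)) ≤ n := by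
    intro i n
    induction n with
    | zero => simp
    | succ n ih =>
      have h1 := hX.dist_triangle (u := p.getVert i) (v := p.getVert (i + n))
        (w := p.getVert (i + (n + 1)))
      have h2 : X.dist (p.getVert (i + n)) (p.getVert (i + (n + 1))) ≤ 1 := by
        rcases lt_or_ge (i + n) p.length with h | h
        · exact (SimpleGraph.dist_eq_one_iff_adj.2 (p.adj_getVert_succ h)).le
        · rw [p.getVert_of_length_le h, p.getVert_of_length_le (by omega)]
          simp
      omega
  refine ⟨p.getVert, p.getVert_zero, hp ▸ p.getVert_length, fun i n hin => ?_⟩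
  have h1 := hX.dist_triangle (u := a) (v := p.getVert i) (w := b)
  have h2 := hX.dist_triangle (u := p.getVert i) (v := p.getVert (i + n)) (w := b)
  have h3 := hle 0 i
  have h4 := hle (i + n) (X.dist a b - (i + n))
  rw [show i + n + (X.dist a b - (i + n)) = p.length by omega, p.getVert_length] at h4
  rw [zero_add, p.getVert_zero] at h3
  have h5 := hle i n
  omega

/-- A discrete geodesic ray in a graph. -/
def IsGeodesicRay {V : Type*} (X : SimpleGraph V) (γ : ℕ → V) : Prop :=
  ∀ i n, X.dist (γ i) (γ (i + n)) = n

/-- The sequences `γ` and `γ'` meet arbitrarily far out, with `γ'` shifted by `c`. -/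
def MeetFrequently {V : Type*} (γ γ' : ℕ → V) (c : ℤ) : Prop :=
  ∀ N, ∃ i ≥ N, ∃ j : ℕ, γ i = γ' j ∧ (i : ℤ) = j + c

/-- In a graph with finite balls, geodesic segments with a common origin and lengths tending to
infinity subconverge to a geodesic ray. -/
theorem exists_isGeodesicRay {V : Type*} {X : SimpleGraph V} (hX : X.Connected) (a : V)
    (hball : ∀ n, {v | X.dist a v ≤ n}.Finite) (y : ℕ → V) (hy : Function.Injective y) :
    ∃ γ : ℕ → V, IsGeodesicRay X γ ∧
      ∀ i, ∃ n, X.dist a (γ i) = i ∧ i + X.dist (γ i) (y n) = X.dist a (y n) := by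
  choose c hc0 hc1 hc using fun n => hX.exists_geodesic_segment a (y n)
  let U := Filter.hyperfilter ℕ
  have hU : ∀ m, ∀ᶠ n in (U : Filter ℕ), m ≤ X.dist a (y n) := by
    intro m
    refine Filter.hyperfilter_le_cofinite ?_
    refine Set.Finite.subset ((hball m).preimage hy.injOn) fun n hn => ?_
    simp only [Set.mem_compl_iff, Set.mem_ofPred_eq, not_le] at hn
    exact hn.le
  have hlim : ∀ i, ∃ v, ∀ᶠ n in (U : Filter ℕ), c n i = v := by
    intro i
    have h : ∀ᶠ n in (U : Filter ℕ), ∃ v ∈ {v | X.dist a v ≤ i}, c n i = v := by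
      filter_upwards [hU i] with n hn
      refine ⟨_, ?_, rfl⟩
      have := hc n 0 i (by omega)
      rw [zero_add, hc0] at this
      exact this.le
    obtain ⟨v, -, hv⟩ := (U.eventually_exists_mem_iff (hball i)).1 h
    exact ⟨v, hv⟩
  choose γ hγ using hlim
  refine ⟨γ, fun i n => ?_, fun i => ?_⟩
  · obtain ⟨m, h1, h2, h3⟩ := ((hγ i).and ((hγ (i + n)).and (hU (i + n)))).exists
    rw [← h1, ← h2]
    exact hc m i n h3
  · obtain ⟨m, h1, h2⟩ := ((hγ i).and (hU i)).exists
    refine ⟨m, ?_⟩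
    have h3 := hc m 0 i (by omega)
    have h4 := hc m i (X.dist a (y m) - i) (by omega)
    rw [zero_add, hc0] at h3
    rw [show i + (X.dist a (y m) - i) = X.dist a (y m) by omega, hc1] at h4
    rw [← h1]
    omega

namespace MeetFrequently

variable {V : Type*} {X : SimpleGraph V} {γ γ' γ'' : ℕ → V} {a b c : ℤ}

theorem refl (γ : ℕ → V) : MeetFrequently γ γ 0 :=
  fun N => ⟨N, le_rfl, N, rfl, by simp⟩

theorem symm (h : MeetFrequently γ γ' c) : MeetFrequently γ' γ (-c) := by
  intro N
  obtain ⟨i, hi, j, hij, hc⟩ := h (N + c.natAbs)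
  exact ⟨j, by omega, i, hij.symm, by omega⟩

theorem le_add (hX : X.Connected) (hγ : IsGeodesicRay X γ) (hγ' : IsGeodesicRay X γ')
    (hγ'' : IsGeodesicRay X γ'') (hab : MeetFrequently γ γ' a) (hbc : MeetFrequently γ' γ'' b)
    (hac : MeetFrequently γ γ'' c) : c ≤ a + b := by
  obtain ⟨i₀, -, j₀, h₀, e₀⟩ := hac 0
  obtain ⟨i, hi, j, h₁, e₁⟩ := hab i₀
  obtain ⟨k, hk, l, h₂, e₂⟩ := hbc (j + j₀ + b.natAbs)
  obtain ⟨u, rfl⟩ := Nat.exists_eq_add_of_le hi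
  obtain ⟨v, rfl⟩ := Nat.exists_eq_add_of_le (show j ≤ k by omega)
  obtain ⟨w, rfl⟩ := Nat.exists_eq_add_of_le (show j₀ ≤ l by omega)
  have h3 := hγ i₀ u
  have h4 := hγ' j v
  have h5 := hγ'' j₀ w
  have h6 := hX.dist_triangle (u := γ i₀) (v := γ (i₀ + u)) (w := γ'' (j₀ + w))
  rw [h₀, h5, ← h₂, h₁, h4, ← h₁, ← h₀, h3] at h6
  omega

theorem eq_add (hX : X.Connected) (hγ : IsGeodesicRay X γ) (hγ' : IsGeodesicRay X γ')
    (hγ'' : IsGeodesicRay X γ'') (hab : MeetFrequently γ γ' a) (hbc : MeetFrequently γ' γ'' b)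
    (hac : MeetFrequently γ γ'' c) : c = a + b := by
  have h1 := le_add hX hγ hγ' hγ'' hab hbc hac
  have h2 := le_add hX hγ' hγ hγ'' hab.symm hac hbc
  omega

end MeetFrequently

/-- The distance between two rays at bounded distance is eventually, up to a constant,
the difference of the parameters. -/
theorem IsGeodesicRay.exists_eventual_shift {V : Type*} {X : SimpleGraph V} (hX : X.Connected)
    {γ γ' : ℕ → V} (hγ : IsGeodesicRay X γ) (hγ' : IsGeodesicRay X γ') {C : ℕ}
    (hC : ∀ i, X.dist (γ i) (γ' i) ≤ C) :
    ∃ (c : ℤ) (N : ℕ), ∀ i ≥ N, ∃ J, ∀ j ≥ J, (X.dist (γ i) (γ' j) : ℤ) = j - i + c := by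
  let F : ℕ → ℕ → ℤ := fun i j => X.dist (γ i) (γ' j) + i - j
  have hF_mono : ∀ j, Monotone fun i => F i j := fun j => monotone_nat_of_le_succ fun i => by
    have h1 := hX.dist_triangle (u := γ i) (v := γ (i + 1)) (w := γ' j)
    rw [hγ i 1] at h1
    simp only [F]
    omega
  have hF_anti : ∀ i, Antitone (F i) := fun i => antitone_nat_of_succ_le fun j => by
    have h1 := hX.dist_triangle (u := γ i) (v := γ' j) (w := γ' (j + 1))
    rw [hγ' j 1] at h1
    simp only [F]
    omega
  have hF_lower : ∀ i j, -(C : ℤ) ≤ F i j := by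
    intro i j
    have h1 := hC i
    have h2 : j ≤ i + X.dist (γ' i) (γ' j) := by
      rcases le_total i j with h | h
      · obtain ⟨n, rfl⟩ := Nat.exists_eq_add_of_le h
        rw [hγ' i n]
      · omega
    have h3 := hX.dist_triangle (u := γ' i) (v := γ i) (w := γ' j)
    rw [SimpleGraph.dist_comm (u := γ' i) (v := γ i)] at h3
    simp only [F]
    omega
  have hφ : ∀ i, ∃ v, (∃ j, F i j = v) ∧ ∀ w, (∃ j, F i j = w) → v ≤ w := fun i =>
    Int.exists_least_of_bdd ⟨-C, by rintro _ ⟨j, rfl⟩; exact hF_lower i j⟩ ⟨_, 0, rfl⟩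
  choose φ hφ1 hφ2 using hφ
  choose J hJ using hφ1
  have hφ_mono : Monotone φ := fun i i' h =>
    (hφ2 i _ ⟨J i', rfl⟩).trans ((hF_mono (J i') h).trans (hJ i').le)
  obtain ⟨c, ⟨N, hN⟩, hc⟩ : ∃ c, (∃ i, φ i = c) ∧ ∀ w, (∃ i, φ i = w) → w ≤ c := by
    refine Int.exists_greatest_of_bdd ⟨C, ?_⟩ ⟨_, 0, rfl⟩
    rintro _ ⟨i, rfl⟩
    refine (hφ2 i _ ⟨i, rfl⟩).trans ?_
    have := hC i
    simp only [F]
    omega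
  refine ⟨c, N, fun i hi => ⟨J i, fun j hj => ?_⟩⟩
  have h1 : φ i = c := le_antisymm (hc _ ⟨i, rfl⟩) (hN ▸ hφ_mono hi)
  have h2 : F i j = c :=
    le_antisymm ((hF_anti i hj).trans (hJ i ▸ h1.le)) (h1 ▸ hφ2 i _ ⟨j, rfl⟩)
  simp only [F] at h2
  omega

/-- Two eventually disjoint rays at bounded distance yield arbitrarily many geodesics
between some pair of vertices. -/
theorem IsGeodesicRay.exists_many_geodesics {V : Type*} {X : SimpleGraph V} (hX : X.Connected)
    {γ γ' : ℕ → V} (hγ : IsGeodesicRay X γ) (hγ' : IsGeodesicRay X γ') {c : ℤ} {N : ℕ}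
    (hc : ∀ i ≥ N, ∃ J, ∀ j ≥ J, (X.dist (γ i) (γ' j) : ℤ) = j - i + c)
    (hdisj : ∀ i ≥ N, ∀ j, γ i ≠ γ' j) (m : ℕ) :
    ∀ i ≥ N, ∃ J, ∀ j ≥ J, ∃ T : Finset (X.Walk (γ i) (γ' j)),
      (∀ p ∈ T, p.length = X.dist (γ i) (γ' j)) ∧ T.card = m := by
  classical
  induction m with
  | zero => exact fun i _ => ⟨0, fun j _ => ⟨∅, by simp, rfl⟩⟩
  | succ m ih =>
    intro i hi
    obtain ⟨J₀, hJ₀⟩ := hc i hi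
    -- `j₁` is chosen so that `γ (i + n)` and `γ' j₁` are at the same distance from `γ i`
    obtain ⟨j₁, n, hj₁, hn⟩ : ∃ j₁ n : ℕ, J₀ ≤ j₁ ∧ (n : ℤ) = j₁ - i + c :=
      ⟨J₀ + i + c.natAbs, (J₀ + c.natAbs + c).toNat, by omega, by omega⟩
    obtain ⟨J₁, hJ₁⟩ := hc (i + n) (by omega)
    obtain ⟨J₂, hJ₂⟩ := ih (i + n) (by omega)
    refine ⟨J₁ + J₂ + j₁, fun j hj => ?_⟩
    obtain ⟨T, hT, hTcard⟩ := hJ₂ j (by omega)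
    have e₁ := hJ₀ j₁ hj₁
    have e₂ := hJ₀ j (by omega)
    have e₃ := hJ₁ j (by omega)
    have e₄ := hγ i n
    have e₅ : X.dist (γ' j₁) (γ' j) = j - j₁ := by
      obtain ⟨u, rfl⟩ := Nat.exists_eq_add_of_le (show j₁ ≤ j by omega)
      rw [hγ' j₁ u]
      omega
    obtain ⟨q, hq⟩ := hX.exists_walk_length_eq_dist (γ i) (γ (i + n))
    obtain ⟨w₁, hw₁⟩ := hX.exists_walk_length_eq_dist (γ i) (γ' j₁)
    obtain ⟨w₂, hw₂⟩ := hX.exists_walk_length_eq_dist (γ' j₁) (γ' j)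
    have hnot : γ (i + n) ∉ (w₁.append w₂).support := by
      rw [SimpleGraph.Walk.mem_support_append_iff]
      rintro (h | h)
      · have := w₁.dist_add_dist_le_length h
        exact hdisj (i + n) (by omega) j₁ (hX.dist_eq_zero_iff.1 (by omega))
      · have := w₂.dist_add_dist_le_length h
        exact hdisj (i + n) (by omega) j₁ (hX.dist_eq_zero_iff.1 (by omega)).symm
    refine ⟨insert (w₁.append w₂) (T.image fun p => q.append p), ?_, ?_⟩
    · intro p hp
      rcases Finset.mem_insert.1 hp with rfl | hp
      · rw [SimpleGraph.Walk.length_append]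
        omega
      · obtain ⟨p', hp', rfl⟩ := Finset.mem_image.1 hp
        have := hT p' hp'
        rw [SimpleGraph.Walk.length_append]
        omega
    · rw [Finset.card_insert_of_notMem, Finset.card_image_of_injective _ q.append_right_injective,
        hTcard]
      intro h
      obtain ⟨p, -, hp⟩ := Finset.mem_image.1 h
      apply hnot
      rw [← hp, SimpleGraph.Walk.mem_support_append_iff]
      exact Or.inl q.end_mem_support

/-- In a `k`-geodetic graph, geodesic rays at bounded distance meet arbitrarily far out. -/
theorem IsKGeodetic.exists_meetFrequently {V : Type*} {X : SimpleGraph V} {k : ℕ}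
    (hX : IsKGeodetic X k) {γ γ' : ℕ → V} (hγ : IsGeodesicRay X γ) (hγ' : IsGeodesicRay X γ')
    {C : ℕ} (hC : ∀ i, X.dist (γ i) (γ' i) ≤ C) : ∃ c, MeetFrequently γ γ' c := by
  obtain ⟨c, N, hc⟩ := hγ.exists_eventual_shift hX.1 hγ' hC
  refine ⟨c, fun M => ?_⟩
  obtain ⟨i, hi, j, hij⟩ : ∃ i ≥ M + N, ∃ j, γ i = γ' j := by
    by_contra! h
    obtain ⟨J, hJ⟩ := hγ.exists_many_geodesics hX.1 hγ' (N := M + N)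
      (fun i hi => hc i (by omega)) h (k + 1) (M + N) le_rfl
    obtain ⟨T, hT, hTcard⟩ := hJ J le_rfl
    have := hX.2 _ _ T hT
    omega
  refine ⟨i, by omega, j, hij, ?_⟩
  obtain ⟨J, hJ⟩ := hc i (by omega)
  have h1 := hJ (j + J) (by omega)
  rw [hij, hγ' j J] at h1
  push_cast at h1
  omega

/-- In a hyperbolic graph, two points at the same position relative to the endpoints of two
segments are close if the endpoints are. -/
theorem IsHyperbolic.exists_dist_le {V : Type*} {X : SimpleGraph V} (hX : X.Connected)
    (hhyp : IsHyperbolic X) (D : ℕ) : ∃ C : ℕ, ∀ a b a' b' p q : V, ∀ i j : ℕ,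
      X.dist a a' ≤ D → X.dist b b' ≤ D → X.dist a p = i → X.dist p b = j →
      X.dist a' q = i → X.dist q b' = j → X.dist a b = i + j → X.dist p q ≤ C := by
  obtain ⟨δ, -, hδ⟩ := hhyp
  refine ⟨⌈(D : ℝ) + 2 * δ⌉₊, fun a b a' b' p q i j ha hb h1 h2 h3 h4 h5 => ?_⟩
  have t1 : X.dist q a ≤ i + D := by
    have := hX.dist_triangle (u := a) (v := a') (w := q)
    rw [SimpleGraph.dist_comm (u := q)]
    omega
  have t2 : X.dist q b ≤ j + D := by
    have := hX.dist_triangle (u := q) (v := b') (w := b)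
    rw [SimpleGraph.dist_comm (u := b')] at this
    omega
  have key := hδ p q a b
  rw [SimpleGraph.dist_comm (u := p) (v := a), h1, h2, h5] at key
  have t1' : (X.dist q a : ℝ) ≤ i + D := by exact_mod_cast t1
  have t2' : (X.dist q b : ℝ) ≤ j + D := by exact_mod_cast t2
  push_cast at key
  have h6 : (X.dist p q : ℝ) ≤ D + 2 * δ := by
    rcases max_cases ((i : ℝ) + X.dist q b) (j + X.dist q a) with h | h <;> linarith [h.1]
  exact_mod_cast h6.trans (Nat.le_ceil _)

section Cayley

variable {G : Type*} [Group G] {S : Set G}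

theorem cayleyGraph_adj {x y : G} :
    (cayleyGraph G S).Adj x y ↔ x ≠ y ∧ (x⁻¹ * y ∈ S ∨ y⁻¹ * x ∈ S) := Iff.rfl

theorem cayleyGraph_dist_mul_left_le (hX : (cayleyGraph G S).Connected) (h x y : G) :
    (cayleyGraph G S).dist (h * x) (h * y) ≤ (cayleyGraph G S).dist x y := by
  obtain ⟨p, hp⟩ := hX.exists_walk_length_eq_dist x y
  let f : cayleyGraph G S →g cayleyGraph G S :=
    ⟨fun z => h * z, fun {z w} hzw => by
      rw [cayleyGraph_adj] at hzw ⊢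
      simpa [mul_assoc] using hzw⟩
  rw [← hp, ← p.length_map f]
  exact SimpleGraph.dist_le _

theorem cayleyGraph_dist_mul_left (hX : (cayleyGraph G S).Connected) (h x y : G) :
    (cayleyGraph G S).dist (h * x) (h * y) = (cayleyGraph G S).dist x y := by
  refine le_antisymm (cayleyGraph_dist_mul_left_le hX h x y) ?_
  simpa using cayleyGraph_dist_mul_left_le hX h⁻¹ (h * x) (h * y)

theorem cayleyGraph_finite_ball (hX : (cayleyGraph G S).Connected) (hfin : S.Finite) (n : ℕ) :
    {v | (cayleyGraph G S).dist 1 v ≤ n}.Finite := by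
  induction n with
  | zero =>
    refine (Set.finite_singleton (1 : G)).subset fun v hv => ?_
    exact (hX.dist_eq_zero_iff.1 (Nat.le_zero.1 hv)).symm
  | succ n ih =>
    refine (ih.union (Set.Finite.image2 (· * ·) ih (hfin.union (hfin.image (·⁻¹))))).subset
      fun v hv => ?_
    rcases Nat.lt_or_ge n ((cayleyGraph G S).dist 1 v) with h | h
    · obtain ⟨c, hc0, hc1, hc⟩ := hX.exists_geodesic_segment 1 v
      have hd : (cayleyGraph G S).dist 1 v = n + 1 := le_antisymm hv h
      have h1 := hc 0 n (by omega)
      have h2 := hc n 1 (by omega)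
      rw [zero_add, hc0] at h1
      rw [← hd, hc1, SimpleGraph.dist_eq_one_iff_adj, cayleyGraph_adj] at h2
      refine Or.inr ⟨c n, h1.le, (c n)⁻¹ * v, ?_, by simp⟩
      rcases h2.2 with h3 | h3
      · exact Or.inl h3
      · exact Or.inr ⟨_, h3, by simp⟩
    · exact Or.inl h

theorem IsGeodesicRay.mul_left (hX : (cayleyGraph G S).Connected) {γ : ℕ → G}
    (hγ : IsGeodesicRay (cayleyGraph G S) γ) (h : G) :
    IsGeodesicRay (cayleyGraph G S) fun i => h * γ i := fun i n => by
  rw [cayleyGraph_dist_mul_left hX, hγ i n]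

theorem MeetFrequently.mul_left {γ γ' : ℕ → G} {c : ℤ} (hm : MeetFrequently γ γ' c) (h : G) :
    MeetFrequently (fun i => h * γ i) (fun i => h * γ' i) c := fun N => by
  obtain ⟨i, hi, j, hij, e⟩ := hm N
  exact ⟨i, hi, j, by simp only [hij], e⟩

/-- If every translate of a geodesic ray by an element of `H` stays at bounded distance from it,
then the shifts at the meeting points embed `H` into `ℤ`. -/
theorem IsKGeodetic.exists_injective_hom {k : ℕ} (hgeo : IsKGeodetic (cayleyGraph G S) k)
    {γ : ℕ → G} (hγ : IsGeodesicRay (cayleyGraph G S) γ) (H : Subgroup G)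
    (hH : ∀ h ∈ H, ∃ C : ℕ, ∀ i, (cayleyGraph G S).dist (γ i) (h * γ i) ≤ C) :
    ∃ f : H →* Multiplicative ℤ, Function.Injective f := by
  have hX := hgeo.1
  have hex : ∀ h : H, ∃ c, MeetFrequently γ (fun i => h * γ i) c := fun h => by
    obtain ⟨C, hC⟩ := hH h h.2
    exact hgeo.exists_meetFrequently hγ (hγ.mul_left hX h) hC
  choose τ hτ using hex
  let f : H →* Multiplicative ℤ := MonoidHom.mk' (fun h => Multiplicative.ofAdd (τ h)) fun a b => by
    rw [← ofAdd_add]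
    congr 1
    refine MeetFrequently.eq_add hX hγ (hγ.mul_left hX a) (hγ.mul_left hX (a * b)) (hτ a) ?_
      (hτ (a * b))
    simpa only [mul_assoc] using (hτ b).mul_left (a : G)
  refine ⟨f, (injective_iff_map_eq_one f).2 fun h hh => ?_⟩
  have h0 : τ h = 0 := Multiplicative.ofAdd.injective hh
  obtain ⟨i, -, j, hij, e⟩ := hτ h 0
  obtain rfl : i = j := by omega
  exact Subtype.ext (right_eq_mul.1 hij)

end Cayley

/-- Let `G` be a hyperbolic group admitting a finite inverse-closed
generating set `S` such that `Cay(G, S)` is `k`-geodetic. Then for every element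
`g ∈ G` of infinite order, the centraliser of `g` is an infinite cyclic group
(isomorphic to `ℤ`). -/
theorem centralizer_infinite_cyclic_of_hyperbolic_kgeodetic {G : Type*} [Group G]
    (k : ℕ) (hk : 0 < k) (S : Set G) (hfin : S.Finite) (hinv : ∀ s ∈ S, s⁻¹ ∈ S)
    (hone : (1 : G) ∉ S) (hgen : Subgroup.closure S = ⊤)
    (hhyp : IsHyperbolic (cayleyGraph G S))
    (hgeo : IsKGeodetic (cayleyGraph G S) k)
    (g : G) (hg : ¬ IsOfFinOrder g) :
    Nonempty ((Subgroup.centralizer {g}) ≃* Multiplicative ℤ) := by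
  have hX := hgeo.1
  have hpow : Function.Injective fun n : ℕ => g ^ n :=
    injective_pow_iff_not_isOfFinOrder.2 hg
  obtain ⟨γ, hγ, hγg⟩ := exists_isGeodesicRay hX 1 (cayleyGraph_finite_ball hX hfin) _ hpow
  obtain ⟨f, hf⟩ := hgeo.exists_injective_hom hγ (Subgroup.centralizer {g}) fun h hh => by
    obtain ⟨C, hC⟩ := hhyp.exists_dist_le hX ((cayleyGraph G S).dist 1 h)
    refine ⟨C, fun i => ?_⟩
    obtain ⟨n, h1, h2⟩ := hγg i
    have hcomm : h * g ^ n = g ^ n * h :=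
      Commute.pow_right (Subgroup.mem_centralizer_singleton_iff.1 hh) n
    refine hC 1 (g ^ n) (h * 1) (h * g ^ n) (γ i) (h * γ i) i _ (by rw [mul_one]) ?_ h1 rfl
      (by rw [cayleyGraph_dist_mul_left hX, h1]) (cayleyGraph_dist_mul_left hX _ _ _) h2.symm
    have := cayleyGraph_dist_mul_left hX (g ^ n) 1 h
    rw [mul_one] at this
    rw [hcomm, this]
  have : IsCyclic (Subgroup.centralizer {g}) := isCyclic_of_injective f hf
  have : Infinite (Subgroup.centralizer {g}) :=
    Infinite.of_injective
      (fun n : ℕ => (⟨g ^ n, Subgroup.pow_mem _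
        (Subgroup.mem_centralizer_singleton_iff.2 rfl) n⟩ : Subgroup.centralizer {g}))
      fun m n h => hpow (congrArg Subtype.val h)
  obtain ⟨x, hx⟩ := IsCyclic.exists_zpow_surjective (G := Subgroup.centralizer {g})
  exact ⟨(intEquivOfZPowersEqTop x ((Subgroup.eq_top_iff' _).2 hx)).symm⟩
end
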